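/- arXiv:2601.00203 — 4 statements merged into one kernel-verified Lean document; each statement's English description precedes it below -/
import Mathlib

section
/- Let D ⊆ ℂ^n be an open set and let f be a Nash function on D. Then for each 1 ≤ i ≤ n the complex partial derivative ∂f/∂z_i (the function z ↦ (the complex Fréchet derivative of f at z applied to the i-th standard basis vector e_i of ℂ^n)) is a Nash function on D. -/
/-- `f` is a Nash function at `z₀ ∈ D`: there is an open neighbourhood `U ⊆ D`
of `z₀` and a nonzero polynomial `P` in `n+1` variables with `P(z, f z) = 0` on `U`. -/
def IsNashAt (n : ℕ) (D : Set (Fin n → ℂ)) (f : (Fin n → ℂ) → ℂ)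
    (z₀ : Fin n → ℂ) : Prop :=
  ∃ U : Set (Fin n → ℂ), IsOpen U ∧ z₀ ∈ U ∧ U ⊆ D ∧
    ∃ P : MvPolynomial (Fin (n + 1)) ℂ, P ≠ 0 ∧
      ∀ z ∈ U, MvPolynomial.eval (Fin.snoc z (f z)) P = 0

/-- `f` is a Nash function on the open set `D`: it is holomorphic on `D` and a
Nash function at every point of `D`. -/
def IsNashOn (n : ℕ) (D : Set (Fin n → ℂ)) (f : (Fin n → ℂ) → ℂ) : Prop :=
  DifferentiableOn ℂ f D ∧ ∀ z₀ ∈ D, IsNashAt n D f z₀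

open Metric in
theorem fderiv_bound_aux {E : Type*} [NormedAddCommGroup E] [NormedSpace ℂ E] {f : E → ℂ} {z₀ : E}
    {R M : ℝ} (hR : 0 < R) (hM : 0 ≤ M) (hf : DifferentiableOn ℂ f (ball z₀ R))
    (hb : ∀ z ∈ ball z₀ R, ‖f z‖ ≤ M) {z : E} (hz : z ∈ ball z₀ (R / 2)) :
    ‖fderiv ℂ f z‖ ≤ M / (R / 4) := by
  refine ContinuousLinearMap.opNorm_le_bound _ (by positivity) fun v => ?_
  by_cases hv : v = 0
  · simp [hv]
  have hv' : 0 < ‖v‖ := norm_pos_iff.mpr hv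
  have hmem : ∀ t ∈ closedBall (0 : ℂ) (R / 4 / ‖v‖), z + t • v ∈ ball z₀ R := by
    intro t ht
    rw [mem_closedBall_zero_iff, le_div_iff₀ hv'] at ht
    rw [mem_ball_iff_norm] at hz ⊢
    calc ‖z + t • v - z₀‖ = ‖(z - z₀) + t • v‖ := by congr 1; abel
      _ ≤ ‖z - z₀‖ + ‖t • v‖ := norm_add_le _ _
      _ < R := by rw [norm_smul]; linarith
  have hd : ∀ t ∈ closedBall (0 : ℂ) (R / 4 / ‖v‖),
      HasDerivAt (fun t : ℂ => f (z + t • v)) (fderiv ℂ f (z + t • v) v) t := by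
    intro t ht
    have h1 := (hf.differentiableAt (isOpen_ball.mem_nhds (hmem t ht))).hasFDerivAt
    have h2 : HasDerivAt (fun t : ℂ => z + t • v) v t := by
      simpa using ((hasDerivAt_id t).smul_const v).const_add z
    exact h1.comp_hasDerivAt t h2
  have hr : 0 < R / 4 / ‖v‖ := by positivity
  have := Complex.norm_deriv_le_of_forall_mem_sphere_norm_le (c := 0) (R := R / 4 / ‖v‖) (C := M)
    (f := fun t : ℂ => f (z + t • v)) hr
    (DifferentiableOn.diffContOnCl (fun t ht => (hd t
      (closure_ball_subset_closedBall ht)).differentiableAt.differentiableWithinAt))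
    (fun t ht => hb _ (hmem t (sphere_subset_closedBall ht)))
  rw [(hd 0 (mem_closedBall_self hr.le)).deriv] at this
  simp only [zero_smul, add_zero] at this
  calc _ ≤ _ := this
    _ = _ := by field_simp

open Metric in
theorem differentiableAt_pderiv_aux {E : Type*} [NormedAddCommGroup E] [NormedSpace ℂ E]
    [FiniteDimensional ℂ E] {f : E → ℂ} {D : Set E} (hD : IsOpen D)
    (hf : DifferentiableOn ℂ f D) (e : E) (he : ‖e‖ = 1) {z₀ : E} (hz₀ : z₀ ∈ D) :
    DifferentiableAt ℂ (fun z => fderiv ℂ f z e) z₀ := by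
  have : CompleteSpace E := FiniteDimensional.complete ℂ E
  borelize E
  have : SecondCountableTopology E := by
    have : ProperSpace E := FiniteDimensional.proper ℂ E
    infer_instance
  obtain ⟨R, M, hR, hM, hfR, hb⟩ : ∃ R M : ℝ, 0 < R ∧ 0 ≤ M ∧
      DifferentiableOn ℂ f (ball z₀ R) ∧ ∀ z ∈ ball z₀ R, ‖f z‖ ≤ M := by
    have hc : ContinuousAt f z₀ := (hf.differentiableAt (hD.mem_nhds hz₀)).continuousAt
    have h1 : ∀ᶠ z in nhds z₀, ‖f z‖ < ‖f z₀‖ + 1 :=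
      hc.norm.eventually_lt_const (lt_add_one _)
    obtain ⟨R, hR, h⟩ := Metric.eventually_nhds_iff_ball.1 (h1.and (hD.mem_nhds hz₀))
    exact ⟨R, ‖f z₀‖ + 1, hR, by positivity, hf.mono fun z hz => (h z hz).2,
      fun z hz => (h z hz).1.le⟩
  have hR4 : 0 < R / 4 := by positivity
  have hmem : ∀ z ∈ ball z₀ (R / 4), ∀ w ∈ closedBall (0 : ℂ) (R / 4),
      z + w • e ∈ ball z₀ (R / 2) := by
    intro z hz w hw
    rw [mem_closedBall_zero_iff] at hw
    rw [mem_ball_iff_norm] at hz ⊢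
    calc ‖z + w • e - z₀‖ = ‖(z - z₀) + w • e‖ := by congr 1; abel
      _ ≤ ‖z - z₀‖ + ‖w • e‖ := norm_add_le _ _
      _ < R / 2 := by rw [norm_smul, he]; linarith
  have hsub : ball z₀ (R / 2) ⊆ ball z₀ R := ball_subset_ball (by linarith)
  have hda : ∀ z ∈ ball z₀ (R / 2), DifferentiableAt ℂ f z := fun z hz =>
    hfR.differentiableAt (isOpen_ball.mem_nhds (hsub hz))
  have hform : ∀ z ∈ ball z₀ (R / 4), fderiv ℂ f z e = (2 * Real.pi * Complex.I)⁻¹ *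
      ∫ θ in (0 : ℝ)..2 * Real.pi, deriv (circleMap 0 (R / 4)) θ *
        (1 / (circleMap 0 (R / 4) θ) ^ 2) * f (z + circleMap 0 (R / 4) θ • e) := by
    intro z hz
    have hd : ∀ t ∈ closedBall (0 : ℂ) (R / 4),
        HasDerivAt (fun t : ℂ => f (z + t • e)) (fderiv ℂ f (z + t • e) e) t := by
      intro t ht
      have h1 := (hda _ (hmem z hz t ht)).hasFDerivAt
      have h2 : HasDerivAt (fun t : ℂ => z + t • e) e t := by
        simpa using ((hasDerivAt_id t).smul_const e).const_add z
      exact h1.comp_hasDerivAt t h2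
    have := DiffContOnCl.deriv_eq_smul_circleIntegral (c := 0) (f := fun t : ℂ => f (z + t • e)) hR4
      (DifferentiableOn.diffContOnCl (fun t ht => (hd t
      (closure_ball_subset_closedBall ht)).differentiableAt.differentiableWithinAt))
    rw [(hd 0 (mem_closedBall_self hR4.le)).deriv] at this
    simp only [zero_smul, add_zero, smul_eq_mul, sub_zero, circleIntegral] at this
    rw [eq_inv_mul_iff_mul_eq₀ Complex.two_pi_I_ne_zero, ← this]
    simp only [mul_assoc]
  have hcirc : ∀ θ, circleMap 0 (R / 4) θ ∈ closedBall (0 : ℂ) (R / 4) := fun θ =>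
    circleMap_mem_closedBall _ hR4.le _
  set k : ℝ → ℂ := fun θ => deriv (circleMap 0 (R / 4)) θ * (1 / (circleMap 0 (R / 4) θ) ^ 2)
    with hk
  have hkc : Continuous k := by
    have : ∀ θ, circleMap 0 (R / 4) θ ^ 2 ≠ 0 := fun θ =>
      pow_ne_zero _ (circleMap_ne_center hR4.ne')
    have h2 : Continuous (circleMap 0 (R / 4)) := continuous_circleMap _ _
    simp only [hk, deriv_circleMap]
    fun_prop (disch := assumption)
  have hFc : ∀ z ∈ ball z₀ (R / 4), Continuous fun θ => k θ * f (z + circleMap 0 (R / 4) θ • e) := by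
    intro z hz
    refine hkc.mul (continuous_iff_continuousAt.2 fun θ => ?_)
    have h2 : Continuous (circleMap 0 (R / 4)) := continuous_circleMap _ _
    exact ContinuousAt.comp (g := f) (f := fun θ => z + circleMap 0 (R / 4) θ • e)
      (hda _ (hmem z hz _ (hcirc θ))).continuousAt (by fun_prop)
  have hz₀' : z₀ ∈ ball z₀ (R / 4) := mem_ball_self hR4
  have hs : ball z₀ (R / 4) ∈ nhds z₀ := ball_mem_nhds _ hR4
  have key := intervalIntegral.hasFDerivAt_integral_of_dominated_of_fderiv_le (𝕜 := ℂ)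
    (μ := MeasureTheory.volume)
    (F := fun z θ => k θ * f (z + circleMap 0 (R / 4) θ • e)) (a := 0) (b := 2 * Real.pi)
    (F' := fun z θ => k θ • fderiv ℂ f (z + circleMap 0 (R / 4) θ • e))
    (bound := fun θ => ‖k θ‖ * (M / (R / 4)))
    (x₀ := z₀) hs
    (Filter.eventually_of_mem hs fun z hz => (hFc z hz).aestronglyMeasurable)
    ((hFc z₀ hz₀').intervalIntegrable _ _)
    (by
      have h2 : Continuous (circleMap 0 (R / 4)) := continuous_circleMap _ _
      have h3 : Continuous fun θ => z₀ + circleMap 0 (R / 4) θ • e := by fun_prop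
      refine AEMeasurable.aestronglyMeasurable ?_
      refine Measurable.aemeasurable ?_
      exact hkc.measurable.smul ((measurable_fderiv ℂ f).comp h3.measurable))
    (Filter.Eventually.of_forall fun θ _ z hz => by
      rw [norm_smul]
      exact mul_le_mul_of_nonneg_left
        (fderiv_bound_aux hR hM hfR hb (hmem z hz _ (hcirc θ))) (norm_nonneg _))
    ((hkc.norm.mul continuous_const).intervalIntegrable _ _)
    (Filter.Eventually.of_forall fun θ _ z hz => by
      have h1 := (hda _ (hmem z hz _ (hcirc θ))).hasFDerivAt
      have h2 : HasFDerivAt (fun z => z + circleMap 0 (R / 4) θ • e)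
        (ContinuousLinearMap.id ℂ E) z := (hasFDerivAt_id z).add_const _
      exact (h1.comp z h2).const_mul (k θ))
  have := key.differentiableAt.const_mul ((2 * Real.pi * Complex.I)⁻¹ : ℂ)
  refine this.congr_of_eventuallyEq (Filter.eventually_of_mem hs fun z hz => ?_)
  exact hform z hz

theorem isAlgebraic_derivation_aux {R A : Type*} [CommRing R] [IsDomain R] [CharZero R]
    [CommRing A] [IsDomain A] [Algebra R A] (hinj : Function.Injective (algebraMap R A))
    (d : Derivation ℤ A A) (hd : ∀ r : R, IsAlgebraic R (d (algebraMap R A r)))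
    (f : A) (hf : IsAlgebraic R f) : IsAlgebraic R (d f) := by
  classical
  have hex : ∃ m : ℕ, ∃ p : Polynomial R, p ≠ 0 ∧ Polynomial.aeval f p = 0 ∧ p.natDegree = m := by
    obtain ⟨p, hp, h⟩ := hf
    exact ⟨_, p, hp, h, rfl⟩
  obtain ⟨p, hp, hpf, hdeg⟩ := Nat.find_spec hex
  have hmin : ∀ q : Polynomial R, q ≠ 0 → Polynomial.aeval f q = 0 →
      p.natDegree ≤ q.natDegree := fun q hq hqf => by
    rw [hdeg]; exact Nat.find_min' hex ⟨q, hq, hqf, rfl⟩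
  have hpos : p.natDegree ≠ 0 := by
    intro h0
    rw [Polynomial.eq_C_of_natDegree_eq_zero h0, Polynomial.aeval_C] at hpf
    have := (injective_iff_map_eq_zero _).1 hinj _ hpf
    apply hp
    rw [Polynomial.eq_C_of_natDegree_eq_zero h0, this, Polynomial.C_0]
  have hder : Polynomial.derivative p ≠ 0 := fun h =>
    hpos (Polynomial.derivative_eq_zero.1 h)
  have hne : Polynomial.aeval f (Polynomial.derivative p) ≠ 0 := fun h =>
    absurd (hmin _ hder h) (not_le.2 (Polynomial.natDegree_derivative_lt hpos))
  have halg : ∀ q : Polynomial R, IsAlgebraic R (Polynomial.aeval f q) := fun q =>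
    by
    rw [Polynomial.aeval_eq_sum_range]
    exact (Subalgebra.algebraicClosure R A).sum_mem fun i _ => (hf.pow i).smul _
  have hgen : ∀ q : Polynomial R, IsAlgebraic R
      (d (Polynomial.aeval f q) - Polynomial.aeval f (Polynomial.derivative q) * d f) := by
    intro q
    induction q using Polynomial.induction_on' with
    | add p q hp hq =>
      convert hp.add hq using 1
      simp only [map_add]; ring
    | monomial k a =>
      have : d (Polynomial.aeval f (Polynomial.monomial k a)) -
          Polynomial.aeval f (Polynomial.derivative (Polynomial.monomial k a)) * d f
          = f ^ k * d (algebraMap R A a) := by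
        rw [Polynomial.aeval_monomial, Polynomial.derivative_monomial, Polynomial.aeval_monomial,
          Derivation.leibniz, Derivation.leibniz_pow]
        simp only [smul_eq_mul, nsmul_eq_mul, map_mul, map_natCast]
        ring
      rw [this]
      exact (hf.pow k).mul (hd a)
  have h1 := (hgen p).neg
  rw [hpf, map_zero, zero_sub, neg_neg] at h1
  exact IsAlgebraic.of_mul (mem_nonZeroDivisors_of_ne_zero hne) (halg _) h1

/-- The ring of holomorphic functions on `U`. -/
def holRing {n : ℕ} (U : Set (Fin n → ℂ)) : Subring (U → ℂ) where
  carrier := {F | ∃ G : (Fin n → ℂ) → ℂ, DifferentiableOn ℂ G U ∧ ∀ z : U, G z = F z}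
  mul_mem' := by
    rintro a b ⟨G, hG, h⟩ ⟨G', hG', h'⟩
    exact ⟨G * G', hG.mul hG', fun z => by simp [h, h']⟩
  one_mem' := ⟨fun _ => 1, differentiableOn_const _, fun z => rfl⟩
  add_mem' := by
    rintro a b ⟨G, hG, h⟩ ⟨G', hG', h'⟩
    exact ⟨G + G', hG.add hG', fun z => by simp [h, h']⟩
  zero_mem' := ⟨fun _ => 0, differentiableOn_const _, fun z => rfl⟩
  neg_mem' := by
    rintro a ⟨G, hG, h⟩
    exact ⟨-G, hG.neg, fun z => by simp [h]⟩

theorem holRing_isDomain {n : ℕ} {U : Set (Fin n → ℂ)} (hU : IsOpen U) (hc : Convex ℝ U)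
    (hne : U.Nonempty) : IsDomain (holRing U) := by
  obtain ⟨u, hu⟩ := hne
  have : Nontrivial (holRing U) := ⟨0, 1, fun h => by
    have := congrFun (congrArg Subtype.val h) ⟨u, hu⟩
    simp at this⟩
  have : NoZeroDivisors (holRing U) := by
    refine ⟨?_⟩
    rintro ⟨F, G, hG, hFG⟩ ⟨F', G', hG', hFG'⟩ h
    have hmul : ∀ z ∈ U, G z * G' z = 0 := by
      intro z hz
      have := congrFun (congrArg Subtype.val h) ⟨z, hz⟩
      simpa [← hFG ⟨z, hz⟩, ← hFG' ⟨z, hz⟩] using this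
    by_contra hcon
    push Not at hcon
    obtain ⟨h1, h2⟩ := hcon
    have h1' : ∃ a ∈ U, G a ≠ 0 := by
      by_contra! hh
      exact h1 (Subtype.ext (funext fun z => (hFG z).symm.trans (hh z z.2)))
    have h2' : ∃ a ∈ U, G' a ≠ 0 := by
      by_contra! hh
      exact h2 (Subtype.ext (funext fun z => (hFG' z).symm.trans (hh z z.2)))
    obtain ⟨a, ha, hGa⟩ := h1'
    obtain ⟨b, hb, hGb⟩ := h2'
    set L : ℂ → (Fin n → ℂ) := fun t => a + t • (b - a) with hL
    have hLd : Differentiable ℂ L := by simp only [hL]; fun_prop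
    have hV : IsOpen (L ⁻¹' U) := hU.preimage hLd.continuous
    have hVc : Convex ℝ (L ⁻¹' U) := by
      intro x hx y hy s t hs ht hst
      have := hc hx hy hs ht hst
      have e : L (s • x + t • y) = s • L x + t • L y := by
        have h1 : (s : ℂ) + t = 1 := by exact_mod_cast hst
        ext j
        simp only [hL, Pi.add_apply, Pi.smul_apply, smul_eq_mul, Complex.real_smul, Pi.sub_apply]
        linear_combination (- a j) * h1
      show L (s • x + t • y) ∈ U
      rw [e]; exact this
    have hm : Set.MapsTo L (L ⁻¹' U) U := fun _ h => h
    have := AnalyticOnNhd.eq_zero_or_eq_zero_of_mul_eq_zero (f := G ∘ L) (g := G' ∘ L)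
      ((hG.comp hLd.differentiableOn hm).analyticOnNhd hV)
      ((hG'.comp hLd.differentiableOn hm).analyticOnNhd hV)
      (fun z hz => hmul _ hz) hVc.isPreconnected
    have hL0 : L 0 = a := by simp [hL]
    have hL1 : L 1 = b := by simp [hL]
    rcases this with h | h
    · exact hGa (by simpa [hL0] using h 0 (by simpa [hL0] using ha))
    · exact hGb (by simpa [hL1] using h 1 (by simpa [hL1] using hb))
  exact NoZeroDivisors.to_isDomain _

theorem differentiable_mvPolynomial_eval_aux {n : ℕ} (p : MvPolynomial (Fin n) ℂ) :
    Differentiable ℂ (fun z : Fin n → ℂ => MvPolynomial.eval z p) := by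
  induction p using MvPolynomial.induction_on with
  | C a => simp
  | add p q hp hq => simp only [map_add]; exact hp.add hq
  | mul_X p i hp =>
    simp only [map_mul, MvPolynomial.eval_X]
    exact hp.mul (by fun_prop)

/-- The inclusion of polynomials into holomorphic functions. -/
noncomputable def polyToHol {n : ℕ} (U : Set (Fin n → ℂ)) : MvPolynomial (Fin n) ℂ →+* holRing U where
  toFun p := ⟨fun z => MvPolynomial.eval z.1 p, fun z => MvPolynomial.eval z p,
    (differentiable_mvPolynomial_eval_aux p).differentiableOn, fun _ => rfl⟩
  map_one' := by ext; simp
  map_mul' p q := by ext; simp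
  map_zero' := by ext; simp
  map_add' p q := by ext; simp

theorem mvPolynomial_eq_zero_aux {n : ℕ} {U : Set (Fin n → ℂ)} (hU : IsOpen U) (hne : U.Nonempty)
    (p : MvPolynomial (Fin n) ℂ) (hp : ∀ z ∈ U, MvPolynomial.eval z p = 0) : p = 0 := by
  obtain ⟨u, hu⟩ := hne
  obtain ⟨r, hr, hb⟩ := Metric.isOpen_iff.1 hU u hu
  refine MvPolynomial.funext_set (fun i => Metric.ball (u i) r) (fun i => ?_) fun x hx => ?_
  · exact infinite_of_mem_nhds (u i) (Metric.ball_mem_nhds _ hr)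
  · rw [map_zero]
    apply hp _ (hb _)
    rw [ball_pi _ hr]
    exact hx

theorem norm_single_aux {n : ℕ} (i : Fin n) : ‖(Pi.single i 1 : Fin n → ℂ)‖ = 1 := by
  rw [Pi.norm_single, norm_one]

/-- Partial derivative on the ring of holomorphic functions. -/
noncomputable def holDeriv {n : ℕ} {U : Set (Fin n → ℂ)} (hU : IsOpen U) (i : Fin n) :
    Derivation ℤ (holRing U) (holRing U) :=
  have key : ∀ (G G' : (Fin n → ℂ) → ℂ), (∀ z ∈ U, G z = G' z) → ∀ z ∈ U,
      fderiv ℂ G z = fderiv ℂ G' z := fun G G' h z hz =>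
    Filter.EventuallyEq.fderiv_eq (Filter.eventually_of_mem (hU.mem_nhds hz) h)
  Derivation.mk'
    (AddMonoidHom.toIntLinearMap
      { toFun := fun F => ⟨fun z => fderiv ℂ F.2.choose z (Pi.single i 1),
          fun z => fderiv ℂ F.2.choose z (Pi.single i 1),
          fun z hz => (differentiableAt_pderiv_aux hU F.2.choose_spec.1 (Pi.single i 1)
            (norm_single_aux i) hz).differentiableWithinAt,
          fun _ => rfl⟩
        map_zero' := by
          ext z
          have h := key (0 : holRing U).2.choose 0 (fun z hz => by
            rw [(0 : holRing U).2.choose_spec.2 ⟨z, hz⟩]; rfl) z z.2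
          show fderiv ℂ _ _ _ = 0
          rw [h]; simp
        map_add' := fun F F' => by
          ext z
          have h := key (F + F').2.choose (F.2.choose + F'.2.choose) (fun z hz => by
            rw [(F + F').2.choose_spec.2 ⟨z, hz⟩, Pi.add_apply, F.2.choose_spec.2 ⟨z, hz⟩,
              F'.2.choose_spec.2 ⟨z, hz⟩]; rfl) z z.2
          simp only [h]
          rw [fderiv_add (F.2.choose_spec.1.differentiableAt (hU.mem_nhds z.2))
            (F'.2.choose_spec.1.differentiableAt (hU.mem_nhds z.2))]
          simp })
    (fun F F' => by
      ext z
      have h := key (F * F').2.choose (F.2.choose * F'.2.choose) (fun z hz => by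
        rw [(F * F').2.choose_spec.2 ⟨z, hz⟩, Pi.mul_apply, F.2.choose_spec.2 ⟨z, hz⟩,
          F'.2.choose_spec.2 ⟨z, hz⟩]; rfl) z z.2
      simp only [AddMonoidHom.coe_toIntLinearMap, AddMonoidHom.coe_mk, ZeroHom.coe_mk, h]
      rw [fderiv_mul (F.2.choose_spec.1.differentiableAt (hU.mem_nhds z.2))
        (F'.2.choose_spec.1.differentiableAt (hU.mem_nhds z.2))]
      simp [F.2.choose_spec.2 z, F'.2.choose_spec.2 z])

theorem holDeriv_apply {n : ℕ} {U : Set (Fin n → ℂ)} (hU : IsOpen U) (i : Fin n)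
    (F : holRing U) (G : (Fin n → ℂ) → ℂ) (h : ∀ z : U, G z = F.1 z) (z : U) :
    (holDeriv hU i F).1 z = fderiv ℂ G z (Pi.single i 1) := by
  show fderiv ℂ F.2.choose z (Pi.single i 1) = _
  congr 1
  exact Filter.EventuallyEq.fderiv_eq (Filter.eventually_of_mem (hU.mem_nhds z.2) fun w hw => by
    rw [F.2.choose_spec.2 ⟨w, hw⟩, h ⟨w, hw⟩])

theorem isAlgebraic_hol_iff {n : ℕ} {U : Set (Fin n → ℂ)} (F : holRing U) :
    letI := (polyToHol U).toAlgebra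
    IsAlgebraic (MvPolynomial (Fin n) ℂ) F ↔
    ∃ P : MvPolynomial (Fin (n + 1)) ℂ, P ≠ 0 ∧
      ∀ z : U, MvPolynomial.eval (Fin.snoc z.1 (F.1 z) : Fin (n + 1) → ℂ) P = 0 := by
  let := (polyToHol U).toAlgebra
  have hev : ∀ P : MvPolynomial (Fin (n + 1)) ℂ, ∀ z : U,
      (Polynomial.aeval F (MvPolynomial.finSuccEquiv ℂ n
        (MvPolynomial.rename (finRotate (n + 1)) P))).1 z
      = MvPolynomial.eval (Fin.snoc z.1 (F.1 z) : Fin (n + 1) → ℂ) P := by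
    intro P z
    let ev : holRing U →+* ℂ := (Pi.evalRingHom (fun _ : U => ℂ) z).comp (holRing U).subtype
    have hcomp : ev.comp (algebraMap (MvPolynomial (Fin n) ℂ) (holRing U))
        = MvPolynomial.eval z.1 := RingHom.ext fun q => rfl
    have hcd : (Fin.cons (F.1 z) z.1 : Fin (n + 1) → ℂ) ∘ finRotate (n + 1) =
        fun j => (Fin.cons (F.1 z) z.1 : Fin (n + 1) → ℂ) (finRotate (n + 1) j) := rfl
    show ev _ = _
    rw [Polynomial.aeval_def, Polynomial.hom_eval₂, hcomp, Fin.snoc_eq_cons_rotate,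
      ← hcd, ← MvPolynomial.eval_rename, MvPolynomial.eval_eq_eval_mv_eval',
      Polynomial.eval_map]
    rfl
  constructor
  · rintro ⟨p, hp, h⟩
    obtain ⟨Q, rfl⟩ := (MvPolynomial.finSuccEquiv ℂ n).surjective p
    obtain ⟨P, rfl⟩ := (MvPolynomial.renameEquiv ℂ (finRotate (n + 1))).surjective Q
    refine ⟨P, ?_, fun z => ?_⟩
    · rintro rfl
      simp at hp
    · rw [← hev]
      rw [MvPolynomial.renameEquiv_apply] at h
      rw [h]; rfl
  · rintro ⟨P, hP, h⟩
    refine ⟨_, ?_, Subtype.ext (funext fun z => (hev P z).trans (h z))⟩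
    rw [Ne, map_eq_zero_iff _ (MvPolynomial.finSuccEquiv ℂ n).injective,
      map_eq_zero_iff _ (MvPolynomial.rename_injective _ (finRotate (n + 1)).injective)]
    exact hP

theorem isAlgebraic_holDeriv {n : ℕ} {U : Set (Fin n → ℂ)} (hU : IsOpen U) (hc : Convex ℝ U)
    (hne : U.Nonempty) (i : Fin n) (F : holRing U) :
    letI := (polyToHol U).toAlgebra
    IsAlgebraic (MvPolynomial (Fin n) ℂ) F →
      IsAlgebraic (MvPolynomial (Fin n) ℂ) (holDeriv hU i F) := by
  let := (polyToHol U).toAlgebra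
  have := holRing_isDomain hU hc hne
  intro hF
  have hinj : Function.Injective (algebraMap (MvPolynomial (Fin n) ℂ) (holRing U)) := by
    rw [injective_iff_map_eq_zero]
    intro p hp
    exact mvPolynomial_eq_zero_aux hU hne p fun z hz =>
      congrFun (congrArg Subtype.val hp) ⟨z, hz⟩
  refine isAlgebraic_derivation_aux hinj (holDeriv hU i) (fun r => ?_) F hF
  have hconst : ∀ (G : holRing U) (c : ℂ), (∀ z, G.1 z = c) →
      IsAlgebraic (MvPolynomial (Fin n) ℂ) G := by
    intro G c h
    have : G = algebraMap (MvPolynomial (Fin n) ℂ) (holRing U) (MvPolynomial.C c) :=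
      Subtype.ext (funext fun z => by
        rw [h z]; exact (MvPolynomial.eval_C (f := z.1) c).symm)
    rw [this]
    exact isAlgebraic_algebraMap _
  induction r using MvPolynomial.induction_on with
  | C a =>
    refine hconst _ 0 fun z => ?_
    rw [holDeriv_apply hU i _ (fun _ => a) (fun z => (MvPolynomial.eval_C (f := z.1) a).symm)]
    simp
  | add p q hp hq => rw [map_add, map_add]; exact hp.add hq
  | mul_X p j hp =>
    rw [map_mul, Derivation.leibniz]
    refine IsAlgebraic.add ?_ ?_
    · refine (isAlgebraic_algebraMap _).mul (hconst _ ((Pi.single i 1 : Fin n → ℂ) j) fun z => ?_)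
      rw [holDeriv_apply hU i _ (fun z => z j)
        (fun z => (MvPolynomial.eval_X (f := z.1) j).symm)]
      have : HasFDerivAt (fun z : Fin n → ℂ => z j)
        (ContinuousLinearMap.proj (R := ℂ) (φ := fun _ : Fin n => ℂ) j) z.1 := hasFDerivAt_apply j z.1
      rw [this.fderiv]; rfl
    · exact (isAlgebraic_algebraMap _).mul hp

theorem nash_pderiv (n : ℕ) (hn : 0 < n) (D : Set (Fin n → ℂ)) (hD : IsOpen D)
    (f : (Fin n → ℂ) → ℂ) (hf : IsNashOn n D f) (i : Fin n) :
    IsNashOn n D (fun z => fderiv ℂ f z (Pi.single i 1)) := by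
  obtain ⟨hdiff, hnash⟩ := hf
  refine ⟨fun z hz => (differentiableAt_pderiv_aux hD hdiff (Pi.single i 1)
    (norm_single_aux i) hz).differentiableWithinAt, fun z₀ hz₀ => ?_⟩
  obtain ⟨V, hV, hzV, hVD, P, hP, hPf⟩ := hnash z₀ hz₀
  obtain ⟨r, hr, hb⟩ := Metric.isOpen_iff.1 hV z₀ hzV
  have hU : IsOpen (Metric.ball z₀ r) := Metric.isOpen_ball
  let F : holRing (Metric.ball z₀ r) := ⟨fun z => f z, f, hdiff.mono (hb.trans hVD), fun _ => rfl⟩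
  have h := isAlgebraic_holDeriv hU (convex_ball z₀ r) ⟨z₀, Metric.mem_ball_self hr⟩ i F
    ((isAlgebraic_hol_iff F).2 ⟨P, hP, fun z => hPf z (hb z.2)⟩)
  obtain ⟨Q, hQ, hQf⟩ := (isAlgebraic_hol_iff _).1 h
  refine ⟨_, hU, Metric.mem_ball_self hr, hb.trans hVD, Q, hQ, fun z hz => ?_⟩
  have := hQf ⟨z, hz⟩
  rwa [holDeriv_apply hU i F f (fun _ => rfl)] at this
end

section
/- Let D ⊆ ℂ^n and D' ⊆ ℂ^m be open sets, let g₁, …, g_m be Nash functions on D such that (g₁(z), …, g_m(z)) ∈ D' for every z ∈ D, and let f be a Nash function on D'. Then the composition z ↦ f(g₁(z), …, g_m(z)) is a Nash function on D. -/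
open Polynomial in
/-- Evaluation of a bivariate polynomial through a ring homomorphism. -/
noncomputable def nashEv {S : Type*} [CommRing S] (e : S →+* ℂ) (a b : ℂ) : S[X][X] →+* ℂ :=
  eval₂RingHom (eval₂RingHom e a) b

open Polynomial in
lemma nashEv_swap {S : Type*} [CommRing S] (e : S →+* ℂ) (a b : ℂ) (p : S[X][X]) :
    nashEv e a b (Bivariate.swap p) = nashEv e b a p := by
  have : (nashEv e a b).comp (Bivariate.swap (R := S) : S[X][X] ≃ₐ[S] S[X][X]).toAlgHom.toRingHom
      = nashEv e b a := by
    ext x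
    · change nashEv e a b (Bivariate.swap (C (C x))) = _
      rw [Bivariate.swap_C_C]; simp [nashEv]
    · change nashEv e a b (Bivariate.swap (C X)) = _
      rw [Bivariate.swap_X]; simp [nashEv]
    · change nashEv e a b (Bivariate.swap X) = _
      rw [Bivariate.swap_Y]; simp [nashEv]
  exact congrArg (fun h : S[X][X] →+* ℂ => h p) this

open Polynomial in
lemma nashEv_continuous {S : Type*} [CommRing S] (e : S →+* ℂ) (p : S[X][X]) :
    Continuous (fun x : ℂ × ℂ => nashEv e x.1 x.2 p) := by
  simp only [nashEv, coe_eval₂RingHom, eval₂_eq_sum_range]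
  fun_prop

open Polynomial Topology in
lemma nash_core {S : Type*} [CommRing S] {ι : Type*} {m : ℕ}
    (q : (MvPolynomial (Fin m) ℂ)[X]) (hq : q ≠ 0) (c : ℂ →+* S) (g : Fin m → S)
    (ev : ι → S →+* ℂ) (hc : ∀ i x, ev i (c x) = x) (i₀ : ι) (f : (Fin m → ℂ) → ℂ)
    (hf : ∀ i, ContinuousAt f (fun j => ev i (g j)))
    (hqf : ∀ i, ∀ᶠ w in 𝓝 (fun j => ev i (g j)), (q.map (MvPolynomial.eval w)).eval (f w) = 0) :
    ∃ p : S[X], p ≠ 0 ∧ ∀ i, p.eval₂ (ev i) (f (fun j => ev i (g j))) = 0 := by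
  obtain ⟨k, hk⟩ : ∃ k, q.coeff k ≠ 0 := by
    by_contra! h
    exact hq (Polynomial.ext (by simpa using h))
  obtain ⟨w₁, hw₁⟩ : ∃ w, MvPolynomial.eval w (q.coeff k) ≠ 0 := by
    by_contra! h
    exact hk (MvPolynomial.funext (by simpa using h))
  set v : Fin m → ℂ := fun j => w₁ j - ev i₀ (g j) with hv
  let φ : MvPolynomial (Fin m) ℂ →+* S[X] :=
    MvPolynomial.eval₂Hom (C.comp c) (fun j => C (g j) + X * C (c (v j)))
  have hφ : ∀ i t (P : MvPolynomial (Fin m) ℂ), (φ P).eval₂ (ev i) t =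
      MvPolynomial.eval (fun j => ev i (g j) + t * v j) P := by
    intro i t P
    have : (eval₂RingHom (ev i) t).comp φ =
        MvPolynomial.eval (fun j => ev i (g j) + t * v j) := by
      ext <;> simp [φ, hc] <;> ring
    exact congrArg (fun h : MvPolynomial (Fin m) ℂ →+* ℂ => h P) this
  have hne : q.map φ ≠ 0 := by
    intro h0
    have h1 : φ (q.coeff k) = 0 := by rw [← coeff_map, h0, coeff_zero]
    have h2 := hφ i₀ 1 (q.coeff k)
    rw [h1] at h2
    apply hw₁
    rw [eval₂_zero] at h2
    rw [h2]
    congr 2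
    funext j
    simp [hv]
  have hev : ∀ i t y, nashEv (ev i) t y (q.map φ) =
      (q.map (MvPolynomial.eval (fun j => ev i (g j) + t * v j))).eval y := by
    intro i t y
    rw [nashEv, coe_eval₂RingHom, eval₂_map, eval_map]
    congr 1
    ext <;> simp [φ, hc] <;> ring
  have hne' : Bivariate.swap (q.map φ) ≠ 0 := by
    simpa using hne
  obtain ⟨r, hr, hr0⟩ := exists_eq_pow_rootMultiplicity_mul_and_not_dvd _ hne' 0
  set d := rootMultiplicity 0 (Bivariate.swap (q.map φ))
  rw [map_zero, sub_zero] at hr hr0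
  rw [X_dvd_iff] at hr0
  refine ⟨r.coeff 0, hr0, fun i => ?_⟩
  have e0 : (r.coeff 0).eval₂ (ev i) (f (fun j => ev i (g j))) =
      nashEv (ev i) (f (fun j => ev i (g j))) 0 r := by
    simp [nashEv, eval₂_at_zero, coeff_zero_eq_eval_zero]
  rw [e0]
  have hline : ContinuousAt (fun t : ℂ => (fun j => ev i (g j) + t * v j)) 0 :=
    Continuous.continuousAt (by fun_prop)
  have hl0 : (fun j => ev i (g j) + (0:ℂ) * v j) = fun j => ev i (g j) := by simp
  set G : ℂ → ℂ := fun t => nashEv (ev i) (f (fun j => ev i (g j) + t * v j)) t r with hG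
  have hGc : ContinuousAt G 0 := by
    have h1 : ContinuousAt (fun t : ℂ => f (fun j => ev i (g j) + t * v j)) 0 := by
      apply ContinuousAt.comp (g := f) (f := fun t : ℂ => (fun j => ev i (g j) + t * v j)) _ hline
      rw [hl0]; exact hf i
    exact ContinuousAt.comp (g := fun x : ℂ × ℂ => nashEv (ev i) x.1 x.2 r)
      (f := fun t : ℂ => (f (fun j => ev i (g j) + t * v j), t))
      (nashEv_continuous (ev i) r).continuousAt (h1.prodMk continuousAt_id)
  have hG0 : ∀ᶠ t in 𝓝[≠] (0:ℂ), G t = 0 := by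
    have h2 : ∀ᶠ t in 𝓝 (0:ℂ), (q.map (MvPolynomial.eval (fun j => ev i (g j) + t * v j))).eval
        (f (fun j => ev i (g j) + t * v j)) = 0 := by
      have h3 := hqf i
      rw [← hl0] at h3
      exact hline.eventually h3
    filter_upwards [h2.filter_mono nhdsWithin_le_nhds, self_mem_nhdsWithin] with t ht ht0
    rw [← hev, ← nashEv_swap, hr, map_mul, map_pow] at ht
    rcases mul_eq_zero.1 ht with h | h
    · exfalso
      apply ht0
      simpa [nashEv] using eq_zero_of_pow_eq_zero h
    · exact h
  have hlim : Filter.Tendsto G (𝓝[≠] 0) (𝓝 (G 0)) := hGc.tendsto.mono_left nhdsWithin_le_nhds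
  have : G 0 = 0 := tendsto_nhds_unique (hlim.congr' hG0) tendsto_const_nhds
  rw [hG] at this
  simpa using this

/-- Holomorphic functions on a set. -/
def nashHol {n : ℕ} (B : Set (Fin n → ℂ)) : Subring (B → ℂ) where
  carrier := {h | ∃ H : (Fin n → ℂ) → ℂ, DifferentiableOn ℂ H B ∧ ∀ z : B, h z = H z}
  mul_mem' := by
    rintro a b ⟨H, h1, h2⟩ ⟨K, k1, k2⟩
    exact ⟨fun z => H z * K z, h1.mul k1, fun z => by simp [h2, k2]⟩
  add_mem' := by
    rintro a b ⟨H, h1, h2⟩ ⟨K, k1, k2⟩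
    exact ⟨fun z => H z + K z, h1.add k1, fun z => by simp [h2, k2]⟩
  neg_mem' := by
    rintro a ⟨H, h1, h2⟩
    exact ⟨fun z => - H z, h1.neg, fun z => by simp [h2]⟩
  one_mem' := ⟨fun _ => 1, by fun_prop, fun z => rfl⟩
  zero_mem' := ⟨fun _ => 0, by fun_prop, fun z => rfl⟩

lemma nashHol_noZeroDivisors {n : ℕ} (B : Set (Fin n → ℂ)) (hB : IsOpen B) (hc : Convex ℝ B) :
    NoZeroDivisors (nashHol B) := by
  constructor
  rintro ⟨a, H, h1, h2⟩ ⟨b, K, k1, k2⟩ hab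
  by_contra! hcon
  obtain ⟨ha, hb⟩ := hcon
  obtain ⟨x, hx⟩ : ∃ x, a x ≠ 0 := by
    by_contra! h
    exact ha (Subtype.ext (funext h))
  obtain ⟨y, hy⟩ : ∃ x, b x ≠ 0 := by
    by_contra! h
    exact hb (Subtype.ext (funext h))
  let L : ℂ → (Fin n → ℂ) := fun t => x.1 + t • (y.1 - x.1)
  have hL : Differentiable ℂ L := by fun_prop
  have hO : IsOpen (L ⁻¹' B) := hB.preimage hL.continuous
  have hcv : Convex ℝ (L ⁻¹' B) := by
    intro s hs t ht α β hα hβ hαβ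
    have := hc hs ht hα hβ hαβ
    have e : L (α • s + β • t) = α • L s + β • L t := by
      funext j
      have : (α:ℂ) + β = 1 := by exact_mod_cast hαβ
      simp only [L, Pi.add_apply, Pi.smul_apply, smul_eq_mul, Complex.real_smul]
      linear_combination (-(x.1 j)) * this
    rw [Set.mem_preimage, e]; exact this
  have hH : AnalyticOnNhd ℂ (H ∘ L) (L ⁻¹' B) :=
    (h1.comp hL.differentiableOn (fun _ h => h)).analyticOnNhd hO
  have hK : AnalyticOnNhd ℂ (K ∘ L) (L ⁻¹' B) :=
    (k1.comp hL.differentiableOn (fun _ h => h)).analyticOnNhd hO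
  have hz : ∀ t ∈ L ⁻¹' B, (H ∘ L) t • (K ∘ L) t = 0 := by
    intro t ht
    have := congrFun (congrArg Subtype.val hab) ⟨L t, ht⟩
    simpa [h2, k2] using this
  rcases hH.eq_zero_or_eq_zero_of_smul_eq_zero hK hz hcv.isPreconnected with h | h
  · apply hx
    have := h 0 (by simp [L])
    rw [h2]; simpa [L] using this
  · apply hy
    have := h 1 (by simp [L])
    rw [k2]; simpa [L] using this

/-- Restriction of polynomials to a set. -/
noncomputable def nashPoly {n : ℕ} (B : Set (Fin n → ℂ)) :
    MvPolynomial (Fin n) ℂ →+* nashHol B where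
  toFun P := ⟨fun z => MvPolynomial.eval z.1 P, fun z => MvPolynomial.eval z P, by
    intro z hz
    apply DifferentiableAt.differentiableWithinAt
    induction P using MvPolynomial.induction_on with
    | C a => simp
    | add p q hp hq => simp only [map_add]; exact hp.add hq
    | mul_X p i hp => simp only [map_mul, MvPolynomial.eval_X]; exact hp.mul (differentiableAt_apply i z), fun z => rfl⟩
  map_one' := by ext; simp
  map_zero' := by ext; simp
  map_add' _ _ := by ext; simp
  map_mul' _ _ := by ext; simp

noncomputable instance nashAlg {n : ℕ} (B : Set (Fin n → ℂ)) :
    Algebra (MvPolynomial (Fin n) ℂ) (nashHol B) := (nashPoly B).toAlgebra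

/-- Evaluation at a point. -/
def nashPt {n : ℕ} (B : Set (Fin n → ℂ)) (z : B) : nashHol B →+* ℂ :=
  (Pi.evalRingHom _ z).comp (nashHol B).subtype

open Polynomial in
lemma nash_aeval {n : ℕ} (B : Set (Fin n → ℂ)) (h : nashHol B)
    (q : (MvPolynomial (Fin n) ℂ)[X]) (z : B) :
    (aeval h q).1 z = (q.map (MvPolynomial.eval z.1)).eval (h.1 z) := by
  change nashPt B z (aeval h q) = _
  rw [aeval_def, hom_eval₂, eval_map]
  rfl

open Polynomial in
lemma nash_conv {n : ℕ} (P : MvPolynomial (Fin (n+1)) ℂ) (z : Fin n → ℂ) (y : ℂ) :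
    MvPolynomial.eval (Fin.snoc z y) P =
    ((((MvPolynomial.renameEquiv ℂ finSuccEquivLast).trans
      (MvPolynomial.optionEquivLeft ℂ (Fin n))) P).map (MvPolynomial.eval z)).eval y := by
  rw [AlgEquiv.trans_apply, ← MvPolynomial.optionEquivLeft_elim_eval,
    MvPolynomial.renameEquiv_apply, MvPolynomial.eval_rename]
  congr 2
  funext i
  refine Fin.lastCases ?_ (fun j => ?_) i <;> simp

open Polynomial in
lemma nash_iff {n : ℕ} (U : Set (Fin n → ℂ)) (h : (Fin n → ℂ) → ℂ) :
    (∃ P : MvPolynomial (Fin (n + 1)) ℂ, P ≠ 0 ∧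
      ∀ z ∈ U, MvPolynomial.eval (Fin.snoc z (h z)) P = 0) ↔
    ∃ q : (MvPolynomial (Fin n) ℂ)[X], q ≠ 0 ∧
      ∀ z ∈ U, (q.map (MvPolynomial.eval z)).eval (h z) = 0 := by
  constructor
  · rintro ⟨P, hP, h⟩
    exact ⟨_, (map_ne_zero_iff _ (AlgEquiv.injective _)).2 hP, fun z hz => by
      rw [← nash_conv]; exact h z hz⟩
  · rintro ⟨q, hq, h⟩
    refine ⟨((MvPolynomial.renameEquiv ℂ finSuccEquivLast).trans
      (MvPolynomial.optionEquivLeft ℂ (Fin n))).symm q,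
      (map_ne_zero_iff _ (AlgEquiv.injective _)).2 hq, fun z hz => ?_⟩
    rw [nash_conv, AlgEquiv.apply_symm_apply]; exact h z hz

lemma nash_isAlgebraic_iff {n : ℕ} (B : Set (Fin n → ℂ)) (H : (Fin n → ℂ) → ℂ)
    (hH : DifferentiableOn ℂ H B) :
    IsAlgebraic (MvPolynomial (Fin n) ℂ) (⟨fun z => H z.1, H, hH, fun _ => rfl⟩ : nashHol B) ↔
    ∃ P : MvPolynomial (Fin (n + 1)) ℂ, P ≠ 0 ∧
      ∀ z ∈ B, MvPolynomial.eval (Fin.snoc z (H z)) P = 0 := by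
  rw [nash_iff]
  refine exists_congr fun q => and_congr_right fun _ => ?_
  rw [Subtype.ext_iff, funext_iff]
  simp only [nash_aeval, Subtype.forall]
  rfl

theorem nash_comp (n m : ℕ) (hn : 0 < n) (hm : 0 < m)
    (D : Set (Fin n → ℂ)) (D' : Set (Fin m → ℂ))
    (hD : IsOpen D) (hD' : IsOpen D')
    (g : Fin m → (Fin n → ℂ) → ℂ) (hg : ∀ j, IsNashOn n D (g j))
    (hmap : ∀ z ∈ D, (fun j => g j z) ∈ D')
    (f : (Fin m → ℂ) → ℂ) (hf : IsNashOn m D' f) :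
    IsNashOn n D (fun z => f (fun j => g j z)) := by
  have hgd : DifferentiableOn ℂ (fun z => (fun j => g j z)) D :=
    differentiableOn_pi.2 fun j => (hg j).1
  have hfg : DifferentiableOn ℂ (fun z => f (fun j => g j z)) D :=
    hf.1.comp hgd hmap
  refine ⟨hfg, fun z₀ hz₀ => ?_⟩
  obtain ⟨U', hU'o, hU'z, hU'D, hP⟩ := hf.2 _ (hmap z₀ hz₀)
  obtain ⟨q, hq0, hq⟩ := (nash_iff U' f).1 hP
  choose U hUo hUz hUD hUP using fun j => (hg j).2 z₀ hz₀
  have hN : (D ∩ (fun z => (fun j => g j z)) ⁻¹' U') ∩ ⋂ j, U j ∈ nhds z₀ := by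
    refine Filter.inter_mem ?_ (Filter.iInter_mem.2 fun j => (hUo j).mem_nhds (hUz j))
    exact (hgd.continuousOn.isOpen_inter_preimage hD hU'o).mem_nhds ⟨hz₀, hU'z⟩
  obtain ⟨ε, hε, hball⟩ := Metric.mem_nhds_iff.1 hN
  set B := Metric.ball z₀ ε with hBdef
  have hBD : B ⊆ D := fun z hz => (hball hz).1.1
  have hBU' : ∀ z ∈ B, (fun j => g j z) ∈ U' := fun z hz => (hball hz).1.2
  have hBU : ∀ j, B ⊆ U j := fun j z hz => Set.mem_iInter.1 (hball hz).2 j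
  have hz₀B : z₀ ∈ B := Metric.mem_ball_self hε
  have := nashHol_noZeroDivisors B Metric.isOpen_ball (convex_ball z₀ ε)
  refine ⟨B, Metric.isOpen_ball, hz₀B, hBD, ?_⟩
  rw [← nash_isAlgebraic_iff B _ (hfg.mono hBD)]
  let R := MvPolynomial (Fin n) ℂ
  let S := Subalgebra.algebraicClosure R (nashHol B)
  let gS : Fin m → S := fun j => ⟨⟨fun z => g j z.1, g j, (hg j).1.mono hBD, fun _ => rfl⟩, by
    rw [Subalgebra.mem_algebraicClosure, nash_isAlgebraic_iff B _ ((hg j).1.mono hBD)]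
    obtain ⟨P, hP0, hP⟩ := hUP j
    exact ⟨P, hP0, fun z hz => hP z (hBU j hz)⟩⟩
  let ev : B → S →+* ℂ := fun z => (nashPt B z).comp S.val.toRingHom
  have hev : ∀ z : B, (fun j => ev z (gS j)) = fun j => g j z.1 := fun z => rfl
  obtain ⟨p, hp0, hp⟩ := nash_core q hq0 ((algebraMap R S).comp MvPolynomial.C) gS ev
    (fun z x => by
      change MvPolynomial.eval z.1 (MvPolynomial.C x) = x
      simp) ⟨z₀, hz₀B⟩ f
    (fun z => by
      rw [hev]
      exact (hf.1.differentiableAt (hD'.mem_nhds (hmap z.1 (hBD z.2)))).continuousAt)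
    (fun z => by
      rw [hev]
      filter_upwards [hU'o.mem_nhds (hBU' z.1 z.2)] with w hw using hq w hw)
  have halg : IsAlgebraic S (⟨fun z => f (fun j => g j z.1), fun z => f (fun j => g j z),
      hfg.mono hBD, fun _ => rfl⟩ : nashHol B) := by
    refine ⟨p, hp0, ?_⟩
    apply Subtype.ext
    funext z
    change nashPt B z _ = 0
    rw [Polynomial.aeval_def, Polynomial.hom_eval₂]
    exact hp z
  exact halg.restrictScalars R
end

section
/- Let κ, κ₁ be positive integers and κ₂ a nonnegative integer. Let V ⊆ ℂ^κ be a connected open set, let H, H₁, …, H_{κ₁+κ₂} be Nash functions on V that are nowhere zero on V, and let μ, μ₁, …, μ_{κ₁+κ₂} ∈ ℝ \ {0}. Let P and Q be polynomials in κ₁ complex variables with Q not identically zero, and suppose Q(H₁(ξ)^{μ₁}, …, H_{κ₁}(ξ)^{μ_{κ₁}}) ≠ 0 for all ξ ∈ V. If exp(H(ξ)^μ) = (P/Q)(H₁(ξ)^{μ₁}, …, H_{κ₁}(ξ)^{μ_{κ₁}}) · ∏_{j=κ₁+1}^{κ₁+κ₂} H_j(ξ)^{μ_j} for all ξ ∈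 V, then H is constant on V. -/
namespace NashAux
open Differential Polynomial

lemma color_sum {M : Type*} [Field M] [Differential M] (K : Subfield M)
    (hK : ∀ x ∈ K, x′ ∈ K) {ι : Type*} (c : ι → Prop) [DecidablePred c] :
    ∀ (n : ℕ) (s : Finset ι) (y : ι → M), s.card ≤ n → (∀ i ∈ s, y i ≠ 0) →
      (∀ i ∈ s, logDeriv (y i) ∈ K) →
      (∀ i ∈ s, ∀ j ∈ s, c i → ¬ c j → ∀ k ∈ K, k ≠ 0 →
        logDeriv (y i) - logDeriv (y j) ≠ logDeriv k) →
      ∑ i ∈ s, y i = 0 → ∑ i ∈ s with c i, y i = 0 := by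
  classical
  intro n
  induction n with
  | zero =>
    intro s y hs _ _ _ _
    have : s = ∅ := by simpa using hs
    simp [this]
  | succ n ih =>
    intro s y hs hne hlog hcol hsum
    have key : ∀ j ∈ s, ∑ i ∈ s with c i, (logDeriv (y i) - logDeriv (y j)) * y i = 0 := by
      intro j hj
      have h1 : ∑ i ∈ s, (logDeriv (y i) - logDeriv (y j)) * y i = 0 := by
        simp only [sub_mul, Finset.sum_sub_distrib, ← Finset.mul_sum, hsum, mul_zero, sub_zero]
        have : (∑ i ∈ s, y i)′ = 0 := by rw [hsum, map_zero]
        rw [map_sum] at this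
        rw [← this]
        refine Finset.sum_congr rfl fun i hi => ?_
        unfold Differential.logDeriv
        field_simp [hne i hi]
      have h2 := ih (s.filter fun i => logDeriv (y i) ≠ logDeriv (y j))
        (fun i => (logDeriv (y i) - logDeriv (y j)) * y i) ?_ ?_ ?_ ?_ ?_
      · rw [Finset.filter_filter] at h2
        rw [← h2]
        symm
        apply Finset.sum_subset
        · intro i; simp only [Finset.mem_filter]; tauto
        · intro i hi hi'
          simp only [Finset.mem_filter] at hi hi'
          have : logDeriv (y i) = logDeriv (y j) := by by_contra h; tauto
          simp [this]
      · have : (s.filter fun i => logDeriv (y i) ≠ logDeriv (y j)).card < s.card := by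
          apply Finset.card_lt_card
          rw [Finset.filter_ssubset]
          exact ⟨j, hj, by simp⟩
        omega
      · intro i hi
        simp only [Finset.mem_filter] at hi
        exact mul_ne_zero (sub_ne_zero.2 hi.2) (hne i hi.1)
      · intro i hi
        simp only [Finset.mem_filter] at hi
        rw [logDeriv_mul _ _ (sub_ne_zero.2 hi.2) (hne i hi.1)]
        have := K.sub_mem (hlog i hi.1) (hlog j hj)
        exact K.add_mem (K.div_mem (hK _ this) this) (hlog i hi.1)
      · intro i hi i' hi' hci hci' k hk hk0 heq
        simp only [Finset.mem_filter] at hi hi'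
        rw [logDeriv_mul _ _ (sub_ne_zero.2 hi.2) (hne i hi.1),
          logDeriv_mul _ _ (sub_ne_zero.2 hi'.2) (hne i' hi'.1)] at heq
        have m1 := K.sub_mem (hlog i hi.1) (hlog j hj)
        have m2 := K.sub_mem (hlog i' hi'.1) (hlog j hj)
        have n1 := sub_ne_zero.2 hi.2
        have n2 := sub_ne_zero.2 hi'.2
        refine hcol i hi.1 i' hi'.1 hci hci'
          (k * (logDeriv (y i') - logDeriv (y j)) / (logDeriv (y i) - logDeriv (y j)))
          (K.div_mem (K.mul_mem hk m2) m1) (div_ne_zero (mul_ne_zero hk0 n2) n1) ?_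
        rw [logDeriv_div _ _ (mul_ne_zero hk0 n2) n1, logDeriv_mul _ _ hk0 n2, ← heq]
        ring
      · rw [← h1]
        apply Finset.sum_subset (Finset.filter_subset _ _)
        intro i hi hi'
        simp only [Finset.mem_filter] at hi'
        have : logDeriv (y i) = logDeriv (y j) := by by_contra h; tauto
        simp [this]
    by_cases hall : ∀ j ∈ s, ∀ j' ∈ s, logDeriv (y j) = logDeriv (y j')
    · by_cases hc : ∀ i ∈ s, c i
      · rw [Finset.filter_true_of_mem hc, hsum]
      · push Not at hc
        obtain ⟨j, hj, hcj⟩ := hc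
        have : s.filter c = ∅ := by
          rw [Finset.filter_eq_empty_iff]
          intro i hi hci
          exact hcol i hi j hj hci hcj 1 K.one_mem one_ne_zero (by simp [hall i hi j hj])
        simp [this]
    · push Not at hall
      obtain ⟨j, hj, j', hj', hjj⟩ := hall
      have h3 := key j hj
      have h4 := key j' hj'
      have : (logDeriv (y j') - logDeriv (y j)) * ∑ i ∈ s with c i, y i = 0 := by
        rw [← sub_zero (0 : M)]
        nth_rw 1 [← h3]
        rw [← h4, ← Finset.sum_sub_distrib, Finset.mul_sum]
        exact Finset.sum_congr rfl fun i _ => by ring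
      rcases mul_eq_zero.1 this with h | h
      · exact absurd (sub_eq_zero.1 h).symm hjj
      · exact h

/-- Norm argument in a Galois extension. -/
lemma galois_norm {F K : Type*} [Field F] [Field K] [Differential F] [Differential K]
    [Algebra F K] [DifferentialAlgebra F K] [CharZero F] [FiniteDimensional F K] [IsGalois F K]
    (a : F) {ι : Type*} [Fintype ι] (c : ι → F) (u : ι → K)
    (h : algebraMap F K a = ∑ x, algebraMap F K (c x) * logDeriv (u x)) :
    ∃ (N : ℕ) (u₀ : ι → F), N ≠ 0 ∧ N * a = ∑ x, c x * logDeriv (u₀ x) := by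
  let u₁ (i : ι) := ∏ x : (K ≃ₐ[F] K), x (u i)
  have : ∀ i, u₁ i ∈ IntermediateField.fixedField (⊤ : Subgroup (K ≃ₐ[F] K)) := by
    rintro i ⟨e, _⟩
    change e (u₁ i) = u₁ i
    simp only [u₁, map_prod]
    apply Fintype.prod_equiv (Equiv.mulLeft e)
    simp
  have ffb : IntermediateField.fixedField ⊤ = ⊥ :=
    (IsGalois.tfae.out 0 1).mp (inferInstance : IsGalois F K)
  simp_rw [ffb, IntermediateField.mem_bot, Set.mem_range] at this
  choose u₀ hu₀ using this
  refine ⟨Fintype.card (K ≃ₐ[F] K), u₀, Fintype.card_ne_zero, ?_⟩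
  apply FaithfulSMul.algebraMap_injective F K
  simp only [map_sum, map_mul, ← logDeriv_algebraMap, hu₀, map_natCast]
  have h1 : ∀ i, logDeriv (u₁ i) = ∑ x : K ≃ₐ[F] K, logDeriv (x (u i)) := by
    intro i
    by_cases h : u i = 0 <;> simp [u₁, Differential.logDeriv_prod, h]
  simp_rw [h1, Finset.mul_sum]
  rw [Finset.sum_comm]
  trans ∑ _ : (K ≃ₐ[F] K), algebraMap F K a
  · simp
  · refine Finset.sum_congr rfl fun e _ => ?_
    have h2 := congrArg e h
    simp only [AlgEquiv.commutes, map_sum, map_mul] at h2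
    rw [h2]
    refine Finset.sum_congr rfl fun x _ => ?_
    simp [Differential.logDeriv, algEquiv_deriv']

lemma finite_norm {F K : Type*} [Field F] [Field K] [Differential F] [Differential K]
    [Algebra F K] [DifferentialAlgebra F K] [CharZero F] [FiniteDimensional F K]
    (a : F) {ι : Type*} [Fintype ι] (c : ι → F) (u : ι → K)
    (h : algebraMap F K a = ∑ x, algebraMap F K (c x) * logDeriv (u x)) :
    ∃ (N : ℕ) (u₀ : ι → F), N ≠ 0 ∧ N * a = ∑ x, c x * logDeriv (u₀ x) := by
  let L := IntermediateField.normalClosure F K (AlgebraicClosure F)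
  let _ : Differential L := differentialFiniteDimensional F L
  have : DifferentialAlgebra F L := differentialAlgebraFiniteDimensional
  have : IsGalois F L := {}
  let φ : K →ₐ[F] AlgebraicClosure F := IsAlgClosed.lift
  let e : K →ₐ[F] L := φ.codRestrict L.toSubalgebra
    (fun x => AlgHom.fieldRange_le_normalClosure φ ⟨x, rfl⟩)
  apply galois_norm (K := L) a c (fun i => e (u i))
  have h2 := congrArg e h
  simp only [AlgHom.commutes, map_sum, map_mul] at h2
  rw [h2]
  refine Finset.sum_congr rfl fun x _ => ?_
  simp [Differential.logDeriv, algHom_deriv' e (RingHom.injective _)]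

end NashAux

namespace NashAux
open Differential Polynomial

def DegLE (d : ℝ) (p : AddMonoidAlgebra ℂ ℝ) : Prop := ∀ a, d < a → p.coeff a = 0

lemma DegLE.add {d p q} (hp : DegLE d p) (hq : DegLE d q) : DegLE d (p + q) := by
  intro a ha; simp [hp a ha, hq a ha]

lemma DegLE.smul {d p} (c : ℂ) (hp : DegLE d p) : DegLE d (c • p) := by
  intro a ha; simp [hp a ha]

lemma DegLE.mul {d e p q} (hp : DegLE d p) (hq : DegLE e q) : DegLE (d + e) (p * q) := by
  classical
  intro a ha
  rw [AddMonoidAlgebra.coeff_mul]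
  refine Finset.sum_eq_zero fun b _ => Finset.sum_eq_zero fun c _ => ?_
  dsimp only
  split_ifs with h
  · by_cases hb : d < b
    · simp [hp b hb]
    · have : e < c := by linarith
      simp [hq c this]
  · rfl

lemma DegLE.coeff_mul {d e p q} (hp : DegLE d p) (hq : DegLE e q) :
    (p * q).coeff (d + e) = p.coeff d * q.coeff e := by
  classical
  rw [AddMonoidAlgebra.coeff_mul, Finsupp.sum, Finset.sum_eq_single d, Finsupp.sum,
    Finset.sum_eq_single e]
  · simp
  · intro c _ hc
    rw [if_neg]; intro h; apply hc; linarith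
  · intro h; simp at h; simp [h]
  · intro b _ hb
    refine Finset.sum_eq_zero fun c _ => ?_
    dsimp only
    split_ifs with h
    · by_cases hb' : d < b
      · simp [hp b hb']
      · have h3 : b < d := lt_of_le_of_ne (not_lt.1 hb') hb
        have : e < c := by linarith
        simp [hq c this]
    · rfl
  · intro h; simp at h; simp [h]

lemma exists_deg {p : AddMonoidAlgebra ℂ ℝ} (hp : p ≠ 0) : ∃ d, DegLE d p ∧ p.coeff d ≠ 0 := by
  have : p.coeff.support.Nonempty := by
    rw [Finsupp.support_nonempty_iff]
    intro h; apply hp; ext; simp [h]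
  refine ⟨p.coeff.support.max' this, ?_, ?_⟩
  · intro a ha
    by_contra h
    exact absurd (p.coeff.support.le_max' a (by simpa using h)) (not_le.2 ha)
  · have := Finset.max'_mem _ this
    simpa using this

section
set_option linter.unusedSectionVars false
variable {M : Type*} [Field M] [Algebra ℂ M] [Differential M]

/-- the derivation as a linear map over the constants -/
noncomputable def dLin (hc : ∀ c : ℂ, (algebraMap ℂ M c)′ = 0) : M →ₗ[ℂ] M where
  toFun x := (x′)
  map_add' := by simp
  map_smul' c x := by simp [Algebra.smul_def, hc]

lemma lift_injective (hc : ∀ c : ℂ, (algebraMap ℂ M c)′ = 0)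
    (X : Multiplicative ℝ →* M)
    (hX : ∀ a : ℝ, (X (Multiplicative.ofAdd a))′ = algebraMap ℂ M a * X (Multiplicative.ofAdd a)) :
    Function.Injective (AddMonoidAlgebra.lift ℂ M ℝ X) := by
  have hli := Module.End.eigenvectors_linearIndependent' (dLin hc) (fun a : ℝ => (a : ℂ))
    Complex.ofReal_injective (fun a : ℝ => X (Multiplicative.ofAdd a)) (by
      intro a
      rw [Module.End.hasEigenvector_iff]
      refine ⟨?_, ?_⟩
      · rw [Module.End.mem_eigenspace_iff]
        rw [Algebra.smul_def]
        exact hX a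
      · intro h
        have h1 : X (Multiplicative.ofAdd a) * X (Multiplicative.ofAdd (-a)) = 1 := by
          rw [← map_mul, ← ofAdd_add]; simp
        rw [h] at h1; simp at h1)
  intro p q hpq
  rw [AddMonoidAlgebra.lift_apply, AddMonoidAlgebra.lift_apply] at hpq
  ext1
  exact hli hpq

lemma lift_deriv (hc : ∀ c : ℂ, (algebraMap ℂ M c)′ = 0)
    (X : Multiplicative ℝ →* M)
    (hX : ∀ a : ℝ, (X (Multiplicative.ofAdd a))′ = algebraMap ℂ M a * X (Multiplicative.ofAdd a))
    (p : AddMonoidAlgebra ℂ ℝ) :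
    ∃ q : AddMonoidAlgebra ℂ ℝ, (AddMonoidAlgebra.lift ℂ M ℝ X p)′ = AddMonoidAlgebra.lift ℂ M ℝ X q
      ∧ ∀ d, DegLE d p → DegLE d q := by
  classical
  refine ⟨∑ a ∈ p.coeff.support, AddMonoidAlgebra.single a ((a : ℂ) * p.coeff a), ?_, ?_⟩
  · rw [AddMonoidAlgebra.lift_apply', Finsupp.sum, map_sum, map_sum]
    refine Finset.sum_congr rfl fun a _ => ?_
    rw [AddMonoidAlgebra.lift_single, Algebra.smul_def]
    simp [hc, hX]
    ring
  · intro d hd a ha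
    rw [AddMonoidAlgebra.coeff_sum, Finsupp.finsetSum_apply]
    refine Finset.sum_eq_zero fun b hb => ?_
    rw [AddMonoidAlgebra.coeff_single, Finsupp.single_apply]
    split_ifs with h
    · subst h; simp [hd _ ha]
    · rfl

def Bd (X : Multiplicative ℝ →* M) (x : M) : Prop :=
  ∃ p q d, q.coeff d ≠ 0 ∧ DegLE d p ∧ DegLE d q ∧
    x * AddMonoidAlgebra.lift ℂ M ℝ X q = AddMonoidAlgebra.lift ℂ M ℝ X p

lemma Bd.add {X : Multiplicative ℝ →* M} {x y : M} (hx : Bd X x) (hy : Bd X y) : Bd X (x + y) := by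
  obtain ⟨p, q, d, h1, h2, h3, h4⟩ := hx
  obtain ⟨p', q', d', h1', h2', h3', h4'⟩ := hy
  refine ⟨p * q' + q * p', q * q', d + d', ?_, (h2.mul h3').add (h3.mul h2'), h3.mul h3', ?_⟩
  · rw [h3.coeff_mul h3']; exact mul_ne_zero h1 h1'
  · simp only [map_mul, map_add, ← h4, ← h4']; ring

lemma Bd.smul {X : Multiplicative ℝ →* M} {x : M} (c : ℂ) (hx : Bd X x) :
    Bd X (algebraMap ℂ M c * x) := by
  obtain ⟨p, q, d, h1, h2, h3, h4⟩ := hx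
  refine ⟨c • p, q, d, h1, h2.smul c, h3, ?_⟩
  rw [map_smul, ← h4, Algebra.smul_def]; ring

lemma Bd.zero (X : Multiplicative ℝ →* M) : Bd X 0 :=
  ⟨0, 1, 0, by simp [AddMonoidAlgebra.one_def], fun a _ => by simp, fun a ha => by
    rw [AddMonoidAlgebra.one_def, AddMonoidAlgebra.coeff_single, Finsupp.single_apply, if_neg ha.ne],
    by simp⟩

lemma not_bd_one (hc : ∀ c : ℂ, (algebraMap ℂ M c)′ = 0)
    (X : Multiplicative ℝ →* M)
    (hX : ∀ a : ℝ, (X (Multiplicative.ofAdd a))′ = algebraMap ℂ M a * X (Multiplicative.ofAdd a)) :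
    ¬ Bd X (X (Multiplicative.ofAdd 1)) := by
  rintro ⟨p, q, d, h1, h2, h3, h4⟩
  have : X (Multiplicative.ofAdd 1) = AddMonoidAlgebra.lift ℂ M ℝ X (AddMonoidAlgebra.single 1 1) := by
    simp
  rw [this, ← map_mul] at h4
  have h5 := lift_injective hc X hX h4
  have h6 := h2 (1 + d) (by linarith)
  rw [← h5, AddMonoidAlgebra.coeff_single_mul_apply] at h6
  simp at h6
  exact h1 h6

/-- the base field -/
noncomputable def E0 (X : Multiplicative ℝ →* M) : IntermediateField ℂ M :=
  IntermediateField.adjoin ℂ (Set.range X)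

lemma mem_E0 {X : Multiplicative ℝ →* M} {x : M} (hx : x ∈ E0 X) :
    ∃ p q, x = AddMonoidAlgebra.lift ℂ M ℝ X p / AddMonoidAlgebra.lift ℂ M ℝ X q := by
  have key : ∀ r ∈ Algebra.adjoin ℂ (Set.range X), ∃ p, r = AddMonoidAlgebra.lift ℂ M ℝ X p := by
    intro r hr
    have : Algebra.adjoin ℂ (Set.range X) ≤ (AddMonoidAlgebra.lift ℂ M ℝ X).range := by
      apply Algebra.adjoin_le
      rintro _ ⟨a, rfl⟩
      exact ⟨AddMonoidAlgebra.single (Multiplicative.toAdd a) 1, by simp⟩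
    obtain ⟨p, hp⟩ := this hr
    exact ⟨p, hp.symm⟩
  obtain ⟨r, hr, s, hs, rfl⟩ := IntermediateField.mem_adjoin_iff_div.1 hx
  obtain ⟨p, rfl⟩ := key r hr
  obtain ⟨q, rfl⟩ := key s hs
  exact ⟨p, q, rfl⟩

lemma X_mem_E0 (X : Multiplicative ℝ →* M) (a) : X a ∈ E0 X :=
  IntermediateField.subset_adjoin _ _ ⟨a, rfl⟩

lemma lift_mem_E0 (X : Multiplicative ℝ →* M) (p) : AddMonoidAlgebra.lift ℂ M ℝ X p ∈ E0 X := by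
  rw [AddMonoidAlgebra.lift_apply]
  exact sum_mem fun a _ => (E0 X).smul_mem (X_mem_E0 X _)

lemma E0_deriv (hc : ∀ c : ℂ, (algebraMap ℂ M c)′ = 0)
    (X : Multiplicative ℝ →* M)
    (hX : ∀ a : ℝ, (X (Multiplicative.ofAdd a))′ = algebraMap ℂ M a * X (Multiplicative.ofAdd a))
    {x : M} (hx : x ∈ E0 X) : x′ ∈ E0 X := by
  obtain ⟨p, q, rfl⟩ := mem_E0 hx
  obtain ⟨p', hp', -⟩ := lift_deriv hc X hX p
  obtain ⟨q', hq', -⟩ := lift_deriv hc X hX q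
  rw [Derivation.leibniz_div, hp', hq']
  have := lift_mem_E0 X p
  have := lift_mem_E0 X q
  have := lift_mem_E0 X p'
  have := lift_mem_E0 X q'
  simp only [smul_eq_mul]
  refine mul_mem (pow_mem (inv_mem ?_) _) (sub_mem (mul_mem ?_ ?_) (mul_mem ?_ ?_)) <;> assumption

lemma bd_logDeriv (hc : ∀ c : ℂ, (algebraMap ℂ M c)′ = 0)
    (X : Multiplicative ℝ →* M)
    (hX : ∀ a : ℝ, (X (Multiplicative.ofAdd a))′ = algebraMap ℂ M a * X (Multiplicative.ofAdd a))
    {x : M} (hx : x ∈ E0 X) : Bd X (Differential.logDeriv x) := by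
  have key : ∀ p, p ≠ 0 → Bd X (Differential.logDeriv (AddMonoidAlgebra.lift ℂ M ℝ X p)) := by
    intro p hp
    obtain ⟨p', hp', h⟩ := lift_deriv hc X hX p
    obtain ⟨d, hd, hd'⟩ := exists_deg hp
    refine ⟨p', p, d, hd', h d hd, hd, ?_⟩
    have : AddMonoidAlgebra.lift ℂ M ℝ X p ≠ 0 := by
      rw [Ne, map_eq_zero_iff _ (lift_injective hc X hX)]; exact hp
    rw [Differential.logDeriv, hp', div_mul_cancel₀ _ this]
  obtain ⟨p, q, rfl⟩ := mem_E0 hx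
  by_cases hp : p = 0
  · simpa [hp] using Bd.zero X
  by_cases hq : q = 0
  · simpa [hq] using Bd.zero X
  have hi := lift_injective hc X hX
  rw [Differential.logDeriv_div]
  · have := (key p hp).add ((key q hq).smul (-1))
    simpa [sub_eq_add_neg] using this
  · rw [Ne, map_eq_zero_iff _ hi]; exact hp
  · rw [Ne, map_eq_zero_iff _ hi]; exact hq

/-- a derivation restricted to a stable subfield -/
@[reducible] noncomputable def restrictDiff (E : IntermediateField ℂ M) (hE : ∀ x ∈ E, x′ ∈ E) : Differential E where
  deriv := Derivation.mk' ({
      toFun := fun x => ⟨(x : M)′, hE _ x.2⟩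
      map_add' := fun x y => by ext; simp
      map_smul' := fun n x => by ext; simp } : E →ₗ[ℤ] E) (by
      intro a b; ext; simp)

lemma deriv_mem_of_algebraic {E : IntermediateField ℂ M} (hE : ∀ x ∈ E, x′ ∈ E)
    {x : M} (hx : IsAlgebraic E x) : x′ ∈ IntermediateField.adjoin E {x} := by
  let _ := restrictDiff E hE
  have : CharZero E := algebraRat.charZero E
  have : DifferentialAlgebra E M := ⟨fun a => rfl⟩
  have : FiniteDimensional E (IntermediateField.adjoin E {x}) :=
    IntermediateField.adjoin.finiteDimensional hx.isIntegral
  let y : IntermediateField.adjoin E {x} := ⟨x, IntermediateField.mem_adjoin_simple_self E x⟩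
  have h : (algebraMap (IntermediateField.adjoin E {x}) M y)′ = algebraMap _ M (y′) :=
    deriv_algebraMap y
  change x′ = _ at h
  rw [h]
  exact (y′).2

/-- the algebraic core -/
theorem no_log (hc : ∀ c : ℂ, (algebraMap ℂ M c)′ = 0)
    (X : Multiplicative ℝ →* M)
    (hX : ∀ a : ℝ, (X (Multiplicative.ofAdd a))′ = algebraMap ℂ M a * X (Multiplicative.ofAdd a))
    {ι : Type*} [Fintype ι] (c : ι → ℂ) (u : ι → M) (hu : ∀ i, IsAlgebraic (E0 X) (u i))
    (h : X (Multiplicative.ofAdd 1) = ∑ i, algebraMap ℂ M (c i) * Differential.logDeriv (u i)) :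
    False := by
  let _ := restrictDiff (E0 X) (fun x hx => E0_deriv hc X hX hx)
  have : CharZero (E0 X) := algebraRat.charZero _
  have : DifferentialAlgebra (E0 X) M := ⟨fun a => rfl⟩
  let L := IntermediateField.adjoin (E0 X) (Set.range u)
  have : FiniteDimensional (E0 X) L := by
    apply IntermediateField.finiteDimensional_adjoin
    rintro _ ⟨i, rfl⟩
    exact (hu i).isIntegral
  let v : ι → L := fun i => ⟨u i, IntermediateField.subset_adjoin _ _ ⟨i, rfl⟩⟩
  obtain ⟨N, u₀, hN, hs⟩ := finite_norm (F := E0 X) (K := L)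
    ⟨X (Multiplicative.ofAdd 1), X_mem_E0 X _⟩ (fun i => algebraMap ℂ (E0 X) (c i)) v (by
      apply FaithfulSMul.algebraMap_injective L M
      rw [map_sum]
      simp only [map_mul, ← logDeriv_algebraMap]
      exact h)
  apply not_bd_one hc X hX
  have hs' := congrArg (algebraMap (E0 X) M) hs
  simp only [map_sum, map_mul, map_natCast, ← logDeriv_algebraMap] at hs'
  have hN' : (N : M) ≠ 0 := by
    have : CharZero M := charZero_of_injective_algebraMap (algebraMap ℂ M).injective
    exact_mod_cast hN
  have e1 : X (Multiplicative.ofAdd 1) = algebraMap ℂ M (N : ℂ)⁻¹ *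
      ∑ x, algebraMap ℂ M (c x) * Differential.logDeriv (algebraMap (E0 X) M (u₀ x)) := by
    rw [map_inv₀, map_natCast, eq_inv_mul_iff_mul_eq₀ hN']
    exact hs'
  rw [e1]
  apply Bd.smul
  apply Finset.sum_induction _ (Bd X) (fun _ _ => Bd.add) (Bd.zero X)
  intro x _
  exact (bd_logDeriv hc X hX (u₀ x).2).smul _

end
end NashAux

namespace NashAux
open Differential Polynomial
open scoped Polynomial.Bivariate

section
set_option linter.unusedSectionVars false
variable {M : Type*} [Field M] [Algebra ℂ M] [Differential M]

lemma transcendental_of_deriv_ne (hc : ∀ c : ℂ, (algebraMap ℂ M c)′ = 0) {x : M}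
    (hx : (x′) ≠ 0) : Transcendental ℂ x := by
  intro h
  let D : Derivation ℂ M M :=
    { dLin hc with
      map_one_eq_zero' := by
        have := hc 1
        rwa [map_one] at this
      leibniz' := fun a b => (Differential.deriv : Derivation ℤ M M).leibniz a b }
  have hD : D x = x′ := rfl
  have h1 := D.map_aeval (minpoly ℂ x) x
  rw [minpoly.aeval, map_zero, hD, smul_eq_mul] at h1
  have h2 := (minpoly.irreducible h.isIntegral).separable.aeval_derivative_ne_zero
    (minpoly.aeval ℂ x)
  exact mul_ne_zero h2 hx h1.symm

lemma alg_of_rel (E : IntermediateField ℂ M) {x y : M} (hx : IsAlgebraic E x)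
    (ht : Transcendental ℂ x) {p : ℂ[X][Y]} (hp : p ≠ 0) (h : aevalAeval x y p = 0) :
    IsAlgebraic E y := by
  let A := algebraicClosure E M
  have : IsScalarTower ℂ A M := IsScalarTower.of_algebraMap_eq fun _ => rfl
  let x' : A := ⟨x, mem_algebraicClosure_iff.2 hx⟩
  let φ : ℂ[X] →+* A := (aeval (R := ℂ) x').toRingHom
  have hφ : Function.Injective φ := by
    have h1 : Function.Injective (aeval (R := ℂ) x) := transcendental_iff_injective.1 ht
    intro a b hab
    apply h1
    have e : ∀ q : ℂ[X], aeval x q = algebraMap A M (φ q) := fun q => by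
      change _ = algebraMap A M (aeval x' q)
      rw [← aeval_algebraMap_apply]; rfl
    rw [e, e, hab]
  have hal : IsAlgebraic A y := by
    refine ⟨p.map φ, ?_, ?_⟩
    · rwa [Ne, Polynomial.map_eq_zero_iff hφ]
    · rw [← h]
      have : ∀ q : ℂ[X][Y], aeval y (q.map φ) = aevalAeval x y q := by
        intro q
        induction q using Polynomial.induction_on' with
        | add a b ha hb => simp only [Polynomial.map_add, map_add, ha, hb]
        | monomial n a =>
          rw [← C_mul_X_pow_eq_monomial, map_mul, map_pow, aevalAeval_C, aevalAeval_Y]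
          simp only [Polynomial.map_mul, Polynomial.map_pow, map_X, map_C, map_mul, map_pow,
            aeval_X, aeval_C]
          congr 1
          change algebraMap A M (aeval x' a) = _
          rw [← aeval_algebraMap_apply]; rfl
      exact this p
  exact hal.restrictScalars E

theorem alg_core (hc : ∀ c : ℂ, (algebraMap ℂ M c)′ = 0)
    (X : Multiplicative ℝ →* M)
    (hX : ∀ a : ℝ, (X (Multiplicative.ofAdd a))′ = algebraMap ℂ M a * X (Multiplicative.ofAdd a))
    {ι : Type*} [Fintype ι] (f g : ι → M) (μ : ι → ℂ)
    (hf : ∀ i, IsAlgebraic (E0 X) (f i)) (hg : ∀ i, g i ≠ 0)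
    (hfg : ∀ i, Differential.logDeriv (g i) = algebraMap ℂ M (μ i) * Differential.logDeriv (f i))
    (e : M) (he : e ≠ 0) (hel : Differential.logDeriv e = X (Multiplicative.ofAdd 1))
    (P Q : MvPolynomial ι ℂ) (hQ : MvPolynomial.aeval g Q ≠ 0)
    (h : e * MvPolynomial.aeval g Q = MvPolynomial.aeval g P) : False := by
  classical
  have hcl : ∀ c : ℂ, Differential.logDeriv (algebraMap ℂ M c) = 0 := fun c => by
    simp [Differential.logDeriv, hc]
  let A := algebraicClosure (E0 X) M
  have hA : ∀ x, x ∈ A ↔ IsAlgebraic (E0 X) x := fun x => mem_algebraicClosure_iff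
  have hAd : ∀ x ∈ A, x′ ∈ A := by
    intro x hx
    have h1 := deriv_mem_of_algebraic (E := E0 X) (fun x hx => E0_deriv hc X hX hx) ((hA x).1 hx)
    have : IntermediateField.adjoin (E0 X) {x} ≤ A := by
      rw [IntermediateField.adjoin_simple_le_iff]; exact hx
    exact this h1
  have hAl : ∀ x ∈ A, Differential.logDeriv x ∈ A := fun x hx => A.div_mem (hAd x hx) hx
  have hAc : ∀ c : ℂ, algebraMap ℂ M c ∈ A := fun c =>
    A.algebraMap_mem (algebraMap ℂ (E0 X) c)
  have hXA : X (Multiplicative.ofAdd 1) ∈ A := A.algebraMap_mem ⟨_, X_mem_E0 X _⟩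
  let T : MvPolynomial ι ℂ → (ι →₀ ℕ) → M := fun R n =>
    algebraMap ℂ M (R.coeff n) * ∏ i, g i ^ n i
  have hTs : ∀ R : MvPolynomial ι ℂ, MvPolynomial.aeval g R = ∑ n ∈ R.support, T R n := fun R => by
    rw [MvPolynomial.aeval_def, MvPolynomial.eval₂_eq']
  have hT0 : ∀ R : MvPolynomial ι ℂ, ∀ n ∈ R.support, T R n ≠ 0 := fun R n hn => by
    refine mul_ne_zero ?_ (Finset.prod_ne_zero_iff.2 fun i _ => pow_ne_zero _ (hg i))
    simpa using hn
  have hTl : ∀ R : MvPolynomial ι ℂ, ∀ n ∈ R.support, Differential.logDeriv (T R n) =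
      ∑ i, algebraMap ℂ M (n i * μ i) * Differential.logDeriv (f i) := fun R n hn => by
    have h0 : ∀ i ∈ Finset.univ, g i ^ n i ≠ 0 := fun i _ => pow_ne_zero _ (hg i)
    simp only [T]
    rw [Differential.logDeriv_mul _ _ (by simpa using hn) (Finset.prod_ne_zero_iff.2 h0), hcl,
      zero_add, Differential.logDeriv_prod _ _ _ h0]
    refine Finset.sum_congr rfl fun i _ => ?_
    rw [Differential.logDeriv_pow, hfg, map_mul, map_natCast, mul_assoc]
  have hTA : ∀ R : MvPolynomial ι ℂ, ∀ n ∈ R.support, Differential.logDeriv (T R n) ∈ A :=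
    fun R n hn => by
      rw [hTl R n hn]
      exact A.sum_mem fun i _ => A.mul_mem (hAc _) (hAl _ ((hA _).2 (hf i)))
  let y : (ι →₀ ℕ) ⊕ (ι →₀ ℕ) → M := Sum.elim (fun n => e * T Q n) (fun n => (-1) * T P n)
  have hm1 : Differential.logDeriv (-1 : M) = 0 := by
    have := hcl (-1); rwa [map_neg, map_one] at this
  have hm0 : (-1 : M) ≠ 0 := by simp
  have key := color_sum A.toSubfield (fun x hx => hAd x hx) (fun i => Sum.isLeft i = true)
    _ (Q.support.disjSum P.support) y le_rfl ?_ ?_ ?_ ?_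
  · have h1 : ∑ i ∈ Q.support.disjSum P.support with Sum.isLeft i = true, y i
        = e * MvPolynomial.aeval g Q := by
      rw [Finset.sum_filter, Finset.sum_disjSum, hTs, Finset.mul_sum]
      simp [y]
    rw [h1] at key
    exact mul_ne_zero he hQ key
  · rintro (n | n) hn
    · exact mul_ne_zero he (hT0 Q n (by simpa using hn))
    · exact mul_ne_zero hm0 (hT0 P n (by simpa using hn))
  · rintro (n | n) hn
    · have hn' : n ∈ Q.support := by simpa using hn
      simp only [y, Sum.elim_inl]
      rw [Differential.logDeriv_mul _ _ he (hT0 Q n hn'), hel]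
      exact A.add_mem hXA (hTA Q n hn')
    · have hn' : n ∈ P.support := by simpa using hn
      simp only [y, Sum.elim_inr]
      rw [Differential.logDeriv_mul _ _ hm0 (hT0 P n hn'), hm1, zero_add]
      exact hTA P n hn'
  · rintro (n | n) hn (m | m) hm h1 h2 k hk hk0 hlog
    · simp at h2
    · have hn' : n ∈ Q.support := by simpa using hn
      have hm' : m ∈ P.support := by simpa using hm
      simp only [y, Sum.elim_inl, Sum.elim_inr] at hlog
      rw [Differential.logDeriv_mul _ _ he (hT0 Q n hn'), hel,
        Differential.logDeriv_mul _ _ hm0 (hT0 P m hm'), hm1, zero_add, hTl Q n hn', hTl P m hm'] at hlog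
      refine no_log hc X hX (ι := Option ι) (fun o => o.elim 1 (fun i => (m i - n i) * μ i))
        (fun o => o.elim k f) ?_ ?_
      · rintro (_ | i)
        · exact (hA k).1 hk
        · exact hf i
      · rw [Fintype.sum_option]
        simp only [Option.elim_none, Option.elim_some, map_one, one_mul, ← hlog]
        rw [← sub_eq_zero]
        have : ∑ i, algebraMap ℂ M ((m i - n i) * μ i) * Differential.logDeriv (f i) =
          ∑ i, algebraMap ℂ M (m i * μ i) * Differential.logDeriv (f i) -
          ∑ i, algebraMap ℂ M (n i * μ i) * Differential.logDeriv (f i) := by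
          rw [← Finset.sum_sub_distrib]
          refine Finset.sum_congr rfl fun i _ => ?_
          simp only [map_mul, map_sub]; ring
        rw [this]; ring
    · simp at h1
    · simp at h1
  · rw [Finset.sum_disjSum]
    simp only [y, Sum.elim_inl, Sum.elim_inr]
    rw [← Finset.mul_sum, ← Finset.mul_sum, ← hTs, ← hTs, h]; ring

end
end NashAux

namespace NashAux
open Differential Polynomial Filter Topology
open scoped Polynomial.Bivariate

section germs

/-- ring of germs of meromorphic functions -/
def merRing (x : ℂ) : Subring (Germ (𝓝[≠] x) ℂ) where
  carrier := {g | ∃ f : ℂ → ℂ, MeromorphicAt f x ∧ (f : Germ (𝓝[≠] x) ℂ) = g}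
  mul_mem' := by
    rintro _ _ ⟨f, hf, rfl⟩ ⟨g, hg, rfl⟩
    exact ⟨f * g, hf.mul hg, rfl⟩
  add_mem' := by
    rintro _ _ ⟨f, hf, rfl⟩ ⟨g, hg, rfl⟩
    exact ⟨f + g, hf.add hg, rfl⟩
  neg_mem' := by
    rintro _ ⟨f, hf, rfl⟩
    exact ⟨-f, hf.neg, rfl⟩
  zero_mem' := ⟨0, MeromorphicAt.const 0 x, rfl⟩
  one_mem' := ⟨1, MeromorphicAt.const 1 x, rfl⟩

/-- germs of meromorphic functions -/
def Mer (x : ℂ) : Type := merRing x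

noncomputable instance merCommRing (x : ℂ) : CommRing (Mer x) :=
  inferInstanceAs (CommRing (merRing x))

variable {x : ℂ}

noncomputable def mk (f : ℂ → ℂ) (hf : MeromorphicAt f x) : Mer x := ⟨(f : Germ (𝓝[≠] x) ℂ), f, hf, rfl⟩

lemma mk_eq {f g : ℂ → ℂ} {hf : MeromorphicAt f x} {hg : MeromorphicAt g x} :
    mk f hf = mk g hg ↔ f =ᶠ[𝓝[≠] x] g := by
  constructor
  · intro h
    exact Germ.coe_eq.1 (congrArg Subtype.val h)
  · intro h
    exact Subtype.ext (Germ.coe_eq.2 h)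

lemma mk_eq_of {f g : ℂ → ℂ} {hf : MeromorphicAt f x} {hg : MeromorphicAt g x}
    (h : f =ᶠ[𝓝 x] g) : mk f hf = mk g hg :=
  mk_eq.2 (h.filter_mono nhdsWithin_le_nhds)

lemma exists_mk (g : Mer x) : ∃ f, ∃ hf : MeromorphicAt f x, g = mk f hf := by
  obtain ⟨_, f, hf, rfl⟩ := g
  exact ⟨f, hf, rfl⟩

lemma mk_add {f g : ℂ → ℂ} (hf : MeromorphicAt f x) (hg : MeromorphicAt g x) :
    mk f hf + mk g hg = mk (f + g) (hf.add hg) := rfl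
lemma mk_mul {f g : ℂ → ℂ} (hf : MeromorphicAt f x) (hg : MeromorphicAt g x) :
    mk f hf * mk g hg = mk (f * g) (hf.mul hg) := rfl
lemma mk_one : (1 : Mer x) = mk 1 (MeromorphicAt.const 1 x) := rfl
lemma mk_zero : (0 : Mer x) = mk 0 (MeromorphicAt.const 0 x) := rfl

lemma mer_isField (x : ℂ) : IsField (Mer x) where
  exists_pair_ne := ⟨0, 1, by
    rw [mk_zero, mk_one, Ne, mk_eq]
    intro h
    obtain ⟨y, hy⟩ := h.exists
    simp at hy⟩
  mul_comm := mul_comm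
  mul_inv_cancel := by
    intro a ha
    obtain ⟨f, hf, rfl⟩ := exists_mk a
    refine ⟨mk f⁻¹ hf.inv, ?_⟩
    rw [mk_mul, mk_one, mk_eq]
    rcases hf.eventually_eq_zero_or_eventually_ne_zero with h | h
    · exact absurd ((mk_eq (hg := MeromorphicAt.const 0 x)).2 h) ha
    · filter_upwards [h] with z hz
      simp [hz]

noncomputable instance merField (x : ℂ) : Field (Mer x) := (mer_isField x).toField

lemma mk_ne_zero {f : ℂ → ℂ} {hf : MeromorphicAt f x} (h : ∀ᶠ z in 𝓝 x, f z ≠ 0) :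
    mk f hf ≠ 0 := by
  rw [mk_zero, Ne, mk_eq]
  intro h'
  obtain ⟨y, hy, hy'⟩ := (h'.and (h.filter_mono nhdsWithin_le_nhds)).exists
  exact hy' hy

noncomputable def mconst (x : ℂ) : ℂ →+* Mer x where
  toFun c := mk (fun _ => c) (MeromorphicAt.const c x)
  map_one' := rfl
  map_zero' := rfl
  map_add' _ _ := rfl
  map_mul' _ _ := rfl

noncomputable instance merAlgebra (x : ℂ) : Algebra ℂ (Mer x) := (mconst x).toAlgebra

lemma algebraMap_mk (c : ℂ) : algebraMap ℂ (Mer x) c =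
  mk (fun _ => c) (MeromorphicAt.const c x) := rfl

lemma deriv_congr_punct {f g : ℂ → ℂ} (h : f =ᶠ[𝓝[≠] x] g) : deriv f =ᶠ[𝓝[≠] x] deriv g := by
  have h1 := eventually_eventually_nhdsWithin.2 h
  filter_upwards [h1, self_mem_nhdsWithin] with z hz hzx
  have : 𝓝[≠] x ≤ 𝓝[≠] x := le_rfl
  rw [(isOpen_compl_singleton (x := x)).nhdsWithin_eq hzx] at hz
  exact Filter.EventuallyEq.deriv_eq hz

noncomputable def mderivFun (a : Mer x) : Mer x :=
  mk (deriv (exists_mk a).choose) (exists_mk a).choose_spec.choose.deriv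

lemma mderivFun_mk {f : ℂ → ℂ} (hf : MeromorphicAt f x) :
    mderivFun (mk f hf) = mk (deriv f) hf.deriv := by
  unfold mderivFun
  rw [mk_eq]
  apply deriv_congr_punct
  exact (mk_eq.1 (exists_mk (mk f hf)).choose_spec.choose_spec).symm

noncomputable def mderiv (x : ℂ) : Derivation ℤ (Mer x) (Mer x) :=
  Derivation.mk' (AddMonoidHom.toIntLinearMap
    { toFun := mderivFun
      map_zero' := by
        rw [mk_zero, mderivFun_mk, mk_eq]
        have : deriv (0 : ℂ → ℂ) = 0 := by ext z; simp
        rw [this]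
      map_add' := by
        intro a b
        obtain ⟨f, hf, rfl⟩ := exists_mk a
        obtain ⟨g, hg, rfl⟩ := exists_mk b
        rw [mk_add, mderivFun_mk, mderivFun_mk, mderivFun_mk, mk_add, mk_eq]
        filter_upwards [hf.eventually_analyticAt, hg.eventually_analyticAt] with z h1 h2
        exact deriv_add h1.differentiableAt h2.differentiableAt }) (by
    intro a b
    obtain ⟨f, hf, rfl⟩ := exists_mk a
    obtain ⟨g, hg, rfl⟩ := exists_mk b
    change mderivFun _ = mk f hf * mderivFun _ + mk g hg * mderivFun _
    rw [mk_mul, mderivFun_mk, mderivFun_mk, mderivFun_mk, mk_mul, mk_mul, mk_add, mk_eq]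
    filter_upwards [hf.eventually_analyticAt, hg.eventually_analyticAt] with z h1 h2
    rw [deriv_mul h1.differentiableAt h2.differentiableAt]
    simp only [Pi.add_apply, Pi.mul_apply]
    ring)

lemma mderiv_mk {f : ℂ → ℂ} (hf : MeromorphicAt f x) :
    mderiv x (mk f hf) = mk (deriv f) hf.deriv := mderivFun_mk hf

lemma mderiv_algebraMap (c : ℂ) : mderiv x (algebraMap ℂ (Mer x) c) = 0 := by
  rw [algebraMap_mk, mderiv_mk, mk_zero, mk_eq]
  filter_upwards with z
  simp

lemma meromorphicAt_eval {ι : Type*} {g : ι → ℂ → ℂ} (hg : ∀ i, MeromorphicAt (g i) x)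
    (R : MvPolynomial ι ℂ) : ∃ h : MeromorphicAt (fun z => MvPolynomial.eval (fun i => g i z) R) x,
      MvPolynomial.aeval (fun i => mk (g i) (hg i)) R = mk _ h := by
  induction R using MvPolynomial.induction_on with
  | C a =>
    refine ⟨by simp, ?_⟩
    simp only [MvPolynomial.aeval_C, algebraMap_mk, MvPolynomial.eval_C]
  | add p q hp hq =>
    obtain ⟨h1, e1⟩ := hp
    obtain ⟨h2, e2⟩ := hq
    refine ⟨by simp only [map_add]; exact h1.add h2, ?_⟩
    rw [map_add, e1, e2, mk_add, mk_eq]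
    filter_upwards with z
    simp
  | mul_X p i hp =>
    obtain ⟨h1, e1⟩ := hp
    refine ⟨by simp only [map_mul, MvPolynomial.eval_X]; exact h1.mul (hg i), ?_⟩
    rw [map_mul, e1, MvPolynomial.aeval_X, mk_mul, mk_eq]
    filter_upwards with z
    simp

lemma aevalAeval_mk {f g : ℂ → ℂ} (hf : MeromorphicAt f x) (hg : MeromorphicAt g x)
    (p : ℂ[X][Y]) (h : ∀ᶠ z in 𝓝 x, evalEval (f z) (g z) p = 0) :
    aevalAeval (mk f hf) (mk g hg) p = 0 := by
  have key : ∃ h : MeromorphicAt (fun z => evalEval (f z) (g z) p) x,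
      aevalAeval (mk f hf) (mk g hg) p = mk _ h := by
    obtain ⟨h1, e1⟩ := meromorphicAt_eval (x := x) (g := ![f, g])
      (fun i => by fin_cases i <;> simpa) (Bivariate.equivMvPolynomial ℂ p)
    have e2 : ∀ z, MvPolynomial.eval (fun i => ![f, g] i z) (Bivariate.equivMvPolynomial ℂ p)
        = evalEval (f z) (g z) p := by
      intro z
      rw [← coe_aevalAeval_eq_evalEval]
      have : (MvPolynomial.aeval (fun i => ![f, g] i z)).comp
        (Bivariate.equivMvPolynomial ℂ).toAlgHom = aevalAeval (R := ℂ) (f z) (g z) := by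
        ext <;> simp [Bivariate.equivMvPolynomial]
      rw [← this]; simp [MvPolynomial.aeval_eq_eval]
    have e3 : aevalAeval (mk f hf) (mk g hg) p = MvPolynomial.aeval
        (fun i => mk (![f, g] i) (by fin_cases i <;> simpa)) (Bivariate.equivMvPolynomial ℂ p) := by
      have : (MvPolynomial.aeval (fun i => mk (![f, g] i) (by fin_cases i <;> simpa))).comp
        (Bivariate.equivMvPolynomial ℂ).toAlgHom = aevalAeval (R := ℂ) (mk f hf) (mk g hg) := by
        ext <;> simp [Bivariate.equivMvPolynomial]
      rw [← this]; rfl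
    have h2 : MeromorphicAt (fun z => evalEval (f z) (g z) p) x := by
      simpa only [e2] using h1
    refine ⟨h2, ?_⟩
    rw [e3, e1, mk_eq]
    filter_upwards with z
    rw [e2]
  obtain ⟨h', e⟩ := key
  rw [e, mk_zero]
  exact mk_eq_of h

end germs
end NashAux

namespace NashAux
open Differential Polynomial Filter Topology
open scoped Polynomial.Bivariate

section loc

lemma mderiv_eq {x : ℂ} {f h : ℂ → ℂ} {hf : MeromorphicAt f x} {hh : MeromorphicAt h x}
    (H : ∀ᶠ z in 𝓝 x, HasDerivAt f (h z) z) : mderiv x (mk f hf) = mk h hh := by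
  rw [mderiv_mk]
  apply mk_eq_of
  filter_upwards [H] with z hz using hz.deriv

theorem local_core (x : ℂ) (f : ℂ → ℂ) (hf : AnalyticAt ℂ f x) (hfs : f x ∈ Complex.slitPlane)
    (hf' : ¬ ∀ᶠ z in 𝓝[≠] x, deriv f z = 0)
    {ι : Type*} [Fintype ι] (F : ι → ℂ → ℂ) (hF : ∀ i, AnalyticAt ℂ (F i) x)
    (hFs : ∀ i, F i x ∈ Complex.slitPlane ∨ ∃ c : ℂ, c ≠ 0 ∧ F i =ᶠ[𝓝 x] fun _ => c)
    (μ : ℝ) (hμ : μ ≠ 0) (μs : ι → ℝ)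
    (p : ℂ[X][Y]) (hp : p ≠ 0) (hpf : ∀ᶠ z in 𝓝 x, evalEval z (f z) p = 0)
    (ps : ι → ℂ[X][Y]) (hps : ∀ i, ps i ≠ 0)
    (hpsf : ∀ i, ∀ᶠ z in 𝓝 x, evalEval z (F i z) (ps i) = 0)
    (P Q : MvPolynomial ι ℂ)
    (hQ : ∀ᶠ z in 𝓝 x, MvPolynomial.eval (fun i => F i z ^ (μs i : ℂ)) Q ≠ 0)
    (heq : ∀ᶠ z in 𝓝 x, Complex.exp (f z ^ (μ : ℂ)) *
      MvPolynomial.eval (fun i => F i z ^ (μs i : ℂ)) Q =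
      MvPolynomial.eval (fun i => F i z ^ (μs i : ℂ)) P) : False := by
  have hμc : (μ : ℂ) ≠ 0 := by exact_mod_cast hμ
  have hmc : algebraMap ℂ (Mer x) (μ : ℂ) ≠ 0 := by
    rw [Ne, map_eq_zero]; exact hμc
  have hfslit : ∀ᶠ z in 𝓝 x, f z ∈ Complex.slitPlane :=
    hf.continuousAt.eventually (Complex.isOpen_slitPlane.mem_nhds hfs)
  have hfne : ∀ᶠ z in 𝓝 x, f z ≠ 0 := hfslit.mono fun z hz => Complex.slitPlane_ne_zero hz
  have hfd : ∀ᶠ z in 𝓝 x, HasDerivAt f (deriv f z) z :=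
    hf.eventually_analyticAt.mono fun z hz => hz.differentiableAt.hasDerivAt
  have hL : AnalyticAt ℂ (fun z => Complex.log (f z)) x := hf.clog hfs
  have hLd : ∀ᶠ z in 𝓝 x, HasDerivAt (fun z => Complex.log (f z)) (deriv f z / f z) z := by
    filter_upwards [hfd, hfslit] with z h1 h2 using h1.clog h2
  have hl : AnalyticAt ℂ (fun z => deriv f z / f z) x :=
    hf.deriv.fun_div hf (Complex.slitPlane_ne_zero hfs)
  set ℓ : Mer x := mk _ hl.meromorphicAt with hℓ
  have hℓ0 : ℓ ≠ 0 := by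
    intro h
    apply hf'
    rw [hℓ, mk_zero, mk_eq] at h
    filter_upwards [h, hfne.filter_mono nhdsWithin_le_nhds] with z h1 h2
    simpa [h2] using h1
  let cc : Mer x := (algebraMap ℂ (Mer x) (μ : ℂ) * ℓ)⁻¹
  have hcc : cc ≠ 0 := inv_ne_zero (mul_ne_zero hmc hℓ0)
  let _ : Differential (Mer x) := ⟨cc • mderiv x⟩
  have hδ : ∀ a : Mer x, (a′) = cc * mderiv x a := fun a => rfl
  have hc : ∀ c : ℂ, (algebraMap ℂ (Mer x) c)′ = 0 := fun c => by
    rw [hδ, mderiv_algebraMap, mul_zero]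
  -- the powers
  have hXa : ∀ a : ℝ, AnalyticAt ℂ (fun z => Complex.exp (a * μ * Complex.log (f z))) x :=
    fun a => (analyticAt_const.mul hL).cexp
  let X : Multiplicative ℝ →* Mer x :=
    { toFun := fun a => mk _ (hXa a.toAdd).meromorphicAt
      map_one' := by
        rw [mk_one]
        apply mk_eq_of
        filter_upwards with z
        simp
      map_mul' := by
        intro a b
        rw [mk_mul]
        apply mk_eq_of
        filter_upwards with z
        simp only [toAdd_mul, Pi.mul_apply, ← Complex.exp_add]
        congr 1; push_cast; ring }
  have hXdef : ∀ a : ℝ, X (Multiplicative.ofAdd a) = mk _ (hXa a).meromorphicAt := fun a => rfl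
  have hX : ∀ a : ℝ, (X (Multiplicative.ofAdd a))′ =
      algebraMap ℂ (Mer x) a * X (Multiplicative.ofAdd a) := by
    intro a
    have h1 : mderiv x (X (Multiplicative.ofAdd a)) = algebraMap ℂ (Mer x) (a : ℂ) *
        (algebraMap ℂ (Mer x) (μ : ℂ) * ℓ) * X (Multiplicative.ofAdd a) := by
      rw [hXdef, hℓ, algebraMap_mk, algebraMap_mk, mk_mul, mk_mul, mk_mul]
      apply mderiv_eq
      filter_upwards [hLd] with z hz
      refine (hz.const_mul (a * μ : ℂ)).cexp.congr_deriv ?_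
      simp only [Pi.mul_apply]; ring
    rw [hδ, h1]
    simp only [cc]
    have := mul_ne_zero hmc hℓ0
    field_simp
  -- f as a power
  let fg : Mer x := mk f hf.meromorphicAt
  let zg : Mer x := mk id (MeromorphicAt.id x)
  have hfX : X (Multiplicative.ofAdd (1 / μ)) = fg := by
    rw [hXdef]
    apply mk_eq_of
    filter_upwards [hfne] with z hz
    have : ((1 / μ : ℝ) : ℂ) * μ = 1 := by push_cast; field_simp
    rw [this, one_mul, Complex.exp_log hz]
  have hfalg : IsAlgebraic (E0 X) fg := by
    rw [← hfX]
    exact isAlgebraic_algebraMap (⟨_, X_mem_E0 X _⟩ : E0 X)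
  have hfder : (fg′) ≠ 0 := by
    rw [hδ, mderiv_mk]
    refine mul_ne_zero hcc ?_
    intro h
    apply hf'
    rw [mk_zero, mk_eq] at h
    exact h
  have hzder : (zg′) ≠ 0 := by
    rw [hδ, mderiv_mk]
    refine mul_ne_zero hcc (mk_ne_zero ?_)
    filter_upwards with z
    simp
  have hzalg : IsAlgebraic (E0 X) zg := by
    refine alg_of_rel (E0 X) hfalg (transcendental_of_deriv_ne hc hfder)
      (p := Bivariate.swap p) ?_ ?_
    · simpa using hp
    · rw [Bivariate.aevalAeval_swap]
      exact aevalAeval_mk _ _ p hpf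
  have hFalg : ∀ i, IsAlgebraic (E0 X) (mk (F i) (hF i).meromorphicAt) := fun i =>
    alg_of_rel (E0 X) hzalg (transcendental_of_deriv_ne hc hzder) (hps i)
      (aevalAeval_mk _ _ (ps i) (hpsf i))
  have hFne : ∀ i, ∀ᶠ z in 𝓝 x, F i z ≠ 0 := by
    intro i
    rcases hFs i with h | ⟨c, hc0, h⟩
    · filter_upwards [(hF i).continuousAt.eventually (Complex.isOpen_slitPlane.mem_nhds h)]
        with z hz using Complex.slitPlane_ne_zero hz
    · filter_upwards [h] with z hz
      rwa [hz]
  have hGan : ∀ i, AnalyticAt ℂ (fun z => F i z ^ (μs i : ℂ)) x := by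
    intro i
    rcases hFs i with h | ⟨c, hc0, h⟩
    · exact (hF i).cpow analyticAt_const h
    · refine (analyticAt_const (v := c ^ (μs i : ℂ))).congr ?_
      filter_upwards [h] with z hz
      rw [hz]
  have hGd : ∀ i, ∀ᶠ z in 𝓝 x, HasDerivAt (fun z => F i z ^ (μs i : ℂ))
      (μs i * (deriv (F i) z / F i z) * F i z ^ (μs i : ℂ)) z := by
    intro i
    rcases hFs i with h | ⟨c, hc0, h⟩
    · filter_upwards [(hF i).continuousAt.eventually (Complex.isOpen_slitPlane.mem_nhds h),
        (hF i).eventually_analyticAt] with z hz hz'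
      have hz0 := Complex.slitPlane_ne_zero hz
      convert hz'.differentiableAt.hasDerivAt.cpow_const (c := (μs i : ℂ)) hz using 1
      rw [Complex.cpow_sub _ _ hz0, Complex.cpow_one]
      field_simp
    · filter_upwards [h.eventually_nhds] with z hz
      have h1 : deriv (F i) z = 0 := by
        rw [Filter.EventuallyEq.deriv_eq (f := fun _ => c) hz]; simp
      rw [h1]
      have h2 : (fun z => F i z ^ (μs i : ℂ)) =ᶠ[𝓝 z] fun _ => c ^ (μs i : ℂ) := by
        filter_upwards [hz] with w hw
        rw [hw]
      simpa using (hasDerivAt_const z (c ^ (μs i : ℂ))).congr_of_eventuallyEq h2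
  have hpow : AnalyticAt ℂ (fun z => f z ^ (μ : ℂ)) x := hf.cpow analyticAt_const hfs
  have hX1 : X (Multiplicative.ofAdd 1) = mk _ hpow.meromorphicAt := by
    rw [hXdef]
    apply mk_eq_of
    filter_upwards [hfne] with z hz
    rw [Complex.cpow_def_of_ne_zero hz]
    simp [mul_comm]
  have hean : AnalyticAt ℂ (fun z => Complex.exp (f z ^ (μ : ℂ))) x := hpow.cexp
  obtain ⟨hQm, hQe⟩ := meromorphicAt_eval (x := x) (fun i => (hGan i).meromorphicAt) Q
  obtain ⟨hPm, hPe⟩ := meromorphicAt_eval (x := x) (fun i => (hGan i).meromorphicAt) P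
  have he0 : mk _ hean.meromorphicAt ≠ 0 := mk_ne_zero (by
    filter_upwards with z using Complex.exp_ne_zero _)
  refine alg_core hc X hX (fun i => mk (F i) (hF i).meromorphicAt)
    (fun i => mk _ (hGan i).meromorphicAt) (fun i => (μs i : ℂ)) hFalg ?_ ?_
    (mk _ hean.meromorphicAt) he0 ?_ P Q ?_ ?_
  · intro i
    apply mk_ne_zero
    filter_upwards [hFne i] with z hz
    simp [Complex.cpow_eq_zero_iff, hz]
  · intro i
    have hF0 : mk (F i) (hF i).meromorphicAt ≠ 0 := mk_ne_zero (hFne i)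
    have hG0 : mk _ (hGan i).meromorphicAt ≠ 0 := mk_ne_zero (by
      filter_upwards [hFne i] with z hz
      simp [Complex.cpow_eq_zero_iff, hz])
    have key : mderiv x (mk _ (hGan i).meromorphicAt) * mk (F i) (hF i).meromorphicAt =
        algebraMap ℂ (Mer x) (μs i) * mderiv x (mk (F i) (hF i).meromorphicAt) *
          mk _ (hGan i).meromorphicAt := by
      rw [mderiv_mk, mderiv_mk, algebraMap_mk, mk_mul, mk_mul, mk_mul]
      apply mk_eq_of
      filter_upwards [hGd i, hFne i] with z h1 h2
      simp only [Pi.mul_apply]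
      rw [h1.deriv]
      field_simp
    simp only [Differential.logDeriv, hδ]
    rw [← mul_div_assoc, div_eq_div_iff hG0 hF0, mul_assoc, key]
    ring
  · have h1 : mderiv x (mk _ hean.meromorphicAt) = X (Multiplicative.ofAdd 1) *
        (algebraMap ℂ (Mer x) (μ : ℂ) * ℓ) * (mk _ hean.meromorphicAt) := by
      rw [hX1, hℓ, algebraMap_mk, mk_mul, mk_mul, mk_mul]
      apply mderiv_eq
      filter_upwards [hfd, hfslit] with z hz hz'
      have hz0 := Complex.slitPlane_ne_zero hz'
      refine (hz.cpow_const (c := (μ : ℂ)) hz').cexp.congr_deriv ?_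
      simp only [Pi.mul_apply]
      rw [Complex.cpow_sub _ _ hz0, Complex.cpow_one]
      field_simp
    simp only [Differential.logDeriv, hδ]
    rw [h1]
    have := mul_ne_zero hmc hℓ0
    simp only [cc]
    field_simp
  · rw [hQe]
    exact mk_ne_zero hQ
  · rw [hQe, hPe, mk_mul]
    exact mk_eq_of heq

end loc
end NashAux

namespace NashAux
open Polynomial Filter Topology
open scoped Polynomial.Bivariate

lemma slit_meets {W : Set ℂ} (hW : IsOpen W) (hne : W.Nonempty) :
    (W ∩ Complex.slitPlane).Nonempty := by
  obtain ⟨w, hw⟩ := hne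
  by_cases h : w ∈ Complex.slitPlane
  · exact ⟨w, hw, h⟩
  · obtain ⟨ε, hε, hb⟩ := Metric.isOpen_iff.1 hW w hw
    rw [Complex.mem_slitPlane_iff] at h
    push Not at h
    refine ⟨w + (ε / 2 : ℝ) * Complex.I, hb ?_, ?_⟩
    · rw [Metric.mem_ball, dist_eq_norm, add_sub_cancel_left, norm_mul, Complex.norm_I, mul_one,
        Complex.norm_real, Real.norm_of_nonneg (by linarith)]
      linarith
    · rw [Complex.mem_slitPlane_iff]
      right
      simp [h.2, hε.ne']

lemma shrink_one {U : Set ℂ} (hU : IsOpen U) (hne : U.Nonempty) {g : ℂ → ℂ}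
    (hg : DifferentiableOn ℂ g U) : ∃ U' ⊆ U, IsOpen U' ∧ U'.Nonempty ∧
      ((∀ z ∈ U', g z ∈ Complex.slitPlane) ∨ ∃ c, ∀ z ∈ U', g z = c) := by
  obtain ⟨w, hw⟩ := hne
  obtain ⟨ε, hε, hb⟩ := Metric.isOpen_iff.1 hU w hw
  have hgb := hg.mono hb
  have hwb : w ∈ Metric.ball w ε := Metric.mem_ball_self hε
  rcases (hgb.analyticOnNhd Metric.isOpen_ball).is_constant_or_isOpen
    (convex_ball w ε).isPreconnected with ⟨c, hc⟩ | h
  · exact ⟨_, hb, Metric.isOpen_ball, ⟨w, hwb⟩, Or.inr ⟨c, hc⟩⟩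
  · obtain ⟨_, ⟨z, hz, rfl⟩, hs⟩ := slit_meets (h _ subset_rfl Metric.isOpen_ball)
      ⟨g w, w, hwb, rfl⟩
    exact ⟨Metric.ball w ε ∩ g ⁻¹' Complex.slitPlane, Set.inter_subset_left.trans hb,
      hgb.continuousOn.isOpen_inter_preimage Metric.isOpen_ball Complex.isOpen_slitPlane,
      ⟨z, hz, hs⟩, Or.inl fun z hz => hz.2⟩

lemma shrink_all {ι : Type*} [Fintype ι] {U : Set ℂ} (hU : IsOpen U) (hne : U.Nonempty)
    {g : ι → ℂ → ℂ} (hg : ∀ i, DifferentiableOn ℂ (g i) U) :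
    ∃ U' ⊆ U, IsOpen U' ∧ U'.Nonempty ∧
      ∀ i, ((∀ z ∈ U', g i z ∈ Complex.slitPlane) ∨ ∃ c, ∀ z ∈ U', g i z = c) := by
  classical
  have : ∀ s : Finset ι, ∃ U' ⊆ U, IsOpen U' ∧ U'.Nonempty ∧
      ∀ i ∈ s, ((∀ z ∈ U', g i z ∈ Complex.slitPlane) ∨ ∃ c, ∀ z ∈ U', g i z = c) := by
    intro s
    induction s using Finset.induction_on with
    | empty => exact ⟨U, subset_rfl, hU, hne, by simp⟩
    | insert a s ha ih =>
      obtain ⟨U₁, hs₁, ho₁, hn₁, h₁⟩ := ih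
      obtain ⟨U₂, hs₂, ho₂, hn₂, h₂⟩ := shrink_one ho₁ hn₁ ((hg a).mono hs₁)
      refine ⟨U₂, hs₂.trans hs₁, ho₂, hn₂, fun i hi => ?_⟩
      rcases Finset.mem_insert.1 hi with rfl | hi
      · exact h₂
      · rcases h₁ i hi with h | ⟨c, h⟩
        · exact Or.inl fun z hz => h z (hs₂ hz)
        · exact Or.inr ⟨c, fun z hz => h z (hs₂ hz)⟩
  obtain ⟨U', h1, h2, h3, h4⟩ := this Finset.univ
  exact ⟨U', h1, h2, h3, fun i => h4 i (Finset.mem_univ i)⟩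

theorem one_var {D : Set ℂ} (hD : IsOpen D) (hDc : IsPreconnected D)
    {ι : Type*} [Fintype ι] (f : ℂ → ℂ) (F : ι → ℂ → ℂ) (hf : DifferentiableOn ℂ f D)
    (hF : ∀ i, DifferentiableOn ℂ (F i) D) (hFne : ∀ i, ∀ z ∈ D, F i z ≠ 0)
    (μ : ℝ) (hμ : μ ≠ 0) (μs : ι → ℝ)
    (p : ℂ[X][Y]) (hp : p ≠ 0) (hpf : ∀ z ∈ D, evalEval z (f z) p = 0)
    (ps : ι → ℂ[X][Y]) (hps : ∀ i, ps i ≠ 0)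
    (hpsf : ∀ i, ∀ z ∈ D, evalEval z (F i z) (ps i) = 0)
    (P Q : MvPolynomial ι ℂ)
    (hQ : ∀ z ∈ D, MvPolynomial.eval (fun i => F i z ^ (μs i : ℂ)) Q ≠ 0)
    (heq : ∀ z ∈ D, Complex.exp (f z ^ (μ : ℂ)) *
      MvPolynomial.eval (fun i => F i z ^ (μs i : ℂ)) Q =
      MvPolynomial.eval (fun i => F i z ^ (μs i : ℂ)) P) :
    ∀ z ∈ D, ∀ w ∈ D, f z = f w := by
  by_contra hcon
  have hfa := hf.analyticOnNhd hD
  -- not locally constant anywhere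
  have hnc : ∀ x ∈ D, ∀ c, ¬ ∀ᶠ z in 𝓝 x, f z = c := by
    intro x hx c h
    apply hcon
    have := hfa.eqOn_of_preconnected_of_eventuallyEq (g := fun _ => c) analyticOnNhd_const hDc hx h
    intro z hz w hw
    rw [this hz, this hw]
  have hne : D.Nonempty := by
    by_contra h
    rw [Set.not_nonempty_iff_eq_empty] at h
    simp [h] at hcon
  obtain ⟨U, hUD, hU, ⟨x, hx⟩, hall⟩ := shrink_all (ι := Option ι) hD hne
    (g := fun o => o.elim f F) (by rintro (_ | i); exacts [hf, hF i])
  have hxU : U ∈ 𝓝 x := hU.mem_nhds hx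
  have hxD : D ∈ 𝓝 x := mem_of_superset hxU hUD
  have ev : ∀ {q : ℂ → Prop}, (∀ z ∈ D, q z) → ∀ᶠ z in 𝓝 x, q z := fun h =>
    mem_of_superset hxD h
  refine local_core x f (hfa x (hUD hx)) ?_ ?_ F (fun i => (hF i).analyticOnNhd hD x (hUD hx)) ?_
    μ hμ μs p hp (ev hpf) ps hps (fun i => ev (hpsf i)) P Q (ev hQ) (ev heq)
  · rcases hall none with h | ⟨c, h⟩
    · exact h x hx
    · exact absurd (mem_of_superset hxU h) (hnc x (hUD hx) c)
  · intro h
    have h1 : ∀ᶠ z in 𝓝 x, deriv f z = 0 :=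
      (hfa x (hUD hx)).deriv.frequently_zero_iff_eventually_zero.1 h.frequently
    obtain ⟨ε, hε, hb⟩ := Metric.mem_nhds_iff.1 (inter_mem h1 hxD)
    apply hnc x (hUD hx) (f x)
    filter_upwards [Metric.ball_mem_nhds x hε] with z hz
    exact (Metric.isOpen_ball (x := x) (ε := ε)).is_const_of_deriv_eq_zero
      (convex_ball x ε).isPreconnected (hf.mono fun z hz => (hb hz).2) (fun z hz => (hb hz).1)
      hz (Metric.mem_ball_self hε)
  · intro i
    rcases hall (some i) with h | ⟨c, h⟩
    · exact Or.inl (h x hx)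
    · refine Or.inr ⟨c, ?_, mem_of_superset hxU h⟩
      rw [← h x hx]
      exact hFne i x (hUD hx)

end NashAux

namespace NashAux
open Polynomial Filter Topology
open scoped Polynomial.Bivariate

/-- restriction of a polynomial to a line -/
noncomputable def lineRes {n : ℕ} (p v : Fin n → ℂ) (P : MvPolynomial (Fin (n + 1)) ℂ) : ℂ[X][Y] :=
  MvPolynomial.aeval
    (Fin.snoc (α := fun _ => ℂ[X][Y]) (fun i => C (C (p i) + X * C (v i))) Y) P

lemma evalEval_lineRes {n : ℕ} (p v : Fin n → ℂ) (P : MvPolynomial (Fin (n + 1)) ℂ) (z y : ℂ) :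
    evalEval z y (lineRes p v P) = MvPolynomial.eval (Fin.snoc (p + z • v) y) P := by
  rw [← coe_aevalAeval_eq_evalEval]
  have : (aevalAeval (R := ℂ) z y).comp (MvPolynomial.aeval
    (Fin.snoc (α := fun _ => ℂ[X][Y]) (fun i => C (C (p i) + X * C (v i))) Y)) =
    MvPolynomial.aeval (Fin.snoc (p + z • v) y) := by
    ext i
    refine Fin.lastCases ?_ (fun i => ?_) i
    · simp
    · simp only [MvPolynomial.aeval_X, AlgHom.comp_apply, Fin.snoc_castSucc, aevalAeval_C,
        Pi.add_apply, Pi.smul_apply]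
      simp
      ring
  have h2 := DFunLike.congr_fun this P
  rw [AlgHom.comp_apply] at h2
  exact h2

lemma local_const (κ κ₁ κ₂ : ℕ)
    (V : Set (Fin κ → ℂ)) (hVo : IsOpen V)
    (H : (Fin κ → ℂ) → ℂ) (Hs : Fin (κ₁ + κ₂) → (Fin κ → ℂ) → ℂ)
    (hH : IsNashOn κ V H) (hHs : ∀ j, IsNashOn κ V (Hs j))
    (hHsne : ∀ j, ∀ ξ ∈ V, Hs j ξ ≠ 0)
    (μ : ℝ) (hμ : μ ≠ 0) (μs : Fin (κ₁ + κ₂) → ℝ)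
    (P Q : MvPolynomial (Fin κ₁) ℂ)
    (hQne : ∀ ξ ∈ V,
      MvPolynomial.eval
        (fun i => Hs (Fin.castAdd κ₂ i) ξ ^ ((μs (Fin.castAdd κ₂ i) : ℂ))) Q ≠ 0)
    (heq : ∀ ξ ∈ V,
      Complex.exp (H ξ ^ ((μ : ℂ))) =
        (MvPolynomial.eval
            (fun i => Hs (Fin.castAdd κ₂ i) ξ ^ ((μs (Fin.castAdd κ₂ i) : ℂ))) P /
          MvPolynomial.eval
            (fun i => Hs (Fin.castAdd κ₂ i) ξ ^ ((μs (Fin.castAdd κ₂ i) : ℂ))) Q) *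
        ∏ j : Fin κ₂, Hs (Fin.natAdd κ₁ j) ξ ^ ((μs (Fin.natAdd κ₁ j) : ℂ)))
    (ξ : Fin κ → ℂ) (hξ : ξ ∈ V) : ∀ᶠ η in 𝓝 ξ, H η = H ξ := by
  obtain ⟨U, hUo, hξU, hUV, P₀, hP₀, hPU⟩ := hH.2 ξ hξ
  have hall := fun j => (hHs j).2 ξ hξ
  choose Us hUso hξUs hUsV Ps hPs hPsU using hall
  have hW : (V ∩ U) ∩ ⋂ j, Us j ∈ 𝓝 ξ :=
    inter_mem (inter_mem (hVo.mem_nhds hξ) (hUo.mem_nhds hξU))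
      ((isOpen_iInter_of_finite hUso).mem_nhds (Set.mem_iInter.2 hξUs))
  obtain ⟨ε, hε, hb⟩ := Metric.mem_nhds_iff.1 hW
  have hbV : ∀ η ∈ Metric.ball ξ ε, η ∈ V := fun η h => (hb h).1.1
  have hbU : ∀ η ∈ Metric.ball ξ ε, η ∈ U := fun η h => (hb h).1.2
  have hbUs : ∀ j, ∀ η ∈ Metric.ball ξ ε, η ∈ Us j := fun j η h => Set.mem_iInter.1 (hb h).2 j
  -- a good base point
  have hgood : ∃ w : Fin (κ + 1) → ℂ, (∀ i : Fin κ, w i.castSucc ∈ Metric.ball (ξ i) ε) ∧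
      MvPolynomial.eval w (P₀ * ∏ j, Ps j) ≠ 0 := by
    by_contra hcon
    push Not at hcon
    have h0 : P₀ * ∏ j, Ps j = 0 := by
      refine MvPolynomial.funext_set
        (Fin.snoc (α := fun _ => Set ℂ) (fun i => Metric.ball (ξ i) ε) Set.univ) ?_ ?_
      · intro i
        refine Fin.lastCases ?_ (fun i => ?_) i
        · rw [Fin.snoc_last]; exact Set.infinite_univ
        · rw [Fin.snoc_castSucc]
          exact infinite_of_mem_nhds (ξ i) (Metric.ball_mem_nhds _ hε)
      · intro w hw
        rw [map_zero]
        apply hcon w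
        intro i
        have := hw i.castSucc (Set.mem_univ _)
        rwa [Fin.snoc_castSucc] at this
    exact mul_ne_zero hP₀ (Finset.prod_ne_zero_iff.2 fun j _ => hPs j) h0
  obtain ⟨w, hwb, hw⟩ := hgood
  rw [map_mul, map_prod] at hw
  have hw0 := left_ne_zero_of_mul hw
  have hwj := fun j => Finset.prod_ne_zero_iff.1 (right_ne_zero_of_mul hw) j (Finset.mem_univ j)
  set p : Fin κ → ℂ := Fin.init w with hp
  have hwp : w = Fin.snoc p (w (Fin.last κ)) := (Fin.snoc_init_self w).symm
  have hpb : p ∈ Metric.ball ξ ε := by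
    rw [Metric.mem_ball, dist_pi_lt_iff hε]
    intro i
    exact hwb i
  have main : ∀ q ∈ Metric.ball ξ ε, H q = H p := by
    intro q hq
    let v := q - p
    let γ : ℂ → (Fin κ → ℂ) := fun z => p + z • v
    have hγ : Differentiable ℂ γ := by
      have : Differentiable ℂ fun z : ℂ => z • v := differentiable_id.smul_const v
      exact this.const_add p
    let D : Set ℂ := γ ⁻¹' Metric.ball ξ ε
    have hDo : IsOpen D := Metric.isOpen_ball.preimage hγ.continuous
    have hDc : Convex ℝ D := by
      intro a ha b hb s t hs ht hst
      have h1 := convex_ball ξ ε ha hb hs ht hst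
      have h2 : γ (s • a + t • b) = s • γ a + t • γ b := by
        ext i
        simp only [γ, Pi.add_apply, Pi.smul_apply, Complex.real_smul, smul_eq_mul]
        have : (s : ℂ) + t = 1 := by exact_mod_cast hst
        linear_combination (-p i) * this
      change γ _ ∈ Metric.ball ξ ε
      rw [h2]; exact h1
    have hD0 : (0 : ℂ) ∈ D := by
      change γ 0 ∈ Metric.ball ξ ε
      simpa [γ] using hpb
    have hD1 : (1 : ℂ) ∈ D := by
      change γ 1 ∈ Metric.ball ξ ε
      simpa [γ, v] using hq
    have hne : ∀ R : MvPolynomial (Fin (κ + 1)) ℂ, MvPolynomial.eval w R ≠ 0 →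
        lineRes p v R ≠ 0 := by
      intro R hR h0
      apply hR
      have := evalEval_lineRes p v R 0 (w (Fin.last κ))
      rw [h0, zero_smul, add_zero, ← hwp, evalEval_zero] at this
      exact this.symm
    have key := one_var hDo hDc.isPreconnected (fun z => H (γ z)) (fun j z => Hs j (γ z))
      (hH.1.comp hγ.differentiableOn fun z hz => hbV _ hz)
      (fun j => (hHs j).1.comp hγ.differentiableOn fun z hz => hbV _ hz)
      (fun j z hz => hHsne j _ (hbV _ hz)) μ hμ μs
      (lineRes p v P₀) (hne _ hw0)
      (fun z hz => by rw [evalEval_lineRes]; exact hPU _ (hbU _ hz))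
      (fun j => lineRes p v (Ps j)) (fun j => hne _ (hwj j))
      (fun j z hz => by rw [evalEval_lineRes]; exact hPsU j _ (hbUs j _ hz))
      (MvPolynomial.rename (Fin.castAdd κ₂) P * ∏ j : Fin κ₂, MvPolynomial.X (Fin.natAdd κ₁ j))
      (MvPolynomial.rename (Fin.castAdd κ₂) Q)
      (fun z hz => by
        rw [MvPolynomial.eval_rename]
        exact hQne _ (hbV _ hz))
      (fun z hz => by
        have h1 := hQne _ (hbV _ hz)
        rw [heq _ (hbV _ hz)]
        simp only [map_mul, map_prod, MvPolynomial.eval_rename, MvPolynomial.eval_X]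
        simp only [Function.comp_def]
        field_simp)
    have := key 1 hD1 0 hD0
    simpa [γ, v] using this
  filter_upwards [Metric.ball_mem_nhds ξ hε] with η hη
  rw [main η hη, main ξ (Metric.mem_ball_self hε)]

end NashAux

/-- Lemma 2.2 of the paper: if `exp(H^μ)` equals a rational expression
`(P/Q)(H₁^{μ₁}, …, H_{κ₁}^{μ_{κ₁}}) ⬝ ∏_{j=κ₁+1}^{κ₁+κ₂} H_j^{μ_j}` of Nash
power functions on a connected open set, then `H` is constant.  Complex powers
with real exponents are principal-branch powers (`Complex.cpow`). -/
theorem const_of_exp_pow_eq_rational (κ κ₁ κ₂ : ℕ) (hκ : 0 < κ) (hκ₁ : 0 < κ₁)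
    (V : Set (Fin κ → ℂ)) (hVo : IsOpen V) (hVc : IsConnected V)
    (H : (Fin κ → ℂ) → ℂ) (Hs : Fin (κ₁ + κ₂) → (Fin κ → ℂ) → ℂ)
    (hH : IsNashOn κ V H) (hHs : ∀ j, IsNashOn κ V (Hs j))
    (hHne : ∀ ξ ∈ V, H ξ ≠ 0) (hHsne : ∀ j, ∀ ξ ∈ V, Hs j ξ ≠ 0)
    (μ : ℝ) (hμ : μ ≠ 0) (μs : Fin (κ₁ + κ₂) → ℝ) (hμs : ∀ j, μs j ≠ 0)
    (P Q : MvPolynomial (Fin κ₁) ℂ) (hQ : Q ≠ 0)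
    (hQne : ∀ ξ ∈ V,
      MvPolynomial.eval
        (fun i => Hs (Fin.castAdd κ₂ i) ξ ^ ((μs (Fin.castAdd κ₂ i) : ℂ))) Q ≠ 0)
    (heq : ∀ ξ ∈ V,
      Complex.exp (H ξ ^ ((μ : ℂ))) =
        (MvPolynomial.eval
            (fun i => Hs (Fin.castAdd κ₂ i) ξ ^ ((μs (Fin.castAdd κ₂ i) : ℂ))) P /
          MvPolynomial.eval
            (fun i => Hs (Fin.castAdd κ₂ i) ξ ^ ((μs (Fin.castAdd κ₂ i) : ℂ))) Q) *
        ∏ j : Fin κ₂, Hs (Fin.natAdd κ₁ j) ξ ^ ((μs (Fin.natAdd κ₁ j) : ℂ))) :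
    ∀ ξ ∈ V, ∀ ξ' ∈ V, H ξ = H ξ' := by
  have : PreconnectedSpace V := Subtype.preconnectedSpace hVc.isPreconnected
  have hloc : IsLocallyConstant (fun ξ : V => H ξ) := by
    rw [IsLocallyConstant.iff_eventually_eq]
    intro ξ
    exact continuous_subtype_val.continuousAt.eventually
      (NashAux.local_const κ κ₁ κ₂ V hVo H Hs hH hHs hHsne μ hμ μs P Q hQne heq ξ.1 ξ.2)
  intro ξ hξ ξ' hξ'
  exact hloc.apply_eq_of_preconnectedSpace ⟨ξ, hξ⟩ ⟨ξ', hξ'⟩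
end

section
/- Let κ, κ₁ be positive integers and κ₂ a nonnegative integer. Let V ⊆ ℂ^κ be a connected open set, let H, H₁, …, H_{κ₁+κ₂} be Nash functions on V that are nowhere zero on V, let μ ∈ ℝ \ {0}, and let μ₁, …, μ_{κ₁+κ₂} ∈ ℝ with at least one μ_j nonzero. Let P and Q be polynomials in κ₁ complex variables with Q not identically zero, and suppose Q(H₁(ξ)^{μ₁}, …, H_{κ₁}(ξ)^{μ_{κ₁}}) ≠ 0 for all ξ ∈ V. If exp(H(ξ)^μ) = (P/Q)(H₁(ξ)^{μ₁}, …, H_{κ₁}(ξ)^{μ_{κ₁}}) · ∏_{j=κ₁+1}^{κ₁+κ₂} H_j(ξ)^{μ_j} for all ξ ∈ V, then H is constant on V. -/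
open Differential in
/-- norm-trace descent property for log-derivative sums -/
def LvProp (F K : Type*) [Field F] [Field K] [Differential F] [Differential K] [Algebra F K] : Prop :=
  ∀ (a : F) (ι : Type) [Fintype ι] (c : ι → F) (u : ι → K),
    algebraMap F K a = ∑ x, algebraMap F K (c x) * Differential.logDeriv (u x) →
    ∃ (N : ℕ) (u₀ : ι → F), N ≠ 0 ∧ N * a = ∑ x, c x * Differential.logDeriv (u₀ x)

open Differential IntermediateField Finset in
lemma LvProp.galois (F K : Type*) [Field F] [Field K] [Differential F] [Differential K]
    [Algebra F K] [DifferentialAlgebra F K] [CharZero F] [FiniteDimensional F K] [IsGalois F K] :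
    LvProp F K := by
  intro a ι _ c u h
  let u₁ (i : ι) := ∏ x : (K ≃ₐ[F] K), x (u i)
  have : ∀ i, u₁ i ∈ fixedField (⊤ : Subgroup (K ≃ₐ[F] K)) := by
    rintro i ⟨e, _⟩
    change e (u₁ i) = u₁ i
    simp only [u₁, map_prod]
    apply Fintype.prod_equiv (Equiv.mulLeft e)
    simp
  have ffb : fixedField ⊤ = ⊥ := (IsGalois.tfae.out 0 1).mp (inferInstance : IsGalois F K)
  simp_rw [ffb, IntermediateField.mem_bot, Set.mem_range] at this
  choose u₀ hu₀ using this
  refine ⟨Fintype.card (K ≃ₐ[F] K), u₀, Fintype.card_ne_zero, ?_⟩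
  apply FaithfulSMul.algebraMap_injective F K
  simp only [map_sum, map_mul, ← Differential.logDeriv_algebraMap, hu₀, map_natCast]
  have h1 : ∀ i, Differential.logDeriv (u₁ i) = ∑ x : K ≃ₐ[F] K, Differential.logDeriv (x (u i)) := by
    intro i
    by_cases h : u i = 0 <;> simp [u₁, Differential.logDeriv_prod, h]
  simp_rw [h1, mul_sum]
  rw [sum_comm]
  trans ∑ _ : (K ≃ₐ[F] K), algebraMap F K a
  · simp
  · refine Finset.sum_congr rfl fun e _ => ?_
    apply_fun e at h
    simp only [AlgEquiv.commutes, map_sum, map_mul] at h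
    rw [h]
    refine Finset.sum_congr rfl fun i _ => ?_
    simp [Differential.logDeriv, algEquiv_deriv']

open Differential IntermediateField Finset in
lemma LvProp.of_algHom {F K K' : Type*} [Field F] [Field K] [Field K'] [Differential F]
    [Differential K] [Differential K'] [Algebra F K] [Algebra F K']
    [DifferentialAlgebra F K] [DifferentialAlgebra F K'] [CharZero F] [Algebra.IsAlgebraic F K]
    (e : K →ₐ[F] K') (h : LvProp F K') : LvProp F K := by
  intro a ι _ c u hu
  refine h a ι c (e ∘ u) ?_
  apply_fun e at hu
  simp only [AlgHom.commutes, map_sum, map_mul] at hu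
  rw [hu]
  refine Finset.sum_congr rfl fun i _ => ?_
  simp [Differential.logDeriv, algHom_deriv' e e.injective]

open Differential IntermediateField Finset in
lemma LvProp.finite (F K : Type*) [Field F] [Field K] [Differential F] [Differential K]
    [Algebra F K] [DifferentialAlgebra F K] [CharZero F] [FiniteDimensional F K] :
    LvProp F K := by
  let map := IsAlgClosed.lift (M := AlgebraicClosure F) (R := F) (S := K)
  let K' := map.fieldRange
  have : FiniteDimensional F K' :=
    LinearMap.finiteDimensional_range map.toLinearMap
  let K'' := normalClosure F K' (AlgebraicClosure F)
  have hle : K' ≤ K'' := IntermediateField.le_normalClosure ..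
  have : IsGalois F K'' := {}
  exact LvProp.of_algHom ((IntermediateField.inclusion hle).comp map.rangeRestrict)
    (LvProp.galois F K'')

/-- `x` is `p(u)/q(u)` with `deg p < deg q` -/
def SmallAt {E : Type*} [Field E] [Algebra ℂ E] (u x : E) : Prop :=
  ∃ p q : Polynomial ℂ, q ≠ 0 ∧ p.degree < q.degree ∧ x * Polynomial.aeval u q = Polynomial.aeval u p

lemma SmallAt.zero {E : Type*} [Field E] [Algebra ℂ E] (u : E) : SmallAt u 0 :=
  ⟨0, 1, one_ne_zero, by simp, by simp⟩

lemma SmallAt.add {E : Type*} [Field E] [Algebra ℂ E] {u x y : E} (hx : SmallAt u x)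
    (hy : SmallAt u y) : SmallAt u (x + y) := by
  obtain ⟨p, q, hq, hd, h⟩ := hx
  obtain ⟨p', q', hq', hd', h'⟩ := hy
  refine ⟨p * q' + p' * q, q * q', mul_ne_zero hq hq', ?_, ?_⟩
  · refine lt_of_le_of_lt (Polynomial.degree_add_le _ _) (max_lt ?_ ?_)
    · rw [Polynomial.degree_mul, Polynomial.degree_mul]
      exact WithBot.add_lt_add_right (by simpa using hq') hd
    · rw [Polynomial.degree_mul, Polynomial.degree_mul, add_comm q.degree]
      exact WithBot.add_lt_add_right (by simpa using hq) hd'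
  · simp only [map_add, map_mul]
    linear_combination (Polynomial.aeval u q') * h + (Polynomial.aeval u q) * h'

lemma SmallAt.smul {E : Type*} [Field E] [Algebra ℂ E] {u x : E} (c : ℂ) (hx : SmallAt u x) :
    SmallAt u (algebraMap ℂ E c * x) := by
  obtain ⟨p, q, hq, hd, h⟩ := hx
  refine ⟨Polynomial.C c * p, q, hq, ?_, ?_⟩
  · refine lt_of_le_of_lt ?_ hd
    rw [← Polynomial.smul_eq_C_mul]
    exact Polynomial.degree_smul_le _ _
  · simp only [map_mul, Polynomial.aeval_C]
    linear_combination (algebraMap ℂ E c) * h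

lemma SmallAt.sum {E : Type*} [Field E] [Algebra ℂ E] {u : E} {ι : Type*} (s : Finset ι)
    (x : ι → E) (hx : ∀ i ∈ s, SmallAt u (x i)) : SmallAt u (∑ i ∈ s, x i) := by
  classical
  induction s using Finset.induction_on with
  | empty => simpa using SmallAt.zero u
  | insert a s ha ih =>
    rw [Finset.sum_insert ha]
    exact (hx a (by simp)).add (ih fun i hi => hx i (by simp [hi]))

open scoped Differential in
lemma deriv_aeval_const {E : Type*} [Field E] [Algebra ℂ E] [Differential E]
    (hC : ∀ c : ℂ, (algebraMap ℂ E c)′ = 0) (u : E) (p : Polynomial ℂ) :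
    (Polynomial.aeval u p)′ = Polynomial.aeval u (Polynomial.derivative p) * u′ := by
  induction p using Polynomial.induction_on' with
  | add p q hp hq => simp [hp, hq, add_mul]
  | monomial n a =>
    simp [Polynomial.aeval_monomial, Derivation.leibniz, Derivation.leibniz_pow, hC,
      Polynomial.derivative_monomial]
    ring

open scoped Differential in
lemma SmallAt.logDeriv_poly {E : Type*} [Field E] [Algebra ℂ E] [Differential E]
    (hC : ∀ c : ℂ, (algebraMap ℂ E c)′ = 0) {u : E} (hu : u′ = 1)
    (p : Polynomial ℂ) : SmallAt u (Differential.logDeriv (Polynomial.aeval u p)) := by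
  by_cases h : Polynomial.aeval u p = 0
  · simpa [h] using SmallAt.zero u
  · have hp : p ≠ 0 := by rintro rfl; simp at h
    refine ⟨Polynomial.derivative p, p, hp, Polynomial.degree_derivative_lt hp, ?_⟩
    rw [Differential.logDeriv, deriv_aeval_const hC, hu]
    field_simp

open scoped Differential in
lemma transcendental_of_deriv {E : Type*} [Field E] [Algebra ℂ E] [Differential E]
    (hC : ∀ c : ℂ, (algebraMap ℂ E c)′ = 0) {u : E} (hu : u′ ≠ 0) : Transcendental ℂ u := by
  intro h
  have hs : (minpoly ℂ u).Separable := (minpoly.irreducible h.isIntegral).separable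
  have h1 := hs.aeval_derivative_ne_zero (minpoly.aeval ℂ u)
  have h2 := deriv_aeval_const hC u (minpoly ℂ u)
  rw [minpoly.aeval, map_zero] at h2
  exact mul_ne_zero h1 hu h2.symm

open scoped Differential in
lemma deriv_mem_adjoin {E : Type*} [Field E] [Algebra ℂ E] [Differential E]
    (hC : ∀ c : ℂ, (algebraMap ℂ E c)′ = 0) {u : E} (hu : u′ = 1) (x : E)
    (hx : x ∈ IntermediateField.adjoin ℂ {u}) : x′ ∈ IntermediateField.adjoin ℂ {u} := by
  induction hx using IntermediateField.adjoin_induction with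
  | mem x hx => rw [Set.mem_singleton_iff.1 hx, hu]; exact one_mem _
  | algebraMap c => rw [hC]; exact zero_mem _
  | add x y _ _ h1 h2 => rw [map_add]; exact add_mem h1 h2
  | inv x hx h => 
    rw [Derivation.leibniz_inv]
    exact mul_mem (neg_mem (pow_mem (inv_mem hx) 2)) h
  | mul x y h1 h2 h3 h4 =>
    rw [Derivation.leibniz]
    exact add_mem (mul_mem h1 h4) (mul_mem h2 h3)

/-- restrict a differential structure to a closed intermediate field -/
@[reducible] noncomputable def restrictDiff {E : Type*} [Field E] [Algebra ℂ E] [Differential E]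
    (M : IntermediateField ℂ E) (hM : ∀ x ∈ M, Differential.deriv x ∈ M) : Differential M :=
  ⟨Derivation.mk' (AddMonoidHom.toIntLinearMap
    { toFun := fun x => ⟨Differential.deriv (x : E), hM x x.2⟩
      map_zero' := by ext; simp
      map_add' := fun x y => by ext; simp }) (fun a b => by
        ext; simp [Derivation.leibniz])⟩

lemma restrictDiff_alg {E : Type*} [Field E] [Algebra ℂ E] [Differential E]
    (M : IntermediateField ℂ E) (hM : ∀ x ∈ M, Differential.deriv x ∈ M) :
    let _ := restrictDiff M hM
    DifferentialAlgebra M E := by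
  let _ := restrictDiff M hM
  exact ⟨fun a => rfl⟩

open scoped Differential in
lemma no_log_relation {E : Type*} [Field E] [Algebra ℂ E] [Differential E]
    (hC : ∀ c : ℂ, (algebraMap ℂ E c)′ = 0) {u : E} (hu : u′ = 1)
    {ι : Type} [Fintype ι] (g : ι → E) (hg : ∀ i, IsAlgebraic (IntermediateField.adjoin ℂ {u}) (g i))
    (c : ι → ℂ) (h : 1 = ∑ i, algebraMap ℂ E (c i) * Differential.logDeriv (g i)) : False := by
  have htr : Transcendental ℂ u := transcendental_of_deriv hC (by simp [hu])
  let F := IntermediateField.adjoin ℂ {u}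
  let _ : Differential F := restrictDiff F (deriv_mem_adjoin hC hu)
  have _ : DifferentialAlgebra F E := restrictDiff_alg F (deriv_mem_adjoin hC hu)
  let K := IntermediateField.adjoin F (Set.range g)
  have _ : FiniteDimensional F K := IntermediateField.finiteDimensional_adjoin (by
    rintro _ ⟨i, rfl⟩
    exact (hg i).isIntegral)
  have _ : CharZero F := charZero_of_injective_algebraMap (algebraMap ℂ F).injective
  have hgK : ∀ i, g i ∈ K := fun i => IntermediateField.subset_adjoin _ _ ⟨i, rfl⟩
  obtain ⟨N, u₀, hN, h0⟩ := LvProp.finite F K 1 ι (fun i => algebraMap ℂ F (c i)) 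
    (fun i => ⟨g i, hgK i⟩) (by
      apply (algebraMap K E).injective
      simp only [map_one, map_sum, map_mul, ← Differential.logDeriv_algebraMap]
      exact h)
  have h1 := congrArg (algebraMap F E) h0
  simp only [map_sum, map_mul, ← Differential.logDeriv_algebraMap, map_natCast, mul_one,
    ← IsScalarTower.algebraMap_apply] at h1
  have h2 : SmallAt u (N : E) := by
    rw [h1]
    refine SmallAt.sum _ _ fun i _ => SmallAt.smul _ ?_
    obtain ⟨r, s, hrs⟩ := (IntermediateField.mem_adjoin_simple_iff ℂ _).1 (u₀ i).2
    have e : algebraMap F E (u₀ i) = Polynomial.aeval u r / Polynomial.aeval u s := hrs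
    rw [e]
    by_cases hr : Polynomial.aeval u r = 0
    · simpa [hr] using SmallAt.zero u
    by_cases hs : Polynomial.aeval u s = 0
    · simpa [hs] using SmallAt.zero u
    rw [Differential.logDeriv_div _ _ hr hs]
    have := (SmallAt.logDeriv_poly hC hu r).add ((SmallAt.logDeriv_poly hC hu s).smul (-1))
    simpa [sub_eq_add_neg] using this
  obtain ⟨p, q, hq, hd, h3⟩ := h2
  have h4 : (N : Polynomial ℂ) * q = p := by
    apply transcendental_iff_injective.1 htr
    simpa using h3
  rw [← h4, ← Polynomial.C_eq_natCast, Polynomial.degree_C_mul (by exact_mod_cast hN)] at hd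
  exact lt_irrefl _ hd

open scoped Differential

/-- hyperexponential elements over `M` -/
def Hyp {E : Type*} [Field E] [Algebra ℂ E] [Differential E] (M : IntermediateField ℂ E) (T : E) :
    Prop := ∃ a ∈ M, T′ = a * T

section
variable {E : Type*} [Field E] [Algebra ℂ E] [Differential E] {M : IntermediateField ℂ E}

lemma Hyp.mul {S T : E} (hS : Hyp M S) (hT : Hyp M T) : Hyp M (S * T) := by
  obtain ⟨a, ha, h⟩ := hS
  obtain ⟨b, hb, h'⟩ := hT
  refine ⟨a + b, add_mem ha hb, ?_⟩
  simp only [Derivation.leibniz, smul_eq_mul, h, h']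
  ring

lemma Hyp.inv {T : E} (hT : Hyp M T) : Hyp M T⁻¹ := by
  obtain ⟨b, hb, h'⟩ := hT
  refine ⟨-b, neg_mem hb, ?_⟩
  by_cases h0 : T = 0
  · simp [h0]
  rw [Derivation.leibniz_inv, h', smul_eq_mul]
  field_simp

lemma Hyp.div {S T : E} (hS : Hyp M S) (hT : Hyp M T) : Hyp M (S / T) := by
  rw [div_eq_mul_inv]; exact hS.mul hT.inv

lemma Hyp.of_mem (hM : ∀ x ∈ M, x′ ∈ M) {T : E} (hT : T ∈ M) : Hyp M T := by
  by_cases h0 : T = 0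
  · exact ⟨0, zero_mem _, by simp [h0]⟩
  · exact ⟨T′ / T, div_mem (hM T hT) hT, by field_simp⟩

lemma Hyp.pow (hM : ∀ x ∈ M, x′ ∈ M) {T : E} (hT : Hyp M T) (n : ℕ) : Hyp M (T ^ n) := by
  induction n with
  | zero => simpa using Hyp.of_mem hM (one_mem M)
  | succ n ih => rw [pow_succ]; exact ih.mul hT

lemma Hyp.prod (hM : ∀ x ∈ M, x′ ∈ M) {ι : Type*} (s : Finset ι) (T : ι → E)
    (hT : ∀ i ∈ s, Hyp M (T i)) : Hyp M (∏ i ∈ s, T i) := by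
  classical
  induction s using Finset.induction_on with
  | empty => simpa using Hyp.of_mem hM (one_mem M)
  | insert a s ha ih =>
    rw [Finset.prod_insert ha]
    exact (hT a (by simp)).mul (ih fun i hi => hT i (by simp [hi]))

lemma Hyp.deriv (hM : ∀ x ∈ M, x′ ∈ M) {T : E} (hT : Hyp M T) :
    Hyp M T′ := by
  obtain ⟨b, hb, h'⟩ := id hT
  rw [h']
  exact (Hyp.of_mem hM hb).mul hT

lemma Hyp.deriv_ne {E : Type*} [Field E] [Differential E] {T : E} (h : T′ ≠ 0) : T ≠ 0 := by
  rintro rfl; simp at h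

lemma Hyp.ratio {S T : E} (hS : Hyp M S) (hT : Hyp M T) (h1 : S′ ≠ 0) (h2 : T′ ≠ 0)
    (h : S′ / T′ ∈ M) : S / T ∈ M := by
  obtain ⟨a, ha, h3⟩ := hS
  obtain ⟨b, hb, h4⟩ := hT
  have ha0 : a ≠ 0 := by rintro rfl; simp [h3] at h1
  have hb0 : b ≠ 0 := by rintro rfl; simp [h4] at h2
  have hT0 : T ≠ 0 := Hyp.deriv_ne h2
  have : S / T = (S′ / T′) * (b / a) := by
    rw [h3, h4]; field_simp
  rw [this]
  exact mul_mem h (div_mem hb ha)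

lemma hyp_one (hM : ∀ x ∈ M, x′ ∈ M) (hc : ∀ x : E, x′ = 0 → x ∈ M)
    {κ : Type*} (t : Finset κ) : ∀ (T : E) (U : κ → E),
    Hyp M T → (∀ j ∈ t, Hyp M (U j)) → T = ∑ j ∈ t, U j → T ≠ 0 →
    ∃ j ∈ t, U j ≠ 0 ∧ T / U j ∈ M := by
  classical
  induction t using Finset.induction_on with
  | empty => intro T U _ _ h h0; simp at h; exact absurd h h0
  | insert j0 t hj ih =>
    intro T U hT hU h h0
    by_cases hz : U j0 = 0
    · rw [Finset.sum_insert hj, hz, zero_add] at h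
      obtain ⟨j, hj', h1⟩ := ih T U hT (fun j hj => hU j (by simp [hj])) h h0
      exact ⟨j, by simp [hj'], h1⟩
    by_cases hy : (T / U j0)′ = 0
    · exact ⟨j0, by simp, hz, hc _ hy⟩
    have hUj := hU j0 (by simp)
    have key : (T / U j0)′ = ∑ j ∈ t, (U j / U j0)′ := by
      rw [h, Finset.sum_div, Finset.sum_insert hj, div_self hz]
      simp
    obtain ⟨j, hj', h1, h2⟩ := ih (T / U j0)′ (fun j => (U j / U j0)′) ((hT.div hUj).deriv hM)
      (fun j hj => ((hU j (by simp [hj])).div hUj).deriv hM) key hy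
    have hne : U j ≠ 0 := by
      intro h3; simp [h3] at h1
    refine ⟨j, by simp [hj'], hne, ?_⟩
    have := Hyp.ratio (hT.div hUj) ((hU j (by simp [hj'])).div hUj) hy h1 h2
    rwa [div_div_div_cancel_right₀ hz] at this

lemma hyp_two (hM : ∀ x ∈ M, x′ ∈ M) (hc : ∀ x : E, x′ = 0 → x ∈ M)
    {ι κ : Type*} (s : Finset ι) (t : Finset κ) : ∀ (T : ι → E) (U : κ → E),
    (∀ i ∈ s, Hyp M (T i)) → (∀ j ∈ t, Hyp M (U j)) → ∑ i ∈ s, T i = ∑ j ∈ t, U j →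
    ∑ i ∈ s, T i ≠ 0 →
    ∃ i ∈ s, ∃ j ∈ t, T i ≠ 0 ∧ U j ≠ 0 ∧ T i / U j ∈ M := by
  classical
  induction s using Finset.induction_on with
  | empty => intro T U _ _ h h0; simp at h0
  | insert i0 s hi ih =>
    intro T U hT hU h h0
    by_cases hz : T i0 = 0
    · rw [Finset.sum_insert hi, hz, zero_add] at h h0
      obtain ⟨i, hi', h1⟩ := ih T U (fun j hj => hT j (by simp [hj])) hU h h0
      exact ⟨i, by simp [hi'], h1⟩
    have hTi := hT i0 (by simp)
    set x := ∑ i ∈ insert i0 s, T i with hx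
    by_cases hy : (x / T i0)′ = 0
    · have hm := hc _ hy
      have hxh : Hyp M x := by
        have : x = (x / T i0) * T i0 := by field_simp
        rw [this]; exact (Hyp.of_mem hM hm).mul hTi
      obtain ⟨j, hj, h1, h2⟩ := hyp_one hM hc t x U hxh hU h h0
      refine ⟨i0, by simp, j, hj, hz, h1, ?_⟩
      have : T i0 / U j = (x / U j) / (x / T i0) := by field_simp
      rw [this]
      exact div_mem h2 hm
    have key : (x / T i0)′ = ∑ j ∈ s, (T j / T i0)′ := by
      rw [hx, Finset.sum_div, Finset.sum_insert hi, div_self hz]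
      simp
    have key2 : (x / T i0)′ = ∑ j ∈ t, (U j / T i0)′ := by
      rw [h, Finset.sum_div]
      simp
    obtain ⟨i, hi', j, hj', h1, h2, h3⟩ := ih (fun j => (T j / T i0)′) (fun j => (U j / T i0)′)
      (fun j hj => ((hT j (by simp [hj])).div hTi).deriv hM) 
      (fun j hj => ((hU j hj).div hTi).deriv hM) (key ▸ key2) (key ▸ hy)
    refine ⟨i, by simp [hi'], j, hj', ?_, ?_, ?_⟩
    · intro h3; simp [h3] at h1
    · intro h3; simp [h3] at h2
    have := Hyp.ratio ((hT i (by simp [hi'])).div hTi) ((hU j hj').div hTi) h1 h2 h3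
    rwa [div_div_div_cancel_right₀ hz] at this

end

section
variable {E : Type*} [Field E] [Algebra ℂ E] [Differential E]

lemma isAlgebraic_deriv {M : IntermediateField ℂ E} (hM : ∀ x ∈ M, x′ ∈ M) {x : E}
    (hx : IsAlgebraic M x) : IsAlgebraic M x′ := by
  let _ : Differential M := restrictDiff M hM
  have _ : DifferentialAlgebra M E := restrictDiff_alg M hM
  have _ : CharZero M := charZero_of_injective_algebraMap (algebraMap ℂ M).injective
  let B := IntermediateField.adjoin M {x}
  have _ : FiniteDimensional M B := IntermediateField.adjoin.finiteDimensional hx.isIntegral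
  let y : B := ⟨x, IntermediateField.mem_adjoin_simple_self M x⟩
  have h : (algebraMap B E y)′ = algebraMap B E y′ := deriv_algebraMap y
  have h2 : IsAlgebraic M (y′) := Algebra.IsAlgebraic.isAlgebraic _
  have h3 : x′ = algebraMap B E y′ := h
  rw [h3]
  exact h2.algebraMap

lemma mem_algCl {E : Type*} [Field E] [Algebra ℂ E] {M : IntermediateField ℂ E} {x : E} :
    x ∈ (algebraicClosure M E).restrictScalars ℂ ↔ IsAlgebraic M x := by
  rw [IntermediateField.mem_restrictScalars, mem_algebraicClosure_iff]

lemma deriv_mem_algCl {M : IntermediateField ℂ E} (hM : ∀ x ∈ M, x′ ∈ M) :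
    ∀ x ∈ (algebraicClosure M E).restrictScalars ℂ,
      x′ ∈ (algebraicClosure M E).restrictScalars ℂ := by
  intro x hx
  rw [mem_algCl] at hx ⊢
  exact isAlgebraic_deriv hM hx

lemma isAlgebraic_exchange {E : Type*} [Field E] [Algebra ℂ E] {X u y : E} (hu : Transcendental ℂ u)
    (huX : IsAlgebraic (IntermediateField.adjoin ℂ {X}) u)
    (hy : IsAlgebraic (IntermediateField.adjoin ℂ {X}) y) :
    IsAlgebraic (IntermediateField.adjoin ℂ {u}) y := by
  have hXu : IsAlgebraic (IntermediateField.adjoin ℂ {u}) X := by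
    by_cases hX : Transcendental ℂ X
    · exact IntermediateField.isAlgebraic_adjoin_iff.mpr (.adjoin_singleton hX hu
        (IntermediateField.isAlgebraic_adjoin_iff.mp huX))
    · exact (not_not.1 hX).tower_top _
  let A := algebraicClosure (IntermediateField.adjoin ℂ {u}) E
  have hle : IntermediateField.adjoin ℂ {X} ≤ A.restrictScalars ℂ := by
    rw [IntermediateField.adjoin_le_iff, Set.singleton_subset_iff]
    exact mem_algCl.2 hXu
  have hyA : IsAlgebraic A y := by
    obtain ⟨p, hp, hpy⟩ := hy
    refine ⟨p.map (IntermediateField.inclusion hle).toRingHom,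
      (Polynomial.map_ne_zero_iff (IntermediateField.inclusion hle).injective).2 hp, ?_⟩
    exact (Polynomial.eval₂_map (p := p) (IntermediateField.inclusion hle).toRingHom
      (algebraMap (A.restrictScalars ℂ) E) y).trans hpy
  exact hyA.restrictScalars _

lemma no_log_relation' (hC : ∀ c : ℂ, (algebraMap ℂ E c)′ = 0) {X u : E} (hu : u′ ≠ 0)
    (huX : IsAlgebraic (IntermediateField.adjoin ℂ {X}) u)
    {ι : Type} [Fintype ι] (g : ι → E) (hg : ∀ i, IsAlgebraic (IntermediateField.adjoin ℂ {X}) (g i))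
    (c : ι → ℂ) (h : u′ = ∑ i, algebraMap ℂ E (c i) * Differential.logDeriv (g i)) : False := by
  have htr : Transcendental ℂ u := transcendental_of_deriv hC hu
  let D1 : Differential E := inferInstance
  obtain ⟨w, hw⟩ : ∃ w : E, w = u′ := ⟨_, rfl⟩
  rw [← hw] at hu h
  have key : ∀ D2 : Differential E, (∀ x : E, @Differential.deriv E _ D2 x = w⁻¹ * @Differential.deriv E _ D1 x) → False := by
    intro D2 hD2
    refine @no_log_relation E _ _ D2 (fun c => by rw [hD2, hC, mul_zero]) u
      (by rw [hD2, ← hw, inv_mul_cancel₀ hu]) ι _ g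
      (fun i => isAlgebraic_exchange htr huX (hg i)) c ?_
    have h2 : ∀ x : E, @Differential.logDeriv E _ D2 x = w⁻¹ * @Differential.logDeriv E _ D1 x := by
      intro x
      simp only [Differential.logDeriv, hD2]
      ring
    simp only [h2]
    rw [← inv_mul_cancel₀ hu]
    nth_rewrite 2 [h]
    rw [Finset.mul_sum]
    refine Finset.sum_congr rfl fun i _ => ?_
    ring
  exact key ⟨w⁻¹ • Differential.deriv⟩ (fun x => rfl)

lemma deriv_mem_adjoin' {L : IntermediateField ℂ E} (hL : ∀ x ∈ L, x′ ∈ L)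
    {u : E} (hu : u′ ∈ IntermediateField.adjoin L {u}) (x : E)
    (hx : x ∈ IntermediateField.adjoin L {u}) : x′ ∈ IntermediateField.adjoin L {u} := by
  induction hx using IntermediateField.adjoin_induction with
  | mem x hx => rw [Set.mem_singleton_iff.1 hx]; exact hu
  | algebraMap c =>
    exact (IntermediateField.adjoin L {u}).algebraMap_mem ⟨_, hL _ c.2⟩
  | add x y _ _ h1 h2 => rw [map_add]; exact add_mem h1 h2
  | inv x hx h => 
    rw [Derivation.leibniz_inv]
    exact mul_mem (neg_mem (pow_mem (inv_mem hx) 2)) h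
  | mul x y h1 h2 h3 h4 =>
    rw [Derivation.leibniz]
    exact add_mem (mul_mem h1 h4) (mul_mem h2 h3)

open Polynomial in
lemma transc_case {L : IntermediateField ℂ E} (hL : ∀ x ∈ L, x′ ∈ L)
    {u : E} (hu : Transcendental L u) (a b : L) (ha : a ≠ 0) (hua : u′ = a * u)
    (g : E) (hg : g ∈ IntermediateField.adjoin L {u}) (hg0 : g ≠ 0)
    (h : Differential.logDeriv g = u′ + b) : False := by
  let _ : Differential L := restrictDiff L hL
  have _ : DifferentialAlgebra L E := restrictDiff_alg L hL
  obtain ⟨r, s, hrs⟩ := (IntermediateField.mem_adjoin_simple_iff L _).1 hg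
  have hr : aeval u r ≠ 0 := by rintro h; simp [h] at hrs; exact hg0 hrs
  have hs : aeval u s ≠ 0 := by rintro h; simp [h] at hrs; exact hg0 hrs
  let d : L[X] → L[X] := fun p => Differential.implicitDeriv (C a * X) p
  have hd : ∀ p, (aeval u p)′ = aeval u (d p) := fun p =>
    Differential.deriv_aeval_eq_implicitDeriv u (C a * X) (by rw [hua]; simp) p
  have hdeg : ∀ p, (d p).degree ≤ p.degree := by
    intro p
    rw [Polynomial.degree_le_iff_coeff_zero]
    intro m hm
    have h0 : p.coeff m = 0 := Polynomial.coeff_eq_zero_of_degree_lt hm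
    simp only [d, Differential.implicitDeriv, Derivation.coe_add, Pi.add_apply, coeff_add,
      Differential.coeff_mapCoeffs, h0, map_zero, zero_add, Derivation.coe_smul, Pi.smul_apply,
      smul_eq_mul, Derivation.restrictScalars_apply, derivative'_apply, mul_assoc, coeff_C_mul]
    rcases m with _ | m
    · simp
    · simp [coeff_X_mul, coeff_derivative, h0]
  rw [hrs, Differential.logDeriv_div _ _ hr hs] at h
  simp only [Differential.logDeriv, hd, hua] at h
  have h2 : (C a * X + C b) * (r * s) = d r * s - r * d s := by
    apply transcendental_iff_injective.1 hu
    simp only [map_mul, map_add, map_sub, aeval_C, aeval_X]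
    field_simp at h
    have ea : algebraMap L E a = a := rfl
    have eb : algebraMap L E b = b := rfl
    rw [ea, eb]
    linear_combination (-1 : E) * h
  have hr0 : r ≠ 0 := by rintro rfl; simp at hr
  have hs0 : s ≠ 0 := by rintro rfl; simp at hs
  have h3 : (d r * s - r * d s).degree ≤ r.degree + s.degree := by
    refine (degree_sub_le _ _).trans (max_le ?_ ?_)
    · rw [degree_mul]; gcongr; exact hdeg r
    · rw [degree_mul]; gcongr; exact hdeg s
  rw [← h2, degree_mul, degree_linear ha, degree_mul, degree_eq_natDegree hr0,
    degree_eq_natDegree hs0] at h3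
  norm_cast at h3
  omega

end

section
variable {E : Type*} [Field E] [Algebra ℂ E] [Differential E]

lemma logDeriv_monomial (hC : ∀ c : ℂ, (algebraMap ℂ E c)′ = 0) {ι : Type} [Fintype ι]
    (hs : ι → E) (hs0 : ∀ i, hs i ≠ 0) (a : ℂ) (ha : a ≠ 0) (n : ι →₀ ℕ) :
    Differential.logDeriv (algebraMap ℂ E a * ∏ i, hs i ^ n i) =
      ∑ i, (n i : E) * Differential.logDeriv (hs i) := by
  have h1 : Differential.logDeriv (algebraMap ℂ E a) = 0 := by simp [Differential.logDeriv, hC]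
  rw [Differential.logDeriv_mul _ _ (by simpa using ha)
    (Finset.prod_ne_zero_iff.2 fun i _ => pow_ne_zero _ (hs0 i)), h1, zero_add,
    Differential.logDeriv_prod _ _ _ fun i _ => pow_ne_zero _ (hs0 i)]
  simp

lemma exists_relation (hC : ∀ c : ℂ, (algebraMap ℂ E c)′ = 0) 
    (hC' : ∀ x : E, x′ = 0 → ∃ c : ℂ, algebraMap ℂ E c = x)
    {ι : Type} [Fintype ι] (fs hs : ι → E) (hs0 : ∀ i, hs i ≠ 0) (c : ι → ℂ)
    (hhs : ∀ i, (hs i)′ = algebraMap ℂ E (c i) * Differential.logDeriv (fs i) * hs i)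
    (u e : E) (he0 : e ≠ 0) (he : e′ = u′ * e)
    (P Q : MvPolynomial ι ℂ) (hQ : MvPolynomial.aeval hs Q ≠ 0)
    (h : e * MvPolynomial.aeval hs Q = MvPolynomial.aeval hs P)
    (M : IntermediateField ℂ E) (hM : ∀ x ∈ M, x′ ∈ M) (huM : u′ ∈ M) (hfs : ∀ i, fs i ∈ M) :
    ∃ g ∈ M, g ≠ 0 ∧ ∃ n : ι → ℂ,
      Differential.logDeriv g = u′ + ∑ i, algebraMap ℂ E (n i) * Differential.logDeriv (fs i) := by
  have hcM : ∀ x : E, x′ = 0 → x ∈ M := by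
    intro x hx
    obtain ⟨c, rfl⟩ := hC' x hx
    exact M.algebraMap_mem c
  have hlM : ∀ i, Differential.logDeriv (fs i) ∈ M := fun i => div_mem (hM _ (hfs i)) (hfs i)
  have hhyp : ∀ i, Hyp M (hs i) := fun i =>
    ⟨_, mul_mem (M.algebraMap_mem (c i)) (hlM i), hhs i⟩
  have hehyp : Hyp M e := ⟨_, huM, he⟩
  have hmon : ∀ (a : ℂ) (n : ι →₀ ℕ), Hyp M (algebraMap ℂ E a * ∏ i, hs i ^ n i) := fun a n =>
    (Hyp.of_mem hM (M.algebraMap_mem a)).mul (Hyp.prod hM _ _ fun i _ => (hhyp i).pow hM _)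
  have hexp : ∀ R : MvPolynomial ι ℂ, MvPolynomial.aeval hs R =
      ∑ n ∈ R.support, algebraMap ℂ E (R.coeff n) * ∏ i, hs i ^ n i := fun R => by
    rw [MvPolynomial.aeval_def, MvPolynomial.eval₂_eq']
  have h0 := mul_ne_zero he0 hQ
  rw [hexp Q, Finset.mul_sum] at h h0
  rw [hexp P] at h
  obtain ⟨α, hα, β, hβ, h1, h2, h3⟩ := hyp_two hM hcM Q.support P.support _ _
    (fun n _ => hehyp.mul (hmon _ _)) (fun n _ => hmon _ _) h h0
  refine ⟨_, h3, div_ne_zero h1 h2, fun i => (α i - β i) * c i, ?_⟩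
  rw [Differential.logDeriv_div _ _ h1 h2, Differential.logDeriv_mul _ _ he0 (right_ne_zero_of_mul h1),
    logDeriv_monomial hC hs hs0 _ (MvPolynomial.mem_support_iff.1 hα),
    logDeriv_monomial hC hs hs0 _ (MvPolynomial.mem_support_iff.1 hβ), add_sub_assoc,
    ← Finset.sum_sub_distrib]
  congr 1
  · rw [Differential.logDeriv, he]; field_simp
  · refine Finset.sum_congr rfl fun i _ => ?_
    have : Differential.logDeriv (hs i) = algebraMap ℂ E (c i) * Differential.logDeriv (fs i) := by
      have := hs0 i
      rw [Differential.logDeriv, hhs]; field_simp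
    rw [this]
    simp only [map_mul, map_sub, map_natCast]
    ring

theorem alg_main (hC : ∀ c : ℂ, (algebraMap ℂ E c)′ = 0) 
    (hC' : ∀ x : E, x′ = 0 → ∃ c : ℂ, algebraMap ℂ E c = x)
    {X : E} (hX : X′ = 1)
    {ι : Type} [Fintype ι] (fs hs : ι → E) (hs0 : ∀ i, hs i ≠ 0) (c : ι → ℂ)
    (hfs : ∀ i, IsAlgebraic (IntermediateField.adjoin ℂ {X}) (fs i))
    (hhs : ∀ i, (hs i)′ = algebraMap ℂ E (c i) * Differential.logDeriv (fs i) * hs i)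
    (f u e : E) (hf : IsAlgebraic (IntermediateField.adjoin ℂ {X}) f) (μ : ℂ) (hμ : μ ≠ 0)
    (hu0 : u ≠ 0) (hu : u′ = algebraMap ℂ E μ * Differential.logDeriv f * u)
    (he0 : e ≠ 0) (he : e′ = u′ * e)
    (P Q : MvPolynomial ι ℂ) (hQ : MvPolynomial.aeval hs Q ≠ 0)
    (h : e * MvPolynomial.aeval hs Q = MvPolynomial.aeval hs P) : f′ = 0 := by
  by_contra hf'
  have hf0 : f ≠ 0 := Hyp.deriv_ne hf'
  have hl : Differential.logDeriv f ≠ 0 := by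
    rw [Ne, Differential.logDeriv_eq_zero]; exact hf'
  have hμE : algebraMap ℂ E μ ≠ 0 := by simpa using hμ
  let L := (algebraicClosure (IntermediateField.adjoin ℂ {X}) E).restrictScalars ℂ
  have hL : ∀ x ∈ L, x′ ∈ L := deriv_mem_algCl (deriv_mem_adjoin hC hX)
  have hfsL : ∀ i, fs i ∈ L := fun i => mem_algCl.2 (hfs i)
  have hfL : f ∈ L := mem_algCl.2 hf
  have hlogL : ∀ x ∈ L, Differential.logDeriv x ∈ L := fun x hx => div_mem (hL x hx) hx
  by_cases huL : u ∈ L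
  · obtain ⟨g, hg, hg0, n, hn⟩ := exists_relation hC hC' fs hs hs0 c hhs u e he0 he P Q hQ h L hL
      (hL _ huL) hfsL
    refine no_log_relation' hC (X := X) (u := u) (by rw [hu]; positivity) (mem_algCl.1 huL)
      (ι := Option ι) (fun o => o.elim g fs) ?_ (fun o => o.elim 1 (fun i => - n i)) ?_
    · rintro (_ | i)
      · exact mem_algCl.1 hg
      · exact hfs i
    · rw [Fintype.sum_option]
      simp [hn]
  · let M := (IntermediateField.adjoin L {u}).restrictScalars ℂ
    have huM : u ∈ M := IntermediateField.mem_adjoin_simple_self L u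
    have hLM : ∀ x ∈ L, x ∈ M := fun x hx =>
      (IntermediateField.adjoin L {u}).algebraMap_mem ⟨x, hx⟩
    have haL : algebraMap ℂ E μ * Differential.logDeriv f ∈ L :=
      mul_mem (L.algebraMap_mem μ) (hlogL f hfL)
    have hu'M : u′ ∈ M := by
      rw [hu]
      exact mul_mem (hLM _ haL) huM
    have hM : ∀ x ∈ M, x′ ∈ M := deriv_mem_adjoin' hL hu'M
    obtain ⟨g, hg, hg0, n, hn⟩ := exists_relation hC hC' fs hs hs0 c hhs u e he0 he P Q hQ h M hM
      hu'M (fun i => hLM _ (hfsL i))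
    have htr : Transcendental L u := by
      intro hal
      apply huL
      refine mem_algCl.2 ?_
      have : IsAlgebraic (algebraicClosure (IntermediateField.adjoin ℂ {X}) E) u := hal
      exact this.restrictScalars _
    exact transc_case hL htr ⟨_, haL⟩ ⟨_, sum_mem fun i (_ : i ∈ Finset.univ) => 
      mul_mem (L.algebraMap_mem (n i)) (hlogL _ (hfsL i))⟩
      (fun h => mul_ne_zero hμE hl (congrArg Subtype.val h)) hu g hg hg0 hn
end

section FracDeriv
open PowerSeries

variable (EF : Type) [Field EF] [Algebra (PowerSeries ℂ) EF] [IsFractionRing (PowerSeries ℂ) EF]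

noncomputable def dualHom : PowerSeries ℂ →+* TrivSqZeroExt EF EF where
  toFun a := TrivSqZeroExt.inl (algebraMap _ EF a) +
    TrivSqZeroExt.inr (algebraMap _ EF (PowerSeries.derivative ℂ a))
  map_one' := by
    ext <;> simp
  map_zero' := by
    ext <;> simp
  map_add' a b := by
    ext <;> simp [Algebra.smul_def]
  map_mul' a b := by
    ext
    · simp
    · simp [mul_comm, Algebra.smul_def]
      rfl

noncomputable def dualLift : EF →+* TrivSqZeroExt EF EF :=
  IsLocalization.lift (M := nonZeroDivisors (PowerSeries ℂ)) (g := dualHom EF) (by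
    intro y
    rw [TrivSqZeroExt.isUnit_iff_isUnit_fst]
    simp [dualHom])

lemma dualLift_alg (a : PowerSeries ℂ) : dualLift EF (algebraMap _ EF a) = dualHom EF a :=
  IsLocalization.lift_eq _ a

lemma dualLift_fst (x : EF) : (dualLift EF x).fst = x := by
  have : ((TrivSqZeroExt.fstHom EF EF EF).toRingHom.comp (dualLift EF)) = RingHom.id EF := by
    apply IsLocalization.ringHom_ext (nonZeroDivisors (PowerSeries ℂ))
    ext a
    simp [dualLift_alg, dualHom]
  exact congrArg (fun f : EF →+* EF => f x) this

@[reducible]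
noncomputable def instDiffEF : Differential EF where
  deriv := Derivation.mk' 
    { toFun := fun x => (dualLift EF x).snd
      map_add' := by intro x y; simp
      map_smul' := by intro n x; simp } (by
      intro a b
      simp [dualLift_fst, mul_comm])

attribute [local instance] instDiffEF

lemma EF_deriv_def (x : EF) : x′ = (dualLift EF x).snd := rfl

lemma EF_deriv_alg (a : PowerSeries ℂ) :
    (algebraMap _ EF a)′ = algebraMap _ EF (PowerSeries.derivative ℂ a) := by
  rw [EF_deriv_def, dualLift_alg]
  simp [dualHom, Algebra.smul_def]
  rfl

variable [Algebra ℂ EF] [IsScalarTower ℂ (PowerSeries ℂ) EF]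

lemma EF_algC (c : ℂ) : algebraMap ℂ EF c = algebraMap (PowerSeries ℂ) EF (C c) := by
  rw [IsScalarTower.algebraMap_apply ℂ (PowerSeries ℂ) EF]
  rfl

lemma EF_hC (c : ℂ) : (algebraMap ℂ EF c)′ = 0 := by
  rw [EF_algC, EF_deriv_alg]; simp

lemma EF_hC' (x : EF) (hx : x′ = 0) : ∃ c : ℂ, algebraMap ℂ EF c = x := by
  obtain ⟨p, q, hq, rfl⟩ := IsFractionRing.div_surjective (A := PowerSeries ℂ) x
  have hq0 : q ≠ 0 := nonZeroDivisors.ne_zero hq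
  have hinj : Function.Injective (algebraMap (PowerSeries ℂ) EF) := IsFractionRing.injective _ _
  obtain ⟨n, w, hw⟩ : ∃ (n : ℕ) (w : PowerSeries ℂ), q * w = X ^ n := by
    refine ⟨q.order.toNat, Inv_divided_by_X_pow_order hq0, ?_⟩
    have h1 := X_pow_order_mul_divXPowOrder (f := q)
    have h2 := Inv_divided_by_X_pow_order_rightInv hq0
    generalize Inv_divided_by_X_pow_order hq0 = w at *
    rw [← mul_one (X ^ _), ← h2, ← mul_assoc, h1]
  set x := algebraMap (PowerSeries ℂ) EF p / algebraMap _ EF q with hxd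
  have hqE : algebraMap (PowerSeries ℂ) EF q ≠ 0 := by simpa using hq0
  have h1 : x * algebraMap (PowerSeries ℂ) EF (X ^ n) = algebraMap _ EF (p * w) := by
    rw [hxd, ← hw, map_mul, map_mul]; field_simp
  have h2 : x * algebraMap (PowerSeries ℂ) EF (PowerSeries.derivative ℂ (X^n)) =
      algebraMap (PowerSeries ℂ) EF (PowerSeries.derivative ℂ (p * w)) := by
    rw [← EF_deriv_alg, ← EF_deriv_alg, ← h1]
    rw [Derivation.leibniz, hx]; simp
  generalize p * w = r at h1 h2
  have h3 : X * PowerSeries.derivative ℂ r = (n : PowerSeries ℂ) * r := by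
    apply hinj
    rw [map_mul, map_mul, ← h2, ← h1]
    have : X * PowerSeries.derivative ℂ (X^n : PowerSeries ℂ) = (n : PowerSeries ℂ) * X ^ n := by
      cases n with
      | zero => simp
      | succ m => rw [derivative_pow]; simp; ring
    have := congrArg (algebraMap (PowerSeries ℂ) EF) this
    rw [map_mul, map_mul] at this
    linear_combination x * this
  have h4 : r = C (coeff n r) * X ^ n := by
    ext k
    have h5 := congrArg (coeff k) h3
    have h6 : coeff k (X * PowerSeries.derivative ℂ r) = k * coeff k r := by
      cases k with
      | zero => simp
      | succ k => rw [coeff_succ_X_mul, coeff_derivative]; push_cast; ring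
    have h7 : coeff k ((n : PowerSeries ℂ) * r) = n * coeff k r := by
      rw [show (n : PowerSeries ℂ) = C (n : ℂ) by simp, coeff_C_mul]
    rw [h6, h7] at h5
    rw [coeff_C_mul, coeff_X_pow]
    split_ifs with hk
    · rw [hk]; simp
    · have : (k : ℂ) - n ≠ 0 := sub_ne_zero.2 (by exact_mod_cast hk)
      have h8 : ((k : ℂ) - n) * coeff k r = 0 := by linear_combination h5
      simpa [this] using h8
  refine ⟨coeff n r, ?_⟩
  rw [h4, map_mul] at h1
  rw [EF_algC]
  have : algebraMap (PowerSeries ℂ) EF (X ^ n) ≠ 0 := by simp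
  exact (mul_right_cancel₀ this h1).symm

end FracDeriv

lemma exists_EF : ∃ (E : Type) (_ : Field E) (_ : Algebra ℂ E) (_ : Differential E)
    (φ : PowerSeries ℂ →ₐ[ℂ] E), Function.Injective φ ∧
    (∀ p, (φ p)′ = φ (PowerSeries.derivative ℂ p)) ∧
    (∀ c : ℂ, (algebraMap ℂ E c)′ = 0) ∧
    (∀ x : E, x′ = 0 → ∃ c : ℂ, algebraMap ℂ E c = x) := by
  refine ⟨FractionRing (PowerSeries ℂ), inferInstance, inferInstance, instDiffEF _,
    IsScalarTower.toAlgHom ℂ (PowerSeries ℂ) (FractionRing (PowerSeries ℂ)),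
    IsFractionRing.injective _ _, fun p => ?_, EF_hC _, EF_hC' _⟩
  exact EF_deriv_alg _ p


section Taylor
open PowerSeries Topology

/-- Functions analytic at `z`. -/
def anAlg (z : ℂ) : Subalgebra ℂ (ℂ → ℂ) where
  carrier := {f | AnalyticAt ℂ f z}
  mul_mem' := fun hf hg => AnalyticAt.mul hf hg
  add_mem' := fun hf hg => AnalyticAt.add hf hg
  algebraMap_mem' := fun r => (analyticAt_const : AnalyticAt ℂ (fun _ => r) z)

lemma mem_anAlg {z : ℂ} {f : ℂ → ℂ} : f ∈ anAlg z ↔ AnalyticAt ℂ f z := Iff.rfl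

noncomputable def tayFun (z : ℂ) (f : ℂ → ℂ) : PowerSeries ℂ :=
  PowerSeries.mk fun n => iteratedDeriv n f z / (n.factorial : ℂ)

lemma tayFun_const (z c : ℂ) : tayFun z (fun _ => c) = C c := by
  ext n
  rw [tayFun, coeff_mk, iteratedDeriv_const, coeff_C]
  split_ifs with h <;> simp [h]

lemma tayFun_mul {z : ℂ} {f g : ℂ → ℂ} (hf : AnalyticAt ℂ f z) (hg : AnalyticAt ℂ g z) :
    tayFun z (f * g) = tayFun z f * tayFun z g := by
  ext n
  simp only [tayFun, coeff_mk, iteratedDeriv_mul hf.contDiffAt hg.contDiffAt, Finset.sum_div,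
    PowerSeries.coeff_mul,
    Finset.Nat.sum_antidiagonal_eq_sum_range_succ_mk, Nat.succ_eq_add_one]
  refine Finset.sum_congr rfl fun i hi ↦ ?_
  rw [Nat.cast_choose _ (by grind)]
  field_simp [Nat.factorial_ne_zero]

lemma tayFun_congr {z : ℂ} {f g : ℂ → ℂ} (h : f =ᶠ[𝓝 z] g) : tayFun z f = tayFun z g := by
  ext n
  simp only [tayFun, coeff_mk]
  rw [(h.iteratedDeriv n).eq_of_nhds]

lemma tayFun_deriv (z : ℂ) (f : ℂ → ℂ) :
    tayFun z (deriv f) = PowerSeries.derivative ℂ (tayFun z f) := by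
  ext n
  rw [coeff_derivative]
  simp only [tayFun, coeff_mk]
  rw [iteratedDeriv_succ', Nat.factorial_succ]
  push_cast
  have : (n : ℂ) + 1 ≠ 0 := by exact_mod_cast Nat.succ_ne_zero n
  field_simp

lemma tayFun_coeff_zero (z : ℂ) (f : ℂ → ℂ) : constantCoeff (tayFun z f) = f z := by
  rw [← coeff_zero_eq_constantCoeff_apply]
  simp [tayFun]

noncomputable def tay (z : ℂ) : anAlg z →ₐ[ℂ] PowerSeries ℂ where
  toFun f := tayFun z f
  map_one' := by
    change tayFun z (fun _ => 1) = 1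
    rw [tayFun_const]; simp
  map_zero' := by
    change tayFun z (fun _ => 0) = 0
    rw [tayFun_const]; simp
  map_add' f g := by
    ext n
    simp [tayFun]
    rw [iteratedDeriv_add (mem_anAlg.1 f.2).contDiffAt (mem_anAlg.1 g.2).contDiffAt]
    ring
  map_mul' f g := tayFun_mul f.2 g.2
  commutes' r := tayFun_const z r

end Taylor

section OneVar
open Topology

lemma isAlgebraic_of_eval₂ {E : Type*} [Field E] [Algebra ℂ E] {X y : E} (hX : Transcendental ℂ X)
    {p : Polynomial (Polynomial ℂ)} (hp : p ≠ 0)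
    (h : p.eval₂ (Polynomial.aeval X : Polynomial ℂ →ₐ[ℂ] E).toRingHom y = 0) :
    IsAlgebraic (IntermediateField.adjoin ℂ {X}) y := by
  have hm : X ∈ IntermediateField.adjoin ℂ {X} := IntermediateField.mem_adjoin_simple_self ℂ X
  let g : Polynomial ℂ →ₐ[ℂ] IntermediateField.adjoin ℂ {X} :=
    Polynomial.aeval (⟨X, hm⟩ : IntermediateField.adjoin ℂ {X})
  have hcomp : (algebraMap (IntermediateField.adjoin ℂ {X}) E).comp g.toRingHom =
      (Polynomial.aeval X : Polynomial ℂ →ₐ[ℂ] E).toRingHom := by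
    have : ((IntermediateField.adjoin ℂ {X}).val).comp g = Polynomial.aeval X := by
      ext; simp [g]
    exact congrArg AlgHom.toRingHom this
  have hg : Function.Injective g := by
    have h1 : Function.Injective (Polynomial.aeval X : Polynomial ℂ →ₐ[ℂ] E) :=
      transcendental_iff_injective.1 hX
    intro a b hab
    apply h1
    have := congrArg (algebraMap (IntermediateField.adjoin ℂ {X}) E) hab
    have e := fun a => congrArg (fun f : Polynomial ℂ →+* E => f a) hcomp
    exact (e a).symm.trans (this.trans (e b))
  refine ⟨p.map g.toRingHom, ?_, ?_⟩
  · rwa [Ne, Polynomial.map_eq_zero_iff (f := g.toRingHom) hg]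
  · rw [Polynomial.aeval_def, Polynomial.eval₂_map, hcomp, h]

/-- Evaluation of an element of `anAlg`. -/
def evAn (z1 z : ℂ) : anAlg z1 →ₐ[ℂ] ℂ :=
  (Pi.evalAlgHom ℂ (fun _ : ℂ => ℂ) z).comp (anAlg z1).val

lemma evAn_apply (z1 z : ℂ) (f : anAlg z1) : evAn z1 z f = f.1 z := rfl

theorem one_var_point {ι : Type} [Fintype ι] (z1 : ℂ) (f u : ℂ → ℂ) (fs hs : ι → ℂ → ℂ)
    (c : ι → ℂ) (μ : ℂ) (hμ : μ ≠ 0)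
    (hf : AnalyticAt ℂ f z1) (hu : AnalyticAt ℂ u z1)
    (hfs : ∀ j, AnalyticAt ℂ (fs j) z1) (hhs : ∀ j, AnalyticAt ℂ (hs j) z1)
    (hf0 : f z1 ≠ 0) (hu0 : u z1 ≠ 0) (hfs0 : ∀ j, fs j z1 ≠ 0) (hhs0 : ∀ j, hs j z1 ≠ 0)
    (hue : ∀ᶠ z in 𝓝 z1, deriv u z * f z = μ * deriv f z * u z)
    (hhse : ∀ j, ∀ᶠ z in 𝓝 z1, deriv (hs j) z * fs j z = c j * deriv (fs j) z * hs j z)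
    (p : Polynomial (Polynomial ℂ)) (hp : p ≠ 0)
    (hpf : ∀ᶠ z in 𝓝 z1, p.eval₂ (Polynomial.evalRingHom z) (f z) = 0)
    (ps : ι → Polynomial (Polynomial ℂ)) (hps : ∀ j, ps j ≠ 0)
    (hpfs : ∀ j, ∀ᶠ z in 𝓝 z1, (ps j).eval₂ (Polynomial.evalRingHom z) (fs j z) = 0)
    (P Q : MvPolynomial ι ℂ) (hQ : MvPolynomial.eval (fun j => hs j z1) Q ≠ 0)
    (h : ∀ᶠ z in 𝓝 z1, Complex.exp (u z) * MvPolynomial.eval (fun j => hs j z) Q =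
      MvPolynomial.eval (fun j => hs j z) P) : deriv f z1 = 0 := by
  obtain ⟨E, _, _, _, φ, hφ, hφd, hC, hC'⟩ := exists_EF
  let T : anAlg z1 →ₐ[ℂ] E := φ.comp (tay z1)
  have hT0 : ∀ F : anAlg z1, F.1 z1 ≠ 0 → T F ≠ 0 := by
    intro F hF h0
    have h1 : tay z1 F = 0 := hφ (by rw [map_zero]; exact h0)
    apply hF
    rw [← tayFun_coeff_zero z1 F.1]
    change PowerSeries.constantCoeff (tay z1 F) = 0
    rw [h1, map_zero]
  have hTc : ∀ F G : anAlg z1, F.1 =ᶠ[𝓝 z1] G.1 → T F = T G := by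
    intro F G hFG
    exact congrArg φ (tayFun_congr hFG)
  let D : anAlg z1 → anAlg z1 := fun F => ⟨deriv F.1, AnalyticAt.deriv F.2⟩
  have hTd : ∀ F : anAlg z1, (T F)′ = T (D F) := by
    intro F
    change (φ (tay z1 F))′ = φ (tay z1 (D F))
    rw [hφd]
    exact congrArg φ (tayFun_deriv z1 F.1).symm
  let I : anAlg z1 := ⟨id, analyticAt_id⟩
  let F : anAlg z1 := ⟨f, hf⟩
  let U : anAlg z1 := ⟨u, hu⟩
  let FS : ι → anAlg z1 := fun j => ⟨fs j, hfs j⟩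
  let HS : ι → anAlg z1 := fun j => ⟨hs j, hhs j⟩
  let EX : anAlg z1 := ⟨fun z => Complex.exp (u z), hu.cexp⟩
  have hX : (T I)′ = 1 := by
    rw [hTd, ← map_one T]
    apply hTc
    exact Filter.Eventually.of_forall fun z => by simp [D, I]
  have hXt : Transcendental ℂ (T I) := transcendental_of_deriv hC (by rw [hX]; exact one_ne_zero)
  have halg : ∀ (p : Polynomial (Polynomial ℂ)) (G : anAlg z1), p ≠ 0 →
      (∀ᶠ z in 𝓝 z1, p.eval₂ (Polynomial.evalRingHom z) (G.1 z) = 0) →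
      IsAlgebraic (IntermediateField.adjoin ℂ {T I}) (T G) := by
    intro p G hp hG
    apply isAlgebraic_of_eval₂ hXt hp
    have h1 : T (p.eval₂ (Polynomial.aeval I : Polynomial ℂ →ₐ[ℂ] anAlg z1).toRingHom G) = 0 := by
      rw [← map_zero T]
      apply hTc
      filter_upwards [hG] with z hz
      rw [← evAn_apply z1 z]
      change (evAn z1 z).toRingHom _ = _
      rw [Polynomial.hom_eval₂]
      have : (evAn z1 z).toRingHom.comp
          (Polynomial.aeval I : Polynomial ℂ →ₐ[ℂ] anAlg z1).toRingHom =
          Polynomial.evalRingHom z := by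
        have : (evAn z1 z).comp (Polynomial.aeval I) = Polynomial.aeval z := by
          ext; simp [evAn_apply, I]
        have h2 := congrArg AlgHom.toRingHom this
        refine h2.trans ?_
        ext <;> simp
      rw [this]
      exact hz
    change T.toRingHom _ = 0 at h1
    rw [Polynomial.hom_eval₂] at h1
    have : T.toRingHom.comp
          (Polynomial.aeval I : Polynomial ℂ →ₐ[ℂ] anAlg z1).toRingHom =
          (Polynomial.aeval (T I) : Polynomial ℂ →ₐ[ℂ] E).toRingHom := by
      have : T.comp (Polynomial.aeval I) = Polynomial.aeval (T I) := by
        ext; simp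
      exact congrArg AlgHom.toRingHom this
    rw [this] at h1
    exact h1
  have hlog : ∀ (G K : anAlg z1) (c : ℂ), G.1 z1 ≠ 0 →
      (∀ᶠ z in 𝓝 z1, deriv K.1 z * G.1 z = c * deriv G.1 z * K.1 z) →
      (T K)′ = algebraMap ℂ E c * Differential.logDeriv (T G) * T K := by
    intro G K c hG hGK
    have h1 : T (D K * G) = T (algebraMap ℂ _ c * D G * K) := hTc _ _ hGK
    rw [map_mul, map_mul, map_mul, ← hTd, ← hTd, AlgHom.commutes] at h1
    have := hT0 G hG
    unfold Differential.logDeriv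
    field_simp
    linear_combination h1
  have hmv : ∀ (R : MvPolynomial ι ℂ) (z : ℂ), (MvPolynomial.aeval HS R).1 z =
      MvPolynomial.eval (fun j => hs j z) R := by
    intro R z
    have : (evAn z1 z).comp (MvPolynomial.aeval HS) = MvPolynomial.aeval (fun j => hs j z) := by
      ext j; simp [evAn_apply, HS]
    exact congrArg (fun f : MvPolynomial ι ℂ →ₐ[ℂ] ℂ => f R) this
  have hmT : ∀ R : MvPolynomial ι ℂ, T (MvPolynomial.aeval HS R) =
      MvPolynomial.aeval (fun j => T (HS j)) R := by
    intro R
    have : T.comp (MvPolynomial.aeval HS) = MvPolynomial.aeval (fun j => T (HS j)) := by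
      ext j; simp
    exact congrArg (fun f : MvPolynomial ι ℂ →ₐ[ℂ] E => f R) this
  have key := alg_main hC hC' hX (fun j => T (FS j)) (fun j => T (HS j))
    (fun j => hT0 _ (hhs0 j)) c (fun j => halg (ps j) (FS j) (hps j) (hpfs j))
    (fun j => hlog (FS j) (HS j) (c j) (hfs0 j) (hhse j))
    (T F) (T U) (T EX) (halg p F hp hpf) μ hμ (hT0 U hu0) (hlog F U μ hf0 hue)
    (hT0 EX (Complex.exp_ne_zero _)) (by
      rw [hTd, hTd, ← map_mul]
      apply hTc
      filter_upwards [hu.eventually_analyticAt] with z hz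
      change deriv (fun z => Complex.exp (u z)) z = deriv u z * Complex.exp (u z)
      rw [deriv_cexp hz.differentiableAt, mul_comm]) P Q
    (by
      rw [← hmT]
      apply hT0
      rw [hmv]; exact hQ)
    (by
      rw [← hmT, ← hmT, ← map_mul]
      apply hTc
      filter_upwards [h] with z hz
      change Complex.exp (u z) * (MvPolynomial.aeval HS Q).1 z = _
      rw [hmv, hmv, hz])
  by_contra hne
  rw [hTd] at key
  exact hT0 (D F) hne key

end OneVar

section Cpow
open Topology

/-- `g` is tame on `Ω` with respect to the principal branch. -/
def GoodOn (g : ℂ → ℂ) (Ω : Set ℂ) : Prop :=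
  (∀ z ∈ Ω, g z ∈ Complex.slitPlane) ∨ ∃ c, ∀ z ∈ Ω, g z = c

lemma GoodOn.mono {g : ℂ → ℂ} {Ω Ω' : Set ℂ} (h : GoodOn g Ω) (hs : Ω' ⊆ Ω) : GoodOn g Ω' := by
  rcases h with h | ⟨c, h⟩
  · exact Or.inl fun z hz => h z (hs hz)
  · exact Or.inr ⟨c, fun z hz => h z (hs hz)⟩

lemma exists_goodOn {g : ℂ → ℂ} {Ω : Set ℂ} (ho : IsOpen Ω) (hne : Ω.Nonempty)
    (hg : DifferentiableOn ℂ g Ω) :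
    ∃ Ω' ⊆ Ω, IsOpen Ω' ∧ Ω'.Nonempty ∧ GoodOn g Ω' := by
  by_cases hex : ∃ z ∈ Ω, g z ∈ Complex.slitPlane
  · obtain ⟨z, hz, hgz⟩ := hex
    exact ⟨Ω ∩ g ⁻¹' Complex.slitPlane, Set.inter_subset_left,
      hg.continuousOn.isOpen_inter_preimage ho Complex.isOpen_slitPlane, ⟨z, hz, hgz⟩,
      Or.inl fun z hz => hz.2⟩
  · push Not at hex
    obtain ⟨z, hz⟩ := hne
    have ha : AnalyticAt ℂ g z := hg.analyticAt (ho.mem_nhds hz)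
    rcases ha.eventually_constant_or_nhds_le_map_nhds with h | h
    · obtain ⟨W, hW, hWo, hzW⟩ := eventually_nhds_iff.1 h
      exact ⟨Ω ∩ W, Set.inter_subset_left, ho.inter hWo, ⟨z, hz, hzW⟩,
        Or.inr ⟨g z, fun w hw => hW w hw.2⟩⟩
    · exfalso
      have h1 : Complex.slitPlaneᶜ ∈ Filter.map g (𝓝 z) :=
        Filter.mem_map.2 (Filter.mem_of_superset (ho.mem_nhds hz) fun w hw => hex w hw)
      have h2 := h h1
      have h3 : Filter.Tendsto (fun t : ℝ => g z + t * Complex.I) (𝓝[>] 0) (𝓝 (g z)) := by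
        have : Continuous (fun t : ℝ => g z + t * Complex.I) := by fun_prop
        have := this.tendsto 0
        simp only [Complex.ofReal_zero, zero_mul, add_zero] at this
        exact this.mono_left nhdsWithin_le_nhds
      obtain ⟨t, ht, ht0⟩ := ((h3.eventually h2).and self_mem_nhdsWithin).exists
      have h5 := hex z hz
      simp only [Set.mem_compl_iff, Complex.mem_slitPlane_iff, not_or, not_not] at ht h5
      have h4 := ht.2
      simp [h5.2] at h4
      exact (ne_of_gt ht0) h4

lemma exists_goodOn_finset {ι : Type*} (s : Finset ι) (g : ι → ℂ → ℂ) {Ω : Set ℂ} (ho : IsOpen Ω)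
    (hne : Ω.Nonempty) (hg : ∀ j, DifferentiableOn ℂ (g j) Ω) :
    ∃ Ω' ⊆ Ω, IsOpen Ω' ∧ Ω'.Nonempty ∧ ∀ j ∈ s, GoodOn (g j) Ω' := by
  classical
  induction s using Finset.induction_on with
  | empty => exact ⟨Ω, subset_rfl, ho, hne, by simp⟩
  | insert a s _ ih =>
    obtain ⟨Ω1, h1, h2, h3, h4⟩ := ih
    obtain ⟨Ω2, k1, k2, k3, k4⟩ := exists_goodOn h2 h3 ((hg a).mono h1)
    refine ⟨Ω2, k1.trans h1, k2, k3, fun j hj => ?_⟩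
    rcases Finset.mem_insert.1 hj with rfl | hj
    · exact k4
    · exact (h4 j hj).mono k1

lemma GoodOn.cpow {g : ℂ → ℂ} {Ω : Set ℂ} (h : GoodOn g Ω) (ho : IsOpen Ω)
    (hg : DifferentiableOn ℂ g Ω) (c : ℂ) {z : ℂ} (hz : z ∈ Ω) (h0 : ∀ z ∈ Ω, g z ≠ 0) :
    AnalyticAt ℂ (fun z => g z ^ c) z ∧
    ∀ᶠ w in 𝓝 z, deriv (fun z => g z ^ c) w * g w = c * deriv g w * g w ^ c := by
  rcases h with h | ⟨a, h⟩
  · refine ⟨(hg.analyticAt (ho.mem_nhds hz)).cpow analyticAt_const (h z hz), ?_⟩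
    filter_upwards [ho.mem_nhds hz] with w hw
    have hd := (hg.differentiableAt (ho.mem_nhds hw)).hasDerivAt
    rw [(hd.cpow_const (h w hw)).deriv, Complex.cpow_sub _ _ (h0 w hw), Complex.cpow_one]
    have := h0 w hw
    field_simp
  · have hc : (fun z => g z ^ c) =ᶠ[𝓝 z] fun _ => a ^ c := by
      filter_upwards [ho.mem_nhds hz] with w hw
      rw [h w hw]
    have hc' : g =ᶠ[𝓝 z] fun _ => a := by
      filter_upwards [ho.mem_nhds hz] with w hw
      rw [h w hw]
    refine ⟨analyticAt_const.congr hc.symm, ?_⟩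
    filter_upwards [hc.deriv, hc'.deriv] with w h1 h2
    rw [h1, h2]; simp

theorem one_var {ι : Type} [Fintype ι] (Ω : Set ℂ) (ho : IsOpen Ω) (f : ℂ → ℂ) (fs : ι → ℂ → ℂ)
    (c : ι → ℂ) (μ : ℂ) (hμ : μ ≠ 0)
    (hf : DifferentiableOn ℂ f Ω) (hfs : ∀ j, DifferentiableOn ℂ (fs j) Ω)
    (hf0 : ∀ z ∈ Ω, f z ≠ 0) (hfs0 : ∀ j, ∀ z ∈ Ω, fs j z ≠ 0)
    (p : Polynomial (Polynomial ℂ)) (hp : p ≠ 0)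
    (hpf : ∀ z ∈ Ω, p.eval₂ (Polynomial.evalRingHom z) (f z) = 0)
    (ps : ι → Polynomial (Polynomial ℂ)) (hps : ∀ j, ps j ≠ 0)
    (hpfs : ∀ j, ∀ z ∈ Ω, (ps j).eval₂ (Polynomial.evalRingHom z) (fs j z) = 0)
    (P Q : MvPolynomial ι ℂ)
    (hQ : ∀ z ∈ Ω, MvPolynomial.eval (fun j => fs j z ^ c j) Q ≠ 0)
    (h : ∀ z ∈ Ω, Complex.exp (f z ^ μ) * MvPolynomial.eval (fun j => fs j z ^ c j) Q =
      MvPolynomial.eval (fun j => fs j z ^ c j) P) : ∀ z ∈ Ω, deriv f z = 0 := by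
  by_contra hcon
  push Not at hcon
  obtain ⟨z0, hz0, hd⟩ := hcon
  have ho1 : IsOpen (Ω ∩ (deriv f) ⁻¹' {0}ᶜ) :=
    (hf.deriv ho).continuousOn.isOpen_inter_preimage ho isOpen_compl_singleton
  obtain ⟨Ω1, s1, o1, n1, g1⟩ := exists_goodOn ho1 ⟨z0, hz0, hd⟩ (hf.mono Set.inter_subset_left)
  obtain ⟨Ω2, s2, o2, ⟨z1, hz1⟩, g2⟩ := exists_goodOn_finset Finset.univ fs o1 n1
    (fun j => (hfs j).mono (s1.trans Set.inter_subset_left))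
  have hsub : Ω2 ⊆ Ω := (s2.trans s1).trans Set.inter_subset_left
  have hev : ∀ᶠ z in 𝓝 z1, z ∈ Ω := Filter.mem_of_superset (o2.mem_nhds hz1) hsub
  have hzΩ := hsub hz1
  have A := (g1.mono s2).cpow o2 (hf.mono hsub) μ hz1 (fun z hz => hf0 z (hsub hz))
  have B := fun j => (g2 j (Finset.mem_univ j)).cpow o2 ((hfs j).mono hsub) (c j) hz1
    (fun z hz => hfs0 j z (hsub hz))
  have key := one_var_point z1 f (fun z => f z ^ μ) fs (fun j z => fs j z ^ c j) c μ hμ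
    (hf.analyticAt hev) A.1 (fun j => (hfs j).analyticAt hev) (fun j => (B j).1)
    (hf0 _ hzΩ) (by simp [Complex.cpow_eq_zero_iff, hf0 _ hzΩ]) (fun j => hfs0 j _ hzΩ)
    (fun j => by simp [Complex.cpow_eq_zero_iff, hfs0 j _ hzΩ])
    A.2 (fun j => (B j).2) p hp (hev.mono hpf) ps hps (fun j => hev.mono (hpfs j)) P Q (hQ _ hzΩ)
    (hev.mono h)
  exact (s1 (s2 hz1)).2 key

end Cpow

section MultiVar
open Topology

/-- Restriction of a polynomial in `n + 1` variables to a line in the first `n` variables. -/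
noncomputable def linePoly {n : ℕ} (a v : Fin n → ℂ) :
    MvPolynomial (Fin (n + 1)) ℂ →+* Polynomial (Polynomial ℂ) :=
  MvPolynomial.eval₂Hom (Polynomial.C.comp Polynomial.C)
    (Fin.snoc (α := fun _ => Polynomial (Polynomial ℂ))
      (fun i => Polynomial.C (Polynomial.C (a i) + Polynomial.X * Polynomial.C (v i)))
      Polynomial.X)

lemma linePoly_eval {n : ℕ} (a v : Fin n → ℂ) (P : MvPolynomial (Fin (n + 1)) ℂ) (z y : ℂ) :
    (linePoly a v P).eval₂ (Polynomial.evalRingHom z) y =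
      MvPolynomial.eval (Fin.snoc (α := fun _ => ℂ) (a + z • v) y) P := by
  have : (Polynomial.eval₂RingHom (Polynomial.evalRingHom z) y).comp (linePoly a v) =
      MvPolynomial.eval (Fin.snoc (α := fun _ => ℂ) (a + z • v) y) := by
    apply MvPolynomial.ringHom_ext
    · intro r
      simp [linePoly]
    · intro i
      refine Fin.lastCases ?_ (fun i => ?_) i
      · simp [linePoly]
      · simp [linePoly]; ring
  exact congrArg (fun f : MvPolynomial (Fin (n + 1)) ℂ →+* ℂ => f P) this

lemma linePoly_ne {n : ℕ} (a v : Fin n → ℂ) (P : MvPolynomial (Fin (n + 1)) ℂ)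
    (h : ∃ y : ℂ, MvPolynomial.eval (Fin.snoc (α := fun _ => ℂ) a y) P ≠ 0) :
    linePoly a v P ≠ 0 := by
  obtain ⟨y, hy⟩ := h
  intro h0
  have := linePoly_eval a v P 0 y
  rw [h0] at this
  simp at this
  exact hy this.symm

/-- Points over which the polynomial does not vanish identically. -/
def nvSet {n : ℕ} (P : MvPolynomial (Fin (n + 1)) ℂ) : Set (Fin n → ℂ) :=
  {a | ∃ y : ℂ, MvPolynomial.eval (Fin.snoc (α := fun _ => ℂ) a y) P ≠ 0}

lemma isOpen_nvSet {n : ℕ} (P : MvPolynomial (Fin (n + 1)) ℂ) : IsOpen (nvSet P) := by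
  have : nvSet P = ⋃ y : ℂ, {a | MvPolynomial.eval (Fin.snoc (α := fun _ => ℂ) a y) P ≠ 0} := by
    ext a; simp [nvSet]
  rw [this]
  refine isOpen_iUnion fun y => ?_
  have hc : Continuous fun a : Fin n → ℂ => Fin.snoc (α := fun _ => ℂ) a y := by
    refine continuous_pi fun i => ?_
    refine Fin.lastCases ?_ (fun i => ?_) i
    · simp [continuous_const]
    · simp [continuous_apply]
  exact isOpen_ne_fun ((MvPolynomial.continuous_eval P).comp hc) continuous_const

lemma dense_nvSet {n : ℕ} (P : MvPolynomial (Fin (n + 1)) ℂ) (hP : P ≠ 0) : Dense (nvSet P) := by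
  rw [dense_iff_inter_open]
  rintro W hW ⟨a, ha⟩
  obtain ⟨r, hr, hb⟩ := Metric.isOpen_iff.1 hW a ha
  by_contra hcon
  apply hP
  apply MvPolynomial.funext_set
    (Fin.snoc (α := fun _ => Set ℂ) (fun i => Metric.ball (a i) r) Set.univ)
  · intro i
    refine Fin.lastCases ?_ (fun i => ?_) i
    · simp [Set.infinite_univ]
    · simpa using infinite_of_mem_nhds (a i) (Metric.ball_mem_nhds _ hr)
  · intro x hx
    rw [map_zero]
    by_contra hne
    apply hcon
    refine ⟨Fin.init x, hb ?_, x (Fin.last n), ?_⟩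
    · rw [ball_pi _ hr]
      intro i _
      have := hx i.castSucc (Set.mem_univ _)
      simpa [Fin.init] using this
    · rwa [Fin.snoc_init_self]

theorem locally_const (κ κ₁ κ₂ : ℕ)
    (V : Set (Fin κ → ℂ)) 
    (H : (Fin κ → ℂ) → ℂ) (Hs : Fin (κ₁ + κ₂) → (Fin κ → ℂ) → ℂ)
    (hH : IsNashOn κ V H) (hHs : ∀ j, IsNashOn κ V (Hs j))
    (hHne : ∀ ξ ∈ V, H ξ ≠ 0) (hHsne : ∀ j, ∀ ξ ∈ V, Hs j ξ ≠ 0)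
    (μ : ℝ) (hμ : μ ≠ 0) (μs : Fin (κ₁ + κ₂) → ℝ) 
    (P Q : MvPolynomial (Fin κ₁) ℂ) 
    (hQne : ∀ ξ ∈ V,
      MvPolynomial.eval
        (fun i => Hs (Fin.castAdd κ₂ i) ξ ^ ((μs (Fin.castAdd κ₂ i) : ℂ))) Q ≠ 0)
    (heq : ∀ ξ ∈ V,
      Complex.exp (H ξ ^ ((μ : ℂ))) =
        (MvPolynomial.eval
            (fun i => Hs (Fin.castAdd κ₂ i) ξ ^ ((μs (Fin.castAdd κ₂ i) : ℂ))) P /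
          MvPolynomial.eval
            (fun i => Hs (Fin.castAdd κ₂ i) ξ ^ ((μs (Fin.castAdd κ₂ i) : ℂ))) Q) *
        ∏ j : Fin κ₂, Hs (Fin.natAdd κ₁ j) ξ ^ ((μs (Fin.natAdd κ₁ j) : ℂ)))
    (x : Fin κ → ℂ) (hx : x ∈ V) : ∀ᶠ y in 𝓝 x, H y = H x := by
  obtain ⟨U0, U0o, hxU0, U0V, P0, hP0, hP0H⟩ := hH.2 x hx
  choose Us Uso hxUs UsV Ps hPs hPsH using fun j => (hHs j).2 x hx
  have hW : U0 ∩ ⋂ j, Us j ∈ 𝓝 x :=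
    (U0o.inter (isOpen_iInter_of_finite Uso)).mem_nhds ⟨hxU0, Set.mem_iInter.2 hxUs⟩
  obtain ⟨r, hr, hb⟩ := Metric.mem_nhds_iff.1 hW
  have hb0 : Metric.ball x r ⊆ U0 := fun y hy => (hb hy).1
  have hbs : ∀ j, Metric.ball x r ⊆ Us j := fun j y hy => Set.mem_iInter.1 (hb hy).2 j
  have hbV : Metric.ball x r ⊆ V := hb0.trans U0V
  have hd : Dense (⋂ o : Option (Fin (κ₁ + κ₂)), nvSet (o.elim P0 Ps)) := by
    apply dense_iInter_of_isOpen
    · intro o; exact isOpen_nvSet _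
    · intro o
      cases o with
      | none => exact dense_nvSet _ hP0
      | some j => exact dense_nvSet _ (hPs j)
  obtain ⟨a, hab, ha⟩ := hd.inter_open_nonempty _ Metric.isOpen_ball ⟨x, Metric.mem_ball_self hr⟩
  have ha0 : a ∈ nvSet P0 := Set.mem_iInter.1 ha none
  have has : ∀ j, a ∈ nvSet (Ps j) := fun j => Set.mem_iInter.1 ha (some j)
  have key : ∀ y ∈ Metric.ball x r, H y = H a := by
    intro y hy
    set v := y - a with hv
    let L : ℂ → (Fin κ → ℂ) := fun z => a + z • v
    have hLd : Differentiable ℂ L := by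
      intro z; exact (differentiableAt_const a).add (differentiableAt_id.smul_const v)
    set Ω := L ⁻¹' (Metric.ball x r) with hΩ
    have hΩo : IsOpen Ω := Metric.isOpen_ball.preimage hLd.continuous
    have hΩc : Convex ℝ Ω := by
      intro z hz w hw s t hs ht hst
      have := convex_ball x r hz hw hs ht hst
      have e : s • L z + t • L w = L (s • z + t • w) := by
        ext i
        have hst' : (s : ℂ) + t = 1 := by exact_mod_cast hst
        simp [L]
        linear_combination (a i) * hst'
      rw [e] at this
      exact this
    have hmem : ∀ z ∈ Ω, L z ∈ V := fun z hz => hbV hz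
    have hdiff : ∀ G : (Fin κ → ℂ) → ℂ, DifferentiableOn ℂ G V →
        DifferentiableOn ℂ (fun z => G (L z)) Ω := by
      intro G hG
      exact hG.comp hLd.differentiableOn hmem
    have hder := one_var Ω hΩo (fun z => H (L z)) (fun j z => Hs j (L z))
      (fun j => (μs j : ℂ)) (μ : ℂ) (by exact_mod_cast hμ) (hdiff H hH.1)
      (fun j => hdiff _ (hHs j).1) (fun z hz => hHne _ (hmem z hz))
      (fun j z hz => hHsne j _ (hmem z hz)) (linePoly a v P0) (linePoly_ne a v P0 ha0)
      (fun z hz => by rw [linePoly_eval]; exact hP0H _ (hb0 hz))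
      (fun j => linePoly a v (Ps j)) (fun j => linePoly_ne a v (Ps j) (has j))
      (fun j z hz => by rw [linePoly_eval]; exact hPsH j _ (hbs j hz))
      (MvPolynomial.rename (Fin.castAdd κ₂) P *
        ∏ j : Fin κ₂, MvPolynomial.X (Fin.natAdd κ₁ j))
      (MvPolynomial.rename (Fin.castAdd κ₂) Q)
      (fun z hz => by
        rw [MvPolynomial.eval_rename]
        exact hQne _ (hmem z hz))
      (fun z hz => by
        rw [map_mul, MvPolynomial.eval_rename, MvPolynomial.eval_rename, map_prod]
        simp only [MvPolynomial.eval_X]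
        rw [heq _ (hmem z hz)]
        have := hQne _ (hmem z hz)
        simp only [Function.comp_def]
        field_simp)
    have h0 : (0 : ℂ) ∈ Ω := by simpa [hΩ, L] using hab
    have h1 : (1 : ℂ) ∈ Ω := by simpa [hΩ, L, hv] using hy
    obtain ⟨b, hb'⟩ := hΩo.exists_is_const_of_deriv_eq_zero hΩc.isPreconnected (hdiff H hH.1) hder
    have e0 := hb' 0 h0
    have e1 := hb' 1 h1
    simp [L, hv] at e0 e1
    rw [e0, e1]
  filter_upwards [Metric.ball_mem_nhds x hr] with y hy
  rw [key y hy, key x (Metric.mem_ball_self hr)]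

end MultiVar

/-- Lemma 2.2 of the paper: if `exp(H^μ)` equals a rational expression
`(P/Q)(H₁^{μ₁}, …, H_{κ₁}^{μ_{κ₁}}) ⬝ ∏_{j=κ₁+1}^{κ₁+κ₂} H_j^{μ_j}` of Nash
power functions on a connected open set, then `H` is constant.  Complex powers
with real exponents are principal-branch powers (`Complex.cpow`). -/
theorem const_of_exp_pow_eq_rational_weak_exponents (κ κ₁ κ₂ : ℕ) (hκ : 0 < κ) (hκ₁ : 0 < κ₁)
    (V : Set (Fin κ → ℂ)) (hVo : IsOpen V) (hVc : IsConnected V)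
    (H : (Fin κ → ℂ) → ℂ) (Hs : Fin (κ₁ + κ₂) → (Fin κ → ℂ) → ℂ)
    (hH : IsNashOn κ V H) (hHs : ∀ j, IsNashOn κ V (Hs j))
    (hHne : ∀ ξ ∈ V, H ξ ≠ 0) (hHsne : ∀ j, ∀ ξ ∈ V, Hs j ξ ≠ 0)
    (μ : ℝ) (hμ : μ ≠ 0) (μs : Fin (κ₁ + κ₂) → ℝ) (hμs : ∃ j, μs j ≠ 0)
    (P Q : MvPolynomial (Fin κ₁) ℂ) (hQ : Q ≠ 0)
    (hQne : ∀ ξ ∈ V,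
      MvPolynomial.eval
        (fun i => Hs (Fin.castAdd κ₂ i) ξ ^ ((μs (Fin.castAdd κ₂ i) : ℂ))) Q ≠ 0)
    (heq : ∀ ξ ∈ V,
      Complex.exp (H ξ ^ ((μ : ℂ))) =
        (MvPolynomial.eval
            (fun i => Hs (Fin.castAdd κ₂ i) ξ ^ ((μs (Fin.castAdd κ₂ i) : ℂ))) P /
          MvPolynomial.eval
            (fun i => Hs (Fin.castAdd κ₂ i) ξ ^ ((μs (Fin.castAdd κ₂ i) : ℂ))) Q) *
        ∏ j : Fin κ₂, Hs (Fin.natAdd κ₁ j) ξ ^ ((μs (Fin.natAdd κ₁ j) : ℂ))) :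
    ∀ ξ ∈ V, ∀ ξ' ∈ V, H ξ = H ξ' := by
  have hloc := locally_const κ κ₁ κ₂ V H Hs hH hHs hHne hHsne μ hμ μs P Q hQne heq
  intro ξ hξ ξ' hξ'
  refine hVo.is_const_of_fderiv_eq_zero (𝕜 := ℂ) hVc.isPreconnected hH.1 ?_ hξ hξ'
  intro x hx
  have h1 : H =ᶠ[nhds x] fun _ => H x := hloc x hx
  rw [h1.fderiv_eq]
  simp
end
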